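/- For every rational affine cone a in V (or in any rational quotient of V), the meromorphic function μ(a) is analytic in a neighborhood of 0, with rational Taylor coefficients with respect to an integral basis. -/

import Mathlib

open MeasureTheory Filter Topology Set
open scoped RealInnerProductSpace Pointwise BigOperators

noncomputable section

/-- the ambient rational vector space: `ℝ^d` with the standard inner product, which is used
to identify `V` with its dual space `V^*`. -/
abbrev Vd (d : ℕ) := EuclideanSpace ℝ (Fin d)

variable {d : ℕ}

/-- the duality pairing `⟨ξ, x⟩` between `V^*` and `V`, realized by the standard inner
product of `ℝ^d`. -/
def pairE {d : ℕ} (ξ x : Vd d) : ℝ := @inner ℝ _ _ ξ x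

/-- `Λ` is a lattice of its span: it is generated by finitely many `ℝ`-independent vectors. -/
def IsLatticeSub (Λ : AddSubgroup (Vd d)) : Prop :=
  ∃ (k : ℕ) (v : Fin k → Vd d), LinearIndependent ℝ v ∧
    Λ = AddSubgroup.closure (Set.range v)

/-- `Λ` is a full-rank lattice in `ℝ^d`. -/
def IsFullLattice (Λ : AddSubgroup (Vd d)) : Prop :=
  IsLatticeSub Λ ∧ Submodule.span ℝ (Λ : Set (Vd d)) = ⊤

/-- `x` is a rational point with respect to the lattice `Λ`. -/
def IsRatPoint (Λ : AddSubgroup (Vd d)) (x : Vd d) : Prop :=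
  ∃ q : ℤ, q ≠ 0 ∧ (q : ℝ) • x ∈ Λ

/-- viewing `φ ∈ V` as a linear functional via the standard pairing, it takes integer values
on `Λ`, i.e. it belongs to the dual lattice. -/
def IsDualIntegral (Λ : AddSubgroup (Vd d)) (φ : Vd d) : Prop :=
  ∀ x ∈ Λ, ∃ n : ℤ, (pairE (φ) (x)) = (n : ℝ)

/-- a rational polyhedron (inside the span of `Λ`): a finite intersection of half-spaces
bounded by rational affine hyperplanes. -/
def IsRatPolyhedron (Λ : AddSubgroup (Vd d)) (P : Set (Vd d)) : Prop :=
  ∃ (n : ℕ) (φ : Fin n → Vd d) (c : Fin n → ℚ),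
    (∀ i, IsDualIntegral Λ (φ i)) ∧
    P = {x | x ∈ Submodule.span ℝ (Λ : Set (Vd d)) ∧ ∀ i, (pairE (φ i) x) ≤ (c i : ℝ)}

/-- the set `P` contains a straight (affine) line. -/
def ContainsLine (P : Set (Vd d)) : Prop :=
  ∃ x u : Vd d, u ≠ 0 ∧ ∀ t : ℝ, x + t • u ∈ P

/-- equality of meromorphic-type functions near `0`: they agree near `0` outside a closed
set with empty interior (the polar set). -/
def MeroEqAt0 (f g : Vd d → ℝ) : Prop :=
  ∃ Z : Set (Vd d), IsClosed Z ∧ interior Z = ∅ ∧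
    ∀ᶠ ξ in 𝓝 (0 : Vd d), ξ ∉ Z → f ξ = g ξ

/-- `g` is analytic at `0` and its Taylor coefficients are rational with respect to an
integral basis (i.e. the coefficients take rational values on dual-lattice vectors). -/
def HasRatSeriesAt0 (Λ : AddSubgroup (Vd d)) (g : Vd d → ℝ) : Prop :=
  ∃ p : FormalMultilinearSeries ℝ (Vd d) ℝ, HasFPowerSeriesAt g p 0 ∧
    ∀ (n : ℕ) (w : Fin n → Vd d), (∀ i, IsDualIntegral Λ (w i)) →
      ∃ q : ℚ, (p n) w = (q : ℝ)

/-- `f` is meromorphic near `0` with rational Taylor coefficients: near `0` it is a quotient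
of two analytic functions with rational Taylor coefficients. -/
def RatMeromorphicAt0 (Λ : AddSubgroup (Vd d)) (f : Vd d → ℝ) : Prop :=
  ∃ g h : Vd d → ℝ, HasRatSeriesAt0 Λ g ∧ HasRatSeriesAt0 Λ h ∧
    (¬ ∀ᶠ ξ in 𝓝 (0 : Vd d), h ξ = 0) ∧
    (∀ᶠ ξ in 𝓝 (0 : Vd d), h ξ ≠ 0 → f ξ * h ξ = g ξ)

/-- `m` is the canonical Lebesgue measure carried by the rational affine subspace `A`,
normalized so that a fundamental parallelepiped of the lattice `Λ ∩ lin(A)` has volume `1`: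
it is the image of the standard Lebesgue measure under a `ℤ`-basis parametrization. -/
def IsCanonicalMeasure (Λ : AddSubgroup (Vd d)) (A : Set (Vd d)) (m : Measure (Vd d)) : Prop :=
  ∃ (k : ℕ) (x₀ : Vd d) (v : Fin k → Vd d),
    x₀ ∈ A ∧ (∀ i, v i ∈ Λ) ∧ LinearIndependent ℝ v ∧
    A = {x | ∃ t : Fin k → ℝ, x = x₀ + ∑ i, t i • v i} ∧
    (∀ y ∈ Λ, y ∈ Submodule.span ℝ (Set.range v) →
      ∃ c : Fin k → ℤ, y = ∑ i, (c i : ℝ) • v i) ∧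
    m = Measure.map (fun t : Fin k → ℝ => x₀ + ∑ i, t i • v i) volume

/-- the characterizing properties of the map `I`: it sends rational polyhedra to meromorphic
functions with rational coefficients, vanishes on polyhedra containing lines, and is given by
`∫_P e^{⟨ξ,x⟩} dm_{<P>}(x)` wherever this integral converges. -/
def IsIMap (Λ : AddSubgroup (Vd d)) (I : Set (Vd d) → Vd d → ℝ) : Prop :=
  (∀ P, IsRatPolyhedron Λ P → RatMeromorphicAt0 Λ (I P)) ∧
  (∀ P, IsRatPolyhedron Λ P → ContainsLine P → ∀ ξ, I P ξ = 0) ∧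
  (∀ P, IsRatPolyhedron Λ P → ∀ m : Measure (Vd d),
    IsCanonicalMeasure Λ ((affineSpan ℝ P : AffineSubspace ℝ (Vd d)) : Set (Vd d)) m →
    ∀ ξ : Vd d, IntegrableOn (fun x => Real.exp (pairE (ξ) (x))) P m →
      I P ξ = ∫ x in P, Real.exp (pairE (ξ) (x)) ∂m)

/-- the characterizing properties of the map `S`: it sends rational polyhedra to meromorphic
functions with rational coefficients, vanishes on polyhedra containing lines, and is given by
`∑_{x ∈ P ∩ Λ} e^{⟨ξ,x⟩}` wherever this sum converges absolutely. -/
def IsSMap (Λ : AddSubgroup (Vd d)) (S : Set (Vd d) → Vd d → ℝ) : Prop :=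
  (∀ P, IsRatPolyhedron Λ P → RatMeromorphicAt0 Λ (S P)) ∧
  (∀ P, IsRatPolyhedron Λ P → ContainsLine P → ∀ ξ, S P ξ = 0) ∧
  (∀ P, IsRatPolyhedron Λ P → ∀ ξ : Vd d,
    Summable (fun x : ↥(P ∩ (Λ : Set (Vd d))) => Real.exp (pairE ξ (x : Vd d))) →
      S P ξ = ∑' x : ↥(P ∩ (Λ : Set (Vd d))), Real.exp (pairE ξ (x : Vd d)))

/-- `F` is a (nonempty, exposed) face of the convex set `P`. -/
def IsFaceOf (P F : Set (Vd d)) : Prop :=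
  F.Nonempty ∧ ∃ φ : Vd d, F = {x ∈ P | ∀ y ∈ P, (pairE (φ) (y)) ≤ (pairE (φ) (x))}

/-- `v` is a vertex of `P`. -/
def IsVertexOf (P : Set (Vd d)) (v : Vd d) : Prop := IsFaceOf P {v}

/-- the cone of feasible directions of `P` along the face `F` (computed at a point of the
relative interior of `F`). -/
def feasibleCone (P F : Set (Vd d)) : Set (Vd d) :=
  {u | ∃ x ∈ intrinsicInterior ℝ F, ∃ ε : ℝ, 0 < ε ∧ ∀ t : ℝ, 0 < t → t ≤ ε → x + t • u ∈ P}

/-- the supporting cone `<F> + c(P,F)` of `P` along its face `F`. -/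
def suppCone (P F : Set (Vd d)) : Set (Vd d) :=
  {z | ∃ a ∈ (affineSpan ℝ F : Set (Vd d)), ∃ u ∈ feasibleCone P F, z = a + u}

/-- the recession cone (cone of directions) of a convex set. -/
def recCone (P : Set (Vd d)) : Set (Vd d) :=
  {u | ∀ x ∈ P, ∀ t : ℝ, 0 ≤ t → x + t • u ∈ P}

/-- a rational affine cone with respect to the lattice `Λ`: a rational translate of a cone
generated by finitely many lattice vectors. -/
def IsRatAffineCone (Λ : AddSubgroup (Vd d)) (a : Set (Vd d)) : Prop :=
  ∃ (s : Vd d) (n : ℕ) (v : Fin n → Vd d), IsRatPoint Λ s ∧ (∀ i, v i ∈ Λ) ∧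
    a = {x | ∃ t : Fin n → ℝ, (∀ i, 0 ≤ t i) ∧ x = s + ∑ i, t i • v i}

/-- a rational (convex polyhedral) cone with vertex at the origin. -/
def IsRatCone (Λ : AddSubgroup (Vd d)) (c : Set (Vd d)) : Prop :=
  ∃ (n : ℕ) (v : Fin n → Vd d), (∀ i, v i ∈ Λ) ∧
    c = {x | ∃ t : Fin n → ℝ, (∀ i, 0 ≤ t i) ∧ x = ∑ i, t i • v i}

/-- `Q` is a rational scalar product: a symmetric positive definite bilinear form taking
rational values on lattice vectors. -/
def IsRatInner (Λ : AddSubgroup (Vd d)) (Q : Vd d →ₗ[ℝ] Vd d →ₗ[ℝ] ℝ) : Prop :=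
  (∀ x y, Q x y = Q y x) ∧ (∀ x : Vd d, x ≠ 0 → 0 < Q x x) ∧
  (∀ x ∈ Λ, ∀ y ∈ Λ, ∃ q : ℚ, Q x y = (q : ℝ))

/-- `π` realizes the quotient map `V → V/L` as the `Q`-orthogonal projection onto the
`Q`-orthogonal complement of `L`. -/
def IsQCoproj (Q : Vd d →ₗ[ℝ] Vd d →ₗ[ℝ] ℝ) (L : Submodule ℝ (Vd d))
    (π : Vd d →ₗ[ℝ] Vd d) : Prop :=
  (∀ x, x - π x ∈ L) ∧ (∀ x : Vd d, ∀ y ∈ L, Q (π x) y = 0)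

/-- `Λ'` is the lattice of a rational quotient space of `(V, Λ)`, realized inside `V` via the
`Q`-orthogonal projection along a rational subspace. -/
def IsQuotLattice (Q : Vd d →ₗ[ℝ] Vd d →ₗ[ℝ] ℝ) (Λ Λ' : AddSubgroup (Vd d)) : Prop :=
  ∃ (L : Submodule ℝ (Vd d)) (π : Vd d →ₗ[ℝ] Vd d),
    Submodule.span ℝ ((L : Set (Vd d)) ∩ (Λ : Set (Vd d))) = L ∧
    IsQCoproj Q L π ∧ Λ' = AddSubgroup.map π.toAddMonoidHom Λ

/-- a family of maps `I` indexed by the rational quotient spaces of `(V,Λ)`, each member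
satisfying the characterizing properties of the integral generating function. -/
def IsIFamily (Q : Vd d →ₗ[ℝ] Vd d →ₗ[ℝ] ℝ) (Λ : AddSubgroup (Vd d))
    (I : AddSubgroup (Vd d) → Set (Vd d) → Vd d → ℝ) : Prop :=
  ∀ Λ', IsQuotLattice Q Λ Λ' → IsIMap Λ' (I Λ')

/-- a family of maps `S` indexed by the rational quotient spaces of `(V,Λ)`, each member
satisfying the characterizing properties of the lattice-point generating function. -/
def IsSFamily (Q : Vd d →ₗ[ℝ] Vd d →ₗ[ℝ] ℝ) (Λ : AddSubgroup (Vd d))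
    (S : AddSubgroup (Vd d) → Set (Vd d) → Vd d → ℝ) : Prop :=
  ∀ Λ', IsQuotLattice Q Λ Λ' → IsSMap Λ' (S Λ')

/-- the defining properties (a),(b),(c) of the family `μ` of Berline--Vergne:
each `μ(a)` is meromorphic with rational coefficients near `0`, `μ_{0}({0}) = 1`, and for
every pointed rational affine cone `a` in a rational quotient `W` of `V` one has
`S(a) = ∑_{f ∈ F(a)} μ(t(a,f)) I(f)`, where the transverse cone `t(a,f)` is realized inside
`V` by the `Q`-orthogonal projection `π F` along `lin(f)`, and functions on quotient duals
are extended by `Q`-orthogonal projection. -/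
def IsMuCore (Λ : AddSubgroup (Vd d)) (Q : Vd d →ₗ[ℝ] Vd d →ₗ[ℝ] ℝ)
    (I S μ : AddSubgroup (Vd d) → Set (Vd d) → Vd d → ℝ) : Prop :=
  (∀ Λ', IsQuotLattice Q Λ Λ' → ∀ a, IsRatAffineCone Λ' a → ¬ ContainsLine a →
      RatMeromorphicAt0 Λ' (μ Λ' a)) ∧
  (∀ ξ, μ ⊥ ({0} : Set (Vd d)) ξ = 1) ∧
  (∀ Λ', IsQuotLattice Q Λ Λ' → ∀ a, IsRatAffineCone Λ' a → ¬ ContainsLine a →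
    ∀ π : Set (Vd d) → (Vd d →ₗ[ℝ] Vd d),
      (∀ F, IsFaceOf a F → IsQCoproj Q (affineSpan ℝ F).direction (π F)) →
      MeroEqAt0 (S Λ' a)
        (fun ξ => ∑ᶠ F ∈ {F | IsFaceOf a F},
          μ (AddSubgroup.map (π F).toAddMonoidHom Λ') ((π F) '' suppCone a F) ξ
            * I Λ' F ξ))

/-- the family `μ`, extended by `μ(a) = 0` on cones containing a straight line. -/
def IsMuFamily (Λ : AddSubgroup (Vd d)) (Q : Vd d →ₗ[ℝ] Vd d →ₗ[ℝ] ℝ)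
    (I S μ : AddSubgroup (Vd d) → Set (Vd d) → Vd d → ℝ) : Prop :=
  IsMuCore Λ Q I S μ ∧
  (∀ Λ', IsQuotLattice Q Λ Λ' → ∀ a, IsRatAffineCone Λ' a → ContainsLine a →
    ∀ ξ, μ Λ' a ξ = 0)

/-- the trace pairing of two `n`-multilinear forms on `ℝ^d`, computed in the standard basis. -/
def multiPair {n : ℕ} (p q : ContinuousMultilinearMap ℝ (fun _ : Fin n => Vd d) ℝ) : ℝ :=
  ∑ ι : Fin n → Fin d,
    p (fun j => (EuclideanSpace.basisFun (Fin d) ℝ) (ι j)) *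
    q (fun j => (EuclideanSpace.basisFun (Fin d) ℝ) (ι j))

/-- the action on `h` of the infinite-order constant-coefficient differential operator whose
symbol has Taylor series `p` at `0`; on polynomials `h` the sum is finite.  Its defining
property is `D(Φ)e^{⟨ξ,·⟩} = Φ(ξ)e^{⟨ξ,·⟩}`. -/
def DOp (p : FormalMultilinearSeries ℝ (Vd d) ℝ) (h : Vd d → ℝ) (x : Vd d) : ℝ :=
  ∑ᶠ n : ℕ, multiPair (p n) (iteratedFDeriv ℝ n h x)

/-- `h` is a polynomial function on `ℝ^d`. -/
def IsPolyFun (h : Vd d → ℝ) : Prop :=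
  ∃ p : MvPolynomial (Fin d) ℝ, ∀ x : Vd d, h x = MvPolynomial.eval (fun i => x i) p

/-- `h` is a polynomial function of degree at most `r` on `ℝ^d`. -/
def IsPolyFunOfDeg (h : Vd d → ℝ) (r : ℕ) : Prop :=
  ∃ p : MvPolynomial (Fin d) ℝ, p.totalDegree ≤ r ∧
    ∀ x : Vd d, h x = MvPolynomial.eval (fun i => x i) p

end



/-- a `ℤ`-basis of a discrete subgroup, independent over `ℝ` -/
lemma exists_disc_basis {d : ℕ} (M : AddSubgroup (Vd d)) [hM : DiscreteTopology M] :
    ∃ (k : ℕ) (b : Fin k → Vd d), LinearIndependent ℝ b ∧ (∀ i, b i ∈ M) ∧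
      ∀ y ∈ M, ∃ c : Fin k → ℤ, y = ∑ i, (c i : ℝ) • b i := by
  classical
  let L : Submodule ℤ (Vd d) := AddSubgroup.toIntSubmodule M
  have hL : DiscreteTopology L := hM
  let b0 := Module.Free.chooseBasis ℤ L
  let n := Module.finrank ℤ L
  let b1 : Module.Basis (Fin n) ℤ L := Module.finBasis ℤ L
  refine ⟨n, fun i => (b1 i : Vd d), ?_, fun i => (b1 i).2, ?_⟩
  · rw [linearIndependent_iff_card_eq_finrank_span]
    have h1 : Submodule.span ℤ (Set.range fun i => (b1 i : Vd d)) = L := by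
      have : (Set.range fun i => (b1 i : Vd d)) = L.subtype '' Set.range b1 := by
        rw [← Set.range_comp]; rfl
      rw [this, ← Submodule.map_span, b1.span_eq]; simp
    have h2 := Real.finrank_eq_int_finrank_of_discrete
      (s := Set.range fun i => (b1 i : Vd d)) (by rw [h1]; exact hL)
    rw [h2, Set.finrank, h1]; simp [n]
  · intro y hy
    refine ⟨fun i => b1.repr ⟨y, hy⟩ i, ?_⟩
    have := congrArg (fun z : L => (z : Vd d)) (b1.sum_repr ⟨y, hy⟩)
    simp only [AddSubmonoidClass.coe_finsetSum, Submodule.coe_smul] at this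
    refine this.symm.trans (Finset.sum_congr rfl fun i _ => ?_)
    exact (Int.cast_smul_eq_zsmul ℝ _ _).symm

lemma disc_finite_inter {d : ℕ} (M : AddSubgroup (Vd d)) [hM : DiscreteTopology M] (K : Set (Vd d))
    (hK : Bornology.IsBounded K) : (K ∩ (M : Set (Vd d))).Finite := by
  exact Metric.finite_isBounded_inter_isClosed (isDiscrete_iff_discreteTopology.2 hM) hK
    (AddSubgroup.isClosed_of_discrete)

/-- a `ℚ`-linear projection of `ℝ` onto `ℚ` -/
lemma exists_ratProj : ∃ l : ℝ →ₗ[ℚ] ℚ, ∀ q : ℚ, l (q : ℝ) = q := by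
  obtain ⟨l, hl⟩ := LinearMap.exists_leftInverse_of_injective (Algebra.linearMap ℚ ℝ)
    (LinearMap.ker_eq_bot.2 (algebraMap ℚ ℝ).injective)
  exact ⟨l, fun q => by simpa using LinearMap.congr_fun hl q⟩

lemma ratProj_mul (l : ℝ →ₗ[ℚ] ℚ) (q : ℚ) (x : ℝ) : l (x * q) = l x * q := by
  have : x * q = q • x := by rw [mul_comm, Rat.smul_def]
  rw [this, map_smul, smul_eq_mul, mul_comm]

section proj
variable {d : ℕ} {Q : Vd d →ₗ[ℝ] Vd d →ₗ[ℝ] ℝ} {Λ : AddSubgroup (Vd d)}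

lemma coproj_zero (hQ : IsRatInner Λ Q) {L : Submodule ℝ (Vd d)} {π : Vd d →ₗ[ℝ] Vd d}
    (h : IsQCoproj Q L π) {y : Vd d} (hy : y ∈ L) : π y = 0 := by
  by_contra hne
  have h1 : π y ∈ L := by
    have := L.sub_mem hy (h.1 y); simpa using this
  have := hQ.2.1 _ hne
  rw [h.2 y _ h1] at this
  exact lt_irrefl _ this

lemma coproj_ker (hQ : IsRatInner Λ Q) {L : Submodule ℝ (Vd d)} {π : Vd d →ₗ[ℝ] Vd d}
    (h : IsQCoproj Q L π) (y : Vd d) : π y = 0 ↔ y ∈ L := by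
  refine ⟨fun h0 => ?_, coproj_zero hQ h⟩
  have := h.1 y; rwa [h0, sub_zero] at this

lemma coproj_unique (hQ : IsRatInner Λ Q) {L : Submodule ℝ (Vd d)} {π π' : Vd d →ₗ[ℝ] Vd d}
    (h : IsQCoproj Q L π) (h' : IsQCoproj Q L π') : π = π' := by
  ext1 x
  by_contra hne
  have h1 : π x - π' x ∈ L := by
    have := L.sub_mem (h'.1 x) (h.1 x); simpa using this
  have := hQ.2.1 _ (sub_ne_zero.2 hne)
  rw [map_sub Q, LinearMap.sub_apply, h.2 x _ h1, h'.2 x _ h1] at this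
  simp at this

lemma exists_coproj (hQ : IsRatInner Λ Q) (L : Submodule ℝ (Vd d)) :
    ∃ π : Vd d →ₗ[ℝ] Vd d, IsQCoproj Q L π := by
  let f : L →ₗ[ℝ] (L →ₗ[ℝ] ℝ) := (Q.compl₁₂ L.subtype L.subtype)
  have hf : Function.Injective f := by
    rw [injective_iff_map_eq_zero]
    intro x hx
    by_contra hne
    have := hQ.2.1 (x : Vd d) (by simpa using hne)
    have h2 := LinearMap.congr_fun hx x
    simp [f] at h2
    linarith
  have hfs : Function.Surjective f := by
    refine (LinearMap.injective_iff_surjective_of_finrank_eq_finrank ?_).1 hf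
    exact (Subspace.dual_finrank_eq (K := ℝ) (V := L)).symm
  let e := LinearEquiv.ofBijective f ⟨hf, hfs⟩
  let r : (Vd d →ₗ[ℝ] ℝ) →ₗ[ℝ] (L →ₗ[ℝ] ℝ) := LinearMap.lcomp ℝ ℝ L.subtype
  refine ⟨LinearMap.id - L.subtype ∘ₗ e.symm.toLinearMap ∘ₗ r ∘ₗ Q, ?_, ?_⟩
  · intro x; simp
  · intro x y hy
    have : f (e.symm (r (Q x))) = r (Q x) := e.apply_symm_apply _
    have h2 := LinearMap.congr_fun this ⟨y, hy⟩
    have h3 : Q (e.symm (r (Q x)) : Vd d) y = Q x y := h2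
    simp only [LinearMap.sub_apply, LinearMap.id_apply, LinearMap.comp_apply, map_sub]
    exact sub_eq_zero.2 h3.symm

/-- composition of coprojections -/
lemma coproj_comp {L M : Submodule ℝ (Vd d)} {π ρ : Vd d →ₗ[ℝ] Vd d}
    (h : IsQCoproj Q L π) (h' : IsQCoproj Q M ρ) (hM : ∀ y ∈ M, ∀ z ∈ L, Q y z = 0) :
    IsQCoproj Q (L ⊔ M) (ρ ∘ₗ π) := by
  constructor
  · intro x
    have : x - ρ (π x) = (x - π x) + (π x - ρ (π x)) := by abel
    rw [LinearMap.comp_apply, this]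
    exact Submodule.add_mem_sup (h.1 x) (h'.1 _)
  · intro x y hy
    obtain ⟨y1, hy1, y2, hy2, rfl⟩ := Submodule.mem_sup.1 hy
    rw [map_add, LinearMap.comp_apply, h'.2 _ _ hy2, add_zero]
    have h3 := hM _ (h'.1 (π x)) y1 hy1
    rw [map_sub, LinearMap.sub_apply, h.2 x y1 hy1] at h3
    linarith

lemma coproj_rat (hQ : IsRatInner Λ Q) {L : Submodule ℝ (Vd d)} {π : Vd d →ₗ[ℝ] Vd d}
    (hL : Submodule.span ℝ ((L : Set (Vd d)) ∩ (Λ : Set (Vd d))) = L)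
    (h : IsQCoproj Q L π) {x : Vd d} (hx : x ∈ Λ) : ∃ N : ℕ, N ≠ 0 ∧ (N : ℝ) • π x ∈ Λ := by
  classical
  obtain ⟨l, hl⟩ := exists_ratProj
  have h1 : x - π x ∈ Submodule.span ℝ ((L : Set (Vd d)) ∩ (Λ : Set (Vd d))) := by
    rw [hL]; exact h.1 x
  obtain ⟨c, hcs, hc⟩ := (Finsupp.mem_span_iff_linearCombination ℝ _ _).1 h1 |>.imp fun c hc => (⟨trivial, hc⟩ : True ∧ _)
  rw [Finsupp.linearCombination_apply, Finsupp.sum] at hc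
  -- the rational solution
  set z : Vd d := ∑ w ∈ c.support, (l (c w) : ℝ) • (w : Vd d) with hz
  have hQz : ∀ y ∈ (L : Set (Vd d)) ∩ (Λ : Set (Vd d)), Q z y = Q (x - π x) y := by
    intro y hy
    have e1 : Q (x - π x) y = Q x y := by simp [h.2 x y hy.1]
    obtain ⟨q, hq⟩ := hQ.2.2 x hx y hy.2
    have e2 : ∑ w ∈ c.support, c w * Q w y = q := by
      rw [← hq, ← e1, ← hc]; simp
    have hr : ∀ w : ↥((L : Set (Vd d)) ∩ (Λ : Set (Vd d))), ∃ r : ℚ, Q w y = r :=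
      fun w => hQ.2.2 _ w.2.2 y hy.2
    choose r hr using hr
    have e3 : ∑ w ∈ c.support, l (c w) * r w = q := by
      rw [← hl q, ← e2, map_sum]
      exact Finset.sum_congr rfl fun w _ => by rw [hr, ratProj_mul]
    rw [e1, hq, hz, ← e3]
    simp [hr]
  have hzL : z ∈ L := by
    refine L.sum_mem fun w _ => L.smul_mem _ w.2.1
  have hzeq : z = x - π x := by
    have hall : ∀ y ∈ L, Q (z - (x - π x)) y = 0 := by
      intro y hy
      rw [← hL] at hy
      induction hy using Submodule.span_induction with
      | mem y hy => rw [map_sub, LinearMap.sub_apply, hQz y hy, sub_self]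
      | zero => simp
      | add a b _ _ ha hb => rw [map_add, ha, hb, add_zero]
      | smul a b _ hb => rw [map_smul, hb, smul_zero]
    by_contra hne
    have := hQ.2.1 _ (sub_ne_zero.2 hne)
    rw [hall _ (L.sub_mem hzL (h.1 x))] at this
    exact lt_irrefl _ this
  refine ⟨∏ w ∈ c.support, (l (c w)).den, Finset.prod_ne_zero_iff.2 fun w _ => (l (c w)).den_nz, ?_⟩
  have e4 : π x = x - z := by rw [hzeq]; abel
  rw [e4, smul_sub]
  refine Λ.sub_mem ?_ ?_
  · rw [Nat.cast_smul_eq_nsmul]; exact Λ.nsmul_mem hx _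
  · rw [hz, Finset.smul_sum]
    refine Λ.sum_mem fun w hw => ?_
    rw [smul_smul, ← Finset.mul_prod_erase _ _ hw]
    have : ((((l (c w)).den * ∏ w ∈ c.support.erase w, (l (c w)).den : ℕ) : ℝ) * (l (c w) : ℝ))
       = (((∏ w ∈ c.support.erase w, (l (c w)).den : ℕ) * (l (c w)).num : ℤ) : ℝ) := by
      have h5 : ((l (c w)).den : ℝ) * (l (c w) : ℝ) = (l (c w)).num := by
        exact_mod_cast Rat.den_mul_eq_num (l (c w))
      push_cast
      rw [← h5]; ring
    rw [this, Int.cast_smul_eq_zsmul]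
    exact Λ.zsmul_mem w.2.2 _

lemma coproj_disc (hΛ : IsFullLattice Λ) (hQ : IsRatInner Λ Q) {L : Submodule ℝ (Vd d)}
    {π : Vd d →ₗ[ℝ] Vd d}
    (hL : Submodule.span ℝ ((L : Set (Vd d)) ∩ (Λ : Set (Vd d))) = L)
    (h : IsQCoproj Q L π) : DiscreteTopology (AddSubgroup.map π.toAddMonoidHom Λ) := by
  classical
  obtain ⟨⟨k, v, hv, hΛv⟩, hspan⟩ := hΛ
  have hvΛ : ∀ i, v i ∈ Λ := fun i => by rw [hΛv]; exact AddSubgroup.subset_closure ⟨i, rfl⟩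
  choose N hN hNv using fun i => coproj_rat hQ hL h (hvΛ i)
  set M : ℕ := ∏ i, N i with hM
  have hM0 : (M : ℝ) ≠ 0 := by
    exact_mod_cast Finset.prod_ne_zero_iff.2 fun i _ => hN i
  have hsv : Submodule.span ℝ (Set.range v) = ⊤ := by
    rw [← hspan, hΛv]
    refine le_antisymm (Submodule.span_mono AddSubgroup.subset_closure) ?_
    rw [Submodule.span_le]
    intro x hx
    exact (AddSubgroup.closure_le (Submodule.span ℝ (Set.range v)).toAddSubgroup).2
      Submodule.subset_span hx
  let b : Module.Basis (Fin k) ℝ (Vd d) := Module.Basis.mk hv hsv.ge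
  let b' : Module.Basis (Fin k) ℝ (Vd d) := b.unitsSMul (fun _ => (Units.mk0 (M : ℝ) hM0)⁻¹)
  have hb' : ∀ i, b' i = (M : ℝ)⁻¹ • v i := by
    intro i; simp [b', b, Module.Basis.unitsSMul_apply]; rfl
  have hdisc : DiscreteTopology (Submodule.span ℤ (Set.range b')) := inferInstance
  have hscale : ∀ x ∈ Λ, (M : ℝ)⁻¹ • x ∈ Submodule.span ℤ (Set.range b') := by
    intro x hx
    rw [hΛv] at hx
    induction hx using AddSubgroup.closure_induction with
    | mem x hx =>
      obtain ⟨i, rfl⟩ := hx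
      rw [← hb']; exact Submodule.subset_span ⟨i, rfl⟩
    | zero => simp
    | add x y _ _ hx hy => rw [smul_add]; exact Submodule.add_mem _ hx hy
    | neg x _ hx => rw [smul_neg]; exact Submodule.neg_mem _ hx
  have hle : (AddSubgroup.map π.toAddMonoidHom Λ : Set (Vd d)) ⊆
      (Submodule.span ℤ (Set.range b') : Set (Vd d)) := by
    rintro _ ⟨x, hx, rfl⟩
    have hx' : (M : ℝ) • π x ∈ Λ := by
      have hx2 : x ∈ AddSubgroup.closure (Set.range v) := by rw [← hΛv]; exact hx
      clear hx
      induction hx2 using AddSubgroup.closure_induction with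
      | mem x hx =>
        obtain ⟨i, rfl⟩ := hx
        rw [hM, ← Finset.mul_prod_erase _ _ (Finset.mem_univ i), mul_comm]
        push_cast
        rw [mul_smul, ← Nat.cast_prod, Nat.cast_smul_eq_nsmul]
        exact Λ.nsmul_mem (hNv i) _
      | zero => simp
      | add x y _ _ hx hy => rw [map_add, smul_add]; exact Λ.add_mem hx hy
      | neg x _ hx => rw [map_neg, smul_neg]; exact Λ.neg_mem hx
    have := hscale _ hx'
    rwa [smul_smul, inv_mul_cancel₀ hM0, one_smul] at this
  exact DiscreteTopology.of_subset (s := (Submodule.span ℤ (Set.range b') : Set (Vd d))) hdisc hle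

lemma quot_disc (hΛ : IsFullLattice Λ) (hQ : IsRatInner Λ Q) {Λ' : AddSubgroup (Vd d)}
    (h : IsQuotLattice Q Λ Λ') : DiscreteTopology Λ' := by
  obtain ⟨L, π, hL, hπ, rfl⟩ := h
  exact coproj_disc hΛ hQ hL hπ

/-- quotient of a quotient -/
lemma quot_quot (hQ : IsRatInner Λ Q) {Λ' : AddSubgroup (Vd d)}
    (h : IsQuotLattice Q Λ Λ') {M : Submodule ℝ (Vd d)} {T : Set (Vd d)} (hT : T ⊆ Λ')
    (hM : M = Submodule.span ℝ T) {ρ : Vd d →ₗ[ℝ] Vd d} (hρ : IsQCoproj Q M ρ) :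
    IsQuotLattice Q Λ (AddSubgroup.map ρ.toAddMonoidHom Λ') := by
  obtain ⟨L, π, hL, hπ, rfl⟩ := h
  have hTL : ∀ y ∈ M, ∀ z ∈ L, Q y z = 0 := by
    intro y hy z hz
    rw [hM] at hy
    induction hy using Submodule.span_induction with
    | mem y hy => obtain ⟨x, hx, rfl⟩ := hT hy; exact hπ.2 x z hz
    | zero => simp
    | add a b _ _ ha hb => rw [map_add, LinearMap.add_apply, ha, hb, add_zero]
    | smul a b _ hb => rw [map_smul, LinearMap.smul_apply, hb, smul_zero]
  refine ⟨L ⊔ M, ρ ∘ₗ π, ?_, coproj_comp hπ hρ hTL, ?_⟩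
  · refine le_antisymm (Submodule.span_le.2 fun x hx => hx.1) ?_
    have hLle : L ≤ Submodule.span ℝ (((L ⊔ M : Submodule ℝ (Vd d)) : Set (Vd d)) ∩ (Λ : Set (Vd d))) := by
      conv_lhs => rw [← hL]
      exact Submodule.span_mono fun x hx => ⟨Submodule.mem_sup_left hx.1, hx.2⟩
    refine sup_le hLle ?_
    conv_lhs => rw [hM]
    rw [Submodule.span_le]
    intro y hy
    obtain ⟨x, hx, rfl⟩ := hT hy
    have h1 : x - π x ∈ L := hπ.1 x
    have h2 : x ∈ L ⊔ M := by
      have : x = (x - π x) + π x := by abel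
      rw [this]
      refine Submodule.add_mem_sup h1 ?_
      rw [hM]; exact Submodule.subset_span hy
    have h3 := Submodule.sub_mem _ (Submodule.subset_span (R := ℝ) (s := (((L ⊔ M : Submodule ℝ (Vd d)) : Set (Vd d)) ∩ (Λ : Set (Vd d)))) ⟨h2, hx⟩) (hLle h1)
    simpa using h3
  · rw [AddSubgroup.map_map]; rfl

end proj


/-- the cone with vertex `s` generated by the `v i`, `i ∈ J` -/
def cn {d n : ℕ} (s : Vd d) (v : Fin n → Vd d) (J : Finset (Fin n)) : Set (Vd d) :=
  {x | ∃ t : Fin n → ℝ, (∀ i, 0 ≤ t i) ∧ x = s + ∑ i ∈ J, t i • v i}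

section dual
variable {d n : ℕ} {Λ : AddSubgroup (Vd d)}

lemma pairE_add_right (ξ x y : Vd d) : pairE ξ (x + y) = pairE ξ x + pairE ξ y := inner_add_right _ _ _
lemma pairE_sub_right (ξ x y : Vd d) : pairE ξ (x - y) = pairE ξ x - pairE ξ y := inner_sub_right _ _ _
lemma pairE_add_left (ξ x y : Vd d) : pairE (x + y) ξ = pairE x ξ + pairE y ξ := inner_add_left _ _ _
lemma pairE_sub_left (ξ x y : Vd d) : pairE (x - y) ξ = pairE x ξ - pairE y ξ := inner_sub_left _ _ _
lemma pairE_smul_right (r : ℝ) (ξ x : Vd d) : pairE ξ (r • x) = r * pairE ξ x :=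
  real_inner_smul_right _ _ _
lemma pairE_smul_left (r : ℝ) (ξ x : Vd d) : pairE (r • ξ) x = r * pairE ξ x :=
  real_inner_smul_left _ _ _
lemma pairE_zero_right (ξ : Vd d) : pairE ξ 0 = 0 := inner_zero_right _
lemma pairE_zero_left (ξ : Vd d) : pairE 0 ξ = 0 := inner_zero_left _
lemma pairE_sum_right {ι : Type*} (J : Finset ι) (ξ : Vd d) (f : ι → Vd d) :
    pairE ξ (∑ i ∈ J, f i) = ∑ i ∈ J, pairE ξ (f i) := inner_sum _ _ _
lemma pairE_sum_left {ι : Type*} (J : Finset ι) (ξ : Vd d) (f : ι → Vd d) :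
    pairE (∑ i ∈ J, f i) ξ = ∑ i ∈ J, pairE (f i) ξ := sum_inner _ _ _
lemma pairE_comb (J : Finset (Fin n)) (ξ : Vd d) (t : Fin n → ℝ) (f : Fin n → Vd d) :
    pairE ξ (∑ i ∈ J, t i • f i) = ∑ i ∈ J, t i * pairE ξ (f i) := by
  simp only [pairE_sum_right, pairE_smul_right]
lemma continuous_pairE_right (ξ : Vd d) : Continuous (fun x => pairE ξ x) := by
  unfold pairE; fun_prop
lemma continuous_pairE_left (x : Vd d) : Continuous (fun ξ => pairE ξ x) := by
  unfold pairE; fun_prop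

lemma exists_pairE (f : Vd d →ₗ[ℝ] ℝ) : ∃ φ : Vd d, ∀ x, pairE φ x = f x := by
  refine ⟨(InnerProductSpace.toDual ℝ (Vd d)).symm (LinearMap.toContinuousLinearMap f), fun x => ?_⟩
  unfold pairE
  rw [InnerProductSpace.toDual_symm_apply]; rfl

lemma exists_adj (f : Vd d →ₗ[ℝ] Vd d) (ψ : Vd d) : ∃ φ : Vd d, ∀ x, pairE φ x = pairE ψ (f x) := by
  exact exists_pairE ((innerₛₗ ℝ ψ) ∘ₗ f)

lemma exists_dual_family {k : ℕ} {b : Fin k → Vd d} (hb : LinearIndependent ℝ b) :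
    ∃ φ : Fin k → Vd d, ∀ (c : Fin k → ℝ) i, pairE (φ i) (∑ j, c j • b j) = c i := by
  obtain ⟨g, hg⟩ := LinearMap.exists_leftInverse_of_injective (Fintype.linearCombination ℝ b)
    (LinearMap.ker_eq_bot.2 hb.fintypeLinearCombination_injective)
  choose φ hφ using fun i => exists_pairE ((LinearMap.proj i : (Fin k → ℝ) →ₗ[ℝ] ℝ) ∘ₗ g)
  refine ⟨φ, fun c i => ?_⟩
  rw [hφ]
  have := congrFun (LinearMap.congr_fun hg c) i
  simpa [Fintype.linearCombination_apply] using this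

lemma span_int_comb {k : ℕ} {b : Fin k → Vd d} (hbM : ∀ i, b i ∈ Λ)
    (hb : ∀ y ∈ Λ, ∃ c : Fin k → ℤ, y = ∑ i, (c i : ℝ) • b i) :
    Submodule.span ℝ (Λ : Set (Vd d)) = Submodule.span ℝ (Set.range b) := by
  refine le_antisymm (Submodule.span_le.2 ?_) (Submodule.span_mono ?_)
  · intro y hy
    obtain ⟨c, rfl⟩ := hb y hy
    exact Submodule.sum_mem _ fun i _ => Submodule.smul_mem _ _ (Submodule.subset_span ⟨i, rfl⟩)
  · rintro _ ⟨i, rfl⟩; exact hbM i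

lemma exists_dual_sep (Λ : AddSubgroup (Vd d)) [DiscreteTopology Λ] :
    ∃ Φ : Finset (Vd d), (∀ φ ∈ Φ, IsDualIntegral Λ φ) ∧
      ∀ x ∈ Submodule.span ℝ (Λ : Set (Vd d)), (∀ φ ∈ Φ, pairE φ x ≤ 0) → x = 0 := by
  classical
  obtain ⟨k, b, hb, hbM, hbc⟩ := exists_disc_basis Λ
  obtain ⟨φ, hφ⟩ := exists_dual_family hb
  have hintg : ∀ i, IsDualIntegral Λ (φ i) := by
    intro i y hy
    obtain ⟨c, rfl⟩ := hbc y hy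
    exact ⟨c i, hφ _ i⟩
  refine ⟨Finset.univ.image φ ∪ Finset.univ.image (fun i => - φ i), ?_, ?_⟩
  · intro ψ hψ
    simp only [Finset.mem_union, Finset.mem_image, Finset.mem_univ, true_and] at hψ
    rcases hψ with ⟨i, rfl⟩ | ⟨i, rfl⟩
    · exact hintg i
    · intro x hx
      obtain ⟨m, hm⟩ := hintg i x hx
      refine ⟨-m, ?_⟩
      push_cast
      rw [← hm]; exact inner_neg_left _ _
  · intro x hx hle
    rw [span_int_comb hbM hbc, Submodule.mem_span_range_iff_exists_fun] at hx
    obtain ⟨c, rfl⟩ := hx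
    have : ∀ i, c i = 0 := by
      intro i
      have h1 := hle (φ i) (by simp)
      have h2 := hle (- φ i) (by simp)
      rw [hφ] at h1
      have h3 : pairE (- φ i) (∑ i, c i • b i) = - c i := by
        rw [← hφ c i]; exact inner_neg_left _ _
      linarith
    simp [this]

lemma cn_insert (s : Vd d) (v : Fin n → Vd d) (J : Finset (Fin n)) {i : Fin n} (hi : i ∉ J) (x : Vd d) :
    x ∈ cn s v (insert i J) ↔ ∃ t : ℝ, 0 ≤ t ∧ x - t • v i ∈ cn s v J := by
  constructor
  · rintro ⟨t, ht, rfl⟩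
    refine ⟨t i, ht i, t, ht, ?_⟩
    rw [Finset.sum_insert hi]; abel
  · rintro ⟨r, hr, t, ht, h⟩
    refine ⟨Function.update t i r, ?_, ?_⟩
    · intro j
      by_cases hj : j = i
      · subst hj; simpa
      · simpa [hj] using ht j
    · rw [Finset.sum_insert hi, Function.update_self]
      have : ∑ j ∈ J, Function.update t i r j • v j = ∑ j ∈ J, t j • v j :=
        Finset.sum_congr rfl fun j hj => by
          rw [Function.update_of_ne]; rintro rfl; exact hi hj
      rw [this]
      have := eq_add_of_sub_eq h
      rw [this]; abel

lemma IsDualIntegral.comb {φ ψ : Vd d} (h : IsDualIntegral Λ φ) (h' : IsDualIntegral Λ ψ) (a b : ℤ) :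
    IsDualIntegral Λ ((a : ℝ) • φ - (b : ℝ) • ψ) := by
  intro x hx
  obtain ⟨m, hm⟩ := h x hx
  obtain ⟨k, hk⟩ := h' x hx
  refine ⟨a * m - b * k, ?_⟩
  rw [pairE_sub_left, pairE_smul_left, pairE_smul_left, hm, hk]; push_cast; ring

/-- rational Minkowski--Weyl -/
lemma cn_hdesc [DiscreteTopology Λ] (v : Fin n → Vd d) (hv : ∀ i, v i ∈ Λ) (J : Finset (Fin n)) :
    ∃ Φ : Finset (Vd d), (∀ φ ∈ Φ, IsDualIntegral Λ φ) ∧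
      ∀ x, x ∈ cn 0 v J ↔ x ∈ Submodule.span ℝ (Λ : Set (Vd d)) ∧ ∀ φ ∈ Φ, pairE φ x ≤ 0 := by
  classical
  induction J using Finset.induction_on with
  | empty =>
    obtain ⟨Φ, hΦ, hs⟩ := exists_dual_sep Λ
    refine ⟨Φ, hΦ, fun x => ⟨?_, fun h => ?_⟩⟩
    · rintro ⟨t, _, rfl⟩
      simp [pairE_zero_right]
    · rw [hs x h.1 h.2]; exact ⟨0, by simp, by simp⟩
  | insert i J hi ih =>
    obtain ⟨Φ, hΦ, hs⟩ := ih
    let pos := Φ.filter (fun φ => 0 < pairE φ (v i))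
    let neg := Φ.filter (fun φ => pairE φ (v i) < 0)
    let np := Φ.filter (fun φ => pairE φ (v i) ≤ 0)
    refine ⟨np ∪ Finset.image₂ (fun φ ψ => (pairE φ (v i)) • ψ - (pairE ψ (v i)) • φ) pos neg, ?_, ?_⟩
    · intro ψ hψ
      rcases Finset.mem_union.1 hψ with h | h
      · exact hΦ _ (Finset.mem_filter.1 h).1
      · obtain ⟨φ, hφ, χ, hχ, rfl⟩ := Finset.mem_image₂.1 h
        have h1 := hΦ _ (Finset.mem_filter.1 hφ).1
        have h2 := hΦ _ (Finset.mem_filter.1 hχ).1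
        obtain ⟨a, ha⟩ := h1 _ (hv i)
        obtain ⟨b, hb⟩ := h2 _ (hv i)
        simp only [ha, hb]
        exact h2.comb h1 a b
    · intro x
      rw [cn_insert _ _ _ hi]
      constructor
      · rintro ⟨t, ht, hx⟩
        obtain ⟨hx1, hx2⟩ := (hs _).1 hx
        simp only [pairE_sub_right, pairE_smul_right, sub_nonpos] at hx2
        refine ⟨?_, fun ψ hψ => ?_⟩
        · have := Submodule.add_mem _ hx1 (Submodule.smul_mem _ t (Submodule.subset_span (hv i)))
          simpa using this
        · rcases Finset.mem_union.1 hψ with h | h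
          · obtain ⟨h1, h2⟩ := Finset.mem_filter.1 h
            have := hx2 ψ h1
            nlinarith
          · obtain ⟨φ, hφ, χ, hχ, rfl⟩ := Finset.mem_image₂.1 h
            obtain ⟨h1, h2⟩ := Finset.mem_filter.1 hφ
            obtain ⟨h3, h4⟩ := Finset.mem_filter.1 hχ
            have e1 := mul_le_mul_of_nonneg_left (hx2 χ h3) h2.le
            have e2 := mul_le_mul_of_nonneg_left (hx2 φ h1) (neg_pos.2 h4).le
            rw [pairE_sub_left, pairE_smul_left, pairE_smul_left]
            nlinarith
      · rintro ⟨hx1, hx2⟩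
        let A : Finset ℝ := insert 0 (pos.image fun φ => pairE φ x / pairE φ (v i))
        have hA : A.Nonempty := Finset.insert_nonempty _ _
        have hmax := A.max'_mem hA
        have hle := fun y hy => A.le_max' y hy
        set t := A.max' hA with ht
        have ht0 : 0 ≤ t := hle 0 (Finset.mem_insert_self _ _)
        refine ⟨t, ht0, (hs _).2 ⟨?_, ?_⟩⟩
        · exact Submodule.sub_mem _ hx1 (Submodule.smul_mem _ t (Submodule.subset_span (hv i)))
        · intro φ hφ
          rw [pairE_sub_right, pairE_smul_right, sub_nonpos]
          rcases lt_trichotomy (pairE φ (v i)) 0 with h | h | h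
          · have hφn : φ ∈ np := Finset.mem_filter.2 ⟨hφ, h.le⟩
            have e0 := hx2 φ (Finset.mem_union_left _ hφn)
            rcases Finset.mem_insert.1 hmax with h0 | h0
            · rw [h0]; simpa using e0
            · obtain ⟨χ, hχ, e⟩ := Finset.mem_image.1 h0
              have hpos := (Finset.mem_filter.1 hχ).2
              have e3 := hx2 _ (Finset.mem_union_right _ (Finset.mem_image₂_of_mem hχ
                (Finset.mem_filter.2 ⟨hφ, h⟩)))
              rw [pairE_sub_left, pairE_smul_left, pairE_smul_left] at e3
              rw [← e, div_mul_eq_mul_div, le_div_iff₀ hpos]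
              linarith
          · have hφn : φ ∈ np := Finset.mem_filter.2 ⟨hφ, h.le⟩
            have e0 := hx2 φ (Finset.mem_union_left _ hφn)
            rw [h]; simpa using e0
          · have := hle (pairE φ x / pairE φ (v i)) (Finset.mem_insert_of_mem
              (Finset.mem_image_of_mem _ (Finset.mem_filter.2 ⟨hφ, h⟩)))
            rwa [div_le_iff₀ h] at this

lemma mem_cn_iff_sub (s : Vd d) (v : Fin n → Vd d) (J : Finset (Fin n)) (x : Vd d) :
    x ∈ cn s v J ↔ x - s ∈ cn 0 v J := by
  constructor
  · rintro ⟨t, ht, rfl⟩; exact ⟨t, ht, by simp⟩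
  · rintro ⟨t, ht, h⟩; exact ⟨t, ht, by rw [zero_add] at h; rw [← h]; abel⟩

lemma cn_ratPolyhedron [DiscreteTopology Λ] (v : Fin n → Vd d) (hv : ∀ i, v i ∈ Λ)
    (J : Finset (Fin n)) {s : Vd d} (hs : IsRatPoint Λ s) : IsRatPolyhedron Λ (cn s v J) := by
  classical
  obtain ⟨Φ, hΦ, hd⟩ := cn_hdesc v hv J
  obtain ⟨q, hq, hqs⟩ := hs
  have hq' : (q : ℝ) ≠ 0 := by exact_mod_cast hq
  have hss : s ∈ Submodule.span ℝ (Λ : Set (Vd d)) := by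
    have := Submodule.smul_mem _ (q : ℝ)⁻¹ (Submodule.subset_span (R := ℝ) hqs)
    rwa [smul_smul, inv_mul_cancel₀ hq', one_smul] at this
  have hrat : ∀ φ : Φ, ∃ c : ℚ, pairE (φ : Vd d) s = c := by
    intro φ
    obtain ⟨m, hm⟩ := hΦ _ φ.2 _ hqs
    refine ⟨m / q, ?_⟩
    rw [pairE_smul_right] at hm
    push_cast
    field_simp
    linarith
  choose c hc using hrat
  let e := Φ.equivFin
  refine ⟨Φ.card, fun i => (e.symm i : Vd d), fun i => c (e.symm i), fun i => hΦ _ (e.symm i).2, ?_⟩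
  ext x
  rw [mem_cn_iff_sub, hd]
  refine and_congr ?_ ?_
  · exact ⟨fun h => by simpa using Submodule.add_mem _ h hss, fun h => Submodule.sub_mem _ h hss⟩
  · simp only [pairE_sub_right, sub_nonpos]
    constructor
    · intro h i
      rw [← hc]; exact h _ (e.symm i).2
    · intro h φ hφ
      have := h (e ⟨φ, hφ⟩)
      rwa [← hc, e.symm_apply_apply] at this

lemma cn_closed [DiscreteTopology Λ] (v : Fin n → Vd d) (hv : ∀ i, v i ∈ Λ)
    (J : Finset (Fin n)) (s : Vd d) : IsClosed (cn s v J) := by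
  obtain ⟨Φ, hΦ, hd⟩ := cn_hdesc v hv J
  have : cn s v J = (fun x => x - s) ⁻¹' ((Submodule.span ℝ (Λ : Set (Vd d)) : Set (Vd d)) ∩
      ⋂ φ ∈ Φ, {x | pairE φ x ≤ 0}) := by
    ext x
    rw [mem_cn_iff_sub, hd]
    simp
  rw [this]
  refine IsClosed.preimage (by fun_prop) (IsClosed.inter (Submodule.closed_of_finiteDimensional _) ?_)
  exact isClosed_biInter fun φ _ => isClosed_le (continuous_pairE_right φ) continuous_const

end dual


section nf
variable {d n : ℕ} {Λ : AddSubgroup (Vd d)}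

lemma cn_mono (s : Vd d) (v : Fin n → Vd d) {J K : Finset (Fin n)} (h : J ⊆ K) : cn s v J ⊆ cn s v K := by
  classical
  rintro x ⟨t, ht, rfl⟩
  refine ⟨fun i => if i ∈ J then t i else 0, fun i => by dsimp only; split_ifs <;> simp [ht], ?_⟩
  congr 1
  rw [← Finset.sum_subset h]
  · exact Finset.sum_congr rfl fun i hi => by simp [hi]
  · intro i _ hi; simp [hi]

lemma cn_vertex_mem (s : Vd d) (v : Fin n → Vd d) (J : Finset (Fin n)) : s ∈ cn s v J :=
  ⟨0, by simp, by simp⟩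

lemma cn_add_smul {s : Vd d} {v : Fin n → Vd d} {J : Finset (Fin n)} {x : Vd d} (hx : x ∈ cn s v J)
    {i : Fin n} (hi : i ∈ J) {r : ℝ} (hr : 0 ≤ r) : x + r • v i ∈ cn s v J := by
  classical
  obtain ⟨t, ht, rfl⟩ := hx
  refine ⟨t + Pi.single i r, fun j => add_nonneg (ht j) ?_, ?_⟩
  · by_cases h : j = i
    · subst h; simpa
    · simp [h]
  · simp only [Pi.add_apply, add_smul, Finset.sum_add_distrib]
    rw [add_assoc]; congr 2
    rw [Finset.sum_eq_single i]
    · simp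
    · intro j _ hj; simp [hj]
    · intro h; exact absurd hi h

lemma cn_add_cn {s : Vd d} {v : Fin n → Vd d} {J : Finset (Fin n)} {x y : Vd d} (hx : x ∈ cn s v J)
    (hy : y ∈ cn 0 v J) : x + y ∈ cn s v J := by
  obtain ⟨t, ht, rfl⟩ := hx
  obtain ⟨u, hu, rfl⟩ := hy
  refine ⟨t + u, fun j => add_nonneg (ht j) (hu j), ?_⟩
  simp only [Pi.add_apply, add_smul, Finset.sum_add_distrib]
  abel

lemma cn_smul_cn {v : Fin n → Vd d} {J : Finset (Fin n)} {y : Vd d} 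
    (hy : y ∈ cn 0 v J) {r : ℝ} (hr : 0 ≤ r) : r • y ∈ cn 0 v J := by
  obtain ⟨u, hu, rfl⟩ := hy
  refine ⟨fun i => r * u i, fun j => mul_nonneg hr (hu j), ?_⟩
  simp only [zero_add, Finset.smul_sum, smul_smul]

lemma cn_gen_mem (v : Fin n → Vd d) {J : Finset (Fin n)} {i : Fin n} (hi : i ∈ J) : v i ∈ cn 0 v J := by
  have := cn_add_smul (cn_vertex_mem 0 v J) hi zero_le_one
  simpa using this

lemma exists_neg_functional [DiscreteTopology Λ] {s : Vd d} (v : Fin n → Vd d) (hv : ∀ i, v i ∈ Λ)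
    (h0 : ∀ i, v i ≠ 0) (hl : ¬ ContainsLine (cn s v Finset.univ)) :
    ∃ η : Vd d, ∀ i, pairE η (v i) < 0 := by
  obtain ⟨Φ, hΦ, hd⟩ := cn_hdesc v hv Finset.univ
  refine ⟨∑ φ ∈ Φ, φ, fun i => ?_⟩
  have hle := ((hd (v i)).1 (cn_gen_mem v (Finset.mem_univ i))).2
  rw [pairE_sum_left]
  refine lt_of_le_of_ne (Finset.sum_nonpos hle) fun he => hl ?_
  have hz := (Finset.sum_eq_zero_iff_of_nonpos hle).1 he
  have hmem : ∀ t : ℝ, t • v i ∈ cn 0 v Finset.univ := fun t => (hd _).2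
    ⟨Submodule.smul_mem _ _ (Submodule.subset_span (hv i)), fun φ hφ => by
      rw [pairE_smul_right, hz φ hφ, mul_zero]⟩
  exact ⟨s, v i, h0 i, fun t => cn_add_cn (cn_vertex_mem _ _ _) (hmem t)⟩

lemma exists_extremal [DiscreteTopology Λ] (v : Fin n → Vd d) (hv : ∀ i, v i ∈ Λ)
    {η : Vd d} (hη : ∀ i, pairE η (v i) < 0) (i : Fin n)
    (hi : v i ∉ cn 0 v (Finset.univ.erase i)) :
    ∃ φ : Vd d, pairE φ (v i) = 0 ∧ ∀ j, j ≠ i → pairE φ (v j) < 0 := by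
  classical
  let w : Fin (n + 1) → Vd d := Fin.cons (- v i) v
  have hw : ∀ j, w j ∈ Λ := by
    intro j; refine Fin.cases ?_ ?_ j
    · exact neg_mem (hv i)
    · exact hv
  obtain ⟨Φ, hΦ, hd⟩ := cn_hdesc w hw Finset.univ
  have hle : ∀ j, ∀ φ ∈ Φ, pairE φ (v j) ≤ 0 := fun j => 
    ((hd (v j)).1 (cn_gen_mem w (Finset.mem_univ j.succ))).2
  have hge : ∀ φ ∈ Φ, pairE φ (v i) = 0 := fun φ hφ => by
    have := ((hd (- v i)).1 (cn_gen_mem w (Finset.mem_univ 0))).2 φ hφ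
    have h2 : pairE φ (- v i) = - pairE φ (v i) := inner_neg_right _ _
    have := hle i φ hφ
    linarith
  refine ⟨∑ φ ∈ Φ, φ, ?_, fun j hj => ?_⟩
  · rw [pairE_sum_left]; exact Finset.sum_eq_zero hge
  rw [pairE_sum_left]
  refine lt_of_le_of_ne (Finset.sum_nonpos (hle j)) fun he => ?_
  have hz := (Finset.sum_eq_zero_iff_of_nonpos (hle j)).1 he
  have hmem : - v j ∈ cn 0 w Finset.univ := (hd _).2
    ⟨Submodule.neg_mem _ (Submodule.subset_span (hv j)), fun φ hφ => by
      have h2 : pairE φ (- v j) = - pairE φ (v j) := inner_neg_right _ _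
      rw [h2, hz φ hφ, neg_zero]⟩
  obtain ⟨t, ht, h⟩ := hmem
  rw [zero_add, Fin.sum_univ_succ] at h
  simp only [w, Fin.cons_zero, Fin.cons_succ] at h
  rw [← Finset.add_sum_erase _ _ (Finset.mem_univ i)] at h
  set y := ∑ k ∈ Finset.univ.erase i, t k.succ • v k with hy
  have hyc : y ∈ cn 0 v (Finset.univ.erase i) := ⟨fun k => t k.succ, fun k => ht _, by rw [zero_add]⟩
  have hr : (t 0 - t i.succ) • v i = v j + y := by
    rw [sub_smul]
    rw [smul_neg] at h
    have : v j = t 0 • v i - t i.succ • v i - y := by rw [← neg_neg (v j), h]; abel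
    rw [this]; abel
  have hyη : pairE η y ≤ 0 := by
    rw [hy, pairE_sum_right]
    refine Finset.sum_nonpos fun k _ => ?_
    rw [pairE_smul_right]; nlinarith [ht k.succ, hη k]
  by_cases hpos : 0 < t 0 - t i.succ
  · apply hi
    have : v i = (t 0 - t i.succ)⁻¹ • (v j + y) := by
      rw [← hr, smul_smul, inv_mul_cancel₀ hpos.ne', one_smul]
    rw [this]
    refine cn_smul_cn (cn_add_cn (cn_gen_mem v ?_) hyc) (inv_nonneg.2 hpos.le)
    simp [hj]
  · have h1 := congrArg (pairE η) hr
    rw [pairE_smul_right, pairE_add_right] at h1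
    nlinarith [hη j, hη i]

lemma exists_primitive [DiscreteTopology Λ] {x : Vd d} (hx : x ∈ Λ) (h0 : x ≠ 0) :
    ∃ r : ℝ, 0 < r ∧ r • x ∈ Λ ∧ ∀ q : ℝ, q • (r • x) ∈ Λ → ∃ k : ℤ, q = k := by
  classical
  let H : AddSubgroup ℝ := Λ.comap ((LinearMap.toSpanSingleton ℝ (Vd d) x).toAddMonoidHom)
  have hH : ∀ q, q ∈ H ↔ q • x ∈ Λ := fun q => Iff.rfl
  have hfin : {q : ℝ | q ∈ H ∧ 0 ≤ q ∧ q ≤ 1}.Finite := by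
    have h1 := disc_finite_inter Λ (Metric.closedBall 0 ‖x‖) Metric.isBounded_closedBall
    refine Set.Finite.of_finite_image (f := fun q : ℝ => q • x) (h1.subset ?_) ?_
    · rintro _ ⟨q, ⟨hq, hq0, hq1⟩, rfl⟩
      refine ⟨?_, hq⟩
      rw [mem_closedBall_zero_iff, norm_smul, Real.norm_of_nonneg hq0]
      nlinarith [norm_nonneg x]
    · intro a _ b _ hab
      exact smul_left_injective ℝ h0 hab
  have hone : (1 : ℝ) ∈ H := by rw [hH]; simpa
  have hfin' : {q : ℝ | q ∈ H ∧ 0 < q ∧ q ≤ 1}.Finite :=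
    hfin.subset fun q hq => ⟨hq.1, hq.2.1.le, hq.2.2⟩
  obtain ⟨r, hr, hmin⟩ := hfin'.exists_minimal ⟨1, hone, one_pos, le_rfl⟩
  have hleast : IsLeast {g : ℝ | g ∈ H ∧ 0 < g} r := by
    refine ⟨⟨hr.1, hr.2.1⟩, fun q hq => ?_⟩
    by_contra hlt
    push Not at hlt
    exact absurd (hmin ⟨hq.1, hq.2, hlt.le.trans hr.2.2⟩ hlt.le) (not_le.2 hlt)
  have hcl := AddSubgroup.cyclic_of_min hleast
  refine ⟨r, hr.2.1, hr.1, fun q hq => ?_⟩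
  rw [smul_smul] at hq
  have : q * r ∈ H := hq
  rw [hcl, AddSubgroup.mem_closure_singleton] at this
  obtain ⟨k, hk⟩ := this
  refine ⟨k, ?_⟩
  have hr0 := hr.2.1.ne'
  rw [zsmul_eq_mul] at hk
  exact (mul_right_cancel₀ hr0 hk).symm

lemma cn_rescale (s : Vd d) (v : Fin n → Vd d) (J : Finset (Fin n)) (r : Fin n → ℝ) (hr : ∀ i, 0 < r i) :
    cn s (fun i => r i • v i) J = cn s v J := by
  ext x; constructor
  · rintro ⟨t, ht, rfl⟩
    exact ⟨fun i => t i * r i, fun i => mul_nonneg (ht i) (hr i).le, by simp [smul_smul]⟩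
  · rintro ⟨t, ht, rfl⟩
    refine ⟨fun i => t i * (r i)⁻¹, fun i => mul_nonneg (ht i) (inv_nonneg.2 (hr i).le), ?_⟩
    congr 1
    refine Finset.sum_congr rfl fun i _ => ?_
    rw [smul_smul, mul_assoc, inv_mul_cancel₀ (hr i).ne', mul_one]

lemma isRatAffineCone_iff (a : Set (Vd d)) : IsRatAffineCone Λ a ↔
    ∃ (s : Vd d) (n : ℕ) (v : Fin n → Vd d), IsRatPoint Λ s ∧ (∀ i, v i ∈ Λ) ∧ a = cn s v Finset.univ :=
  Iff.rfl

lemma normal_form [DiscreteTopology Λ] {a : Set (Vd d)} (ha : IsRatAffineCone Λ a)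
    (hl : ¬ ContainsLine a) :
    ∃ (s : Vd d) (n : ℕ) (v : Fin n → Vd d), IsRatPoint Λ s ∧ (∀ i, v i ∈ Λ) ∧ a = cn s v Finset.univ ∧
      (∀ i, ∀ q : ℝ, q • v i ∈ Λ → ∃ k : ℤ, q = k) ∧
      (∃ η : Vd d, ∀ i, pairE η (v i) < 0) ∧
      ∀ i, ∃ φ : Vd d, pairE φ (v i) = 0 ∧ ∀ j, j ≠ i → pairE φ (v j) < 0 := by
  classical
  have hex : ∃ n : ℕ, ∃ (s : Vd d) (v : Fin n → Vd d), IsRatPoint Λ s ∧ (∀ i, v i ∈ Λ) ∧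
      a = cn s v Finset.univ := by
    obtain ⟨s, n, v, h⟩ := ha; exact ⟨n, s, v, h⟩
  obtain ⟨n, ⟨s, v, hs, hv, hav⟩, hmin⟩ : ∃ n : ℕ, (∃ (s : Vd d) (v : Fin n → Vd d), IsRatPoint Λ s ∧
      (∀ i, v i ∈ Λ) ∧ a = cn s v Finset.univ) ∧ ∀ m, m < n → ¬ ∃ (s : Vd d) (v : Fin m → Vd d),
      IsRatPoint Λ s ∧ (∀ i, v i ∈ Λ) ∧ a = cn s v Finset.univ :=
    ⟨Nat.find hex, Nat.find_spec hex, fun m => Nat.find_min hex⟩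
  have hir : ∀ i, v i ∉ cn 0 v (Finset.univ.erase i) := by
    intro i hi
    have hn0 : n ≠ 0 := fun h => by rw [h] at i; exact i.elim0
    obtain ⟨k, hk⟩ := Nat.exists_eq_succ_of_ne_zero hn0
    subst hk
    refine hmin k (Nat.lt_succ_self k) ⟨s, v ∘ i.succAbove, hs, fun j => hv _, ?_⟩
    rw [hav]
    have himg : (Finset.univ.erase i) = Finset.univ.map (Fin.succAboveEmb i) := by
      ext j; simp [Fin.exists_succAbove_eq_iff]
    obtain ⟨u, hu, hui⟩ := hi
    rw [zero_add, himg, Finset.sum_map] at hui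
    ext x; constructor
    · rintro ⟨t, ht, rfl⟩
      refine ⟨fun j => t (i.succAbove j) + t i * u (i.succAbove j), fun j => add_nonneg (ht _)
        (mul_nonneg (ht _) (hu _)), ?_⟩
      rw [Fin.sum_univ_succAbove _ i]
      congr 1
      nth_rewrite 1 [hui]
      rw [Finset.smul_sum, ← Finset.sum_add_distrib]
      refine Finset.sum_congr rfl fun j _ => ?_
      simp [add_smul, smul_smul, add_comm]
    · rintro ⟨t, ht, rfl⟩
      refine ⟨i.insertNth 0 t, fun j => ?_, ?_⟩
      · refine Fin.succAboveCases i ?_ ?_ j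
        · simp
        · intro l; simp [ht]
      · rw [Fin.sum_univ_succAbove _ i]; simp
  have h0 : ∀ i, v i ≠ 0 := fun i h => hir i (by rw [h]; exact cn_vertex_mem _ _ _)
  obtain ⟨η, hη⟩ := exists_neg_functional v hv h0 (hav ▸ hl)
  choose r hr hrΛ hrp using fun i => exists_primitive (hv i) (h0 i)
  refine ⟨s, n, fun i => r i • v i, hs, hrΛ, ?_, hrp, ⟨η, fun i => ?_⟩, fun i => ?_⟩
  · rw [cn_rescale _ _ _ _ hr, hav]
  · rw [pairE_smul_right]; exact mul_neg_of_pos_of_neg (hr i) (hη i)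
  · obtain ⟨φ, h1, h2⟩ := exists_extremal v hv hη i (hir i)
    refine ⟨φ, ?_, fun j hj => ?_⟩
    · rw [pairE_smul_right, h1, mul_zero]
    · rw [pairE_smul_right]; exact mul_neg_of_pos_of_neg (hr j) (h2 j hj)

end nf


section faces
variable {d n : ℕ} {Λ : AddSubgroup (Vd d)}

open Classical in
/-- indices of the generators contained in a face -/
noncomputable def faceJ (s : Vd d) (v : Fin n → Vd d) (F : Set (Vd d)) : Finset (Fin n) :=
  Finset.univ.filter (fun i => s + v i ∈ F)

lemma mem_cn_filter (s : Vd d) (v : Fin n → Vd d) {φ : Vd d} (hφ : ∀ i, pairE φ (v i) ≤ 0)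
    (J : Finset (Fin n)) (hJ : ∀ i, i ∈ J ↔ pairE φ (v i) = 0) (x : Vd d) :
    x ∈ cn s v J ↔ x ∈ cn s v Finset.univ ∧ pairE φ x = pairE φ s := by
  constructor
  · intro hx
    refine ⟨cn_mono s v (Finset.subset_univ J) hx, ?_⟩
    obtain ⟨t, ht, rfl⟩ := hx
    rw [pairE_add_right, pairE_comb, Finset.sum_eq_zero, add_zero]
    intro i hi; rw [(hJ i).1 hi, mul_zero]
  · rintro ⟨⟨t, ht, rfl⟩, h⟩
    rw [pairE_add_right, pairE_comb] at h
    have h0 : ∑ i, t i * pairE φ (v i) = 0 := by linarith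
    have hz := (Finset.sum_eq_zero_iff_of_nonpos
      (fun i _ => mul_nonpos_of_nonneg_of_nonpos (ht i) (hφ i))).1 h0
    refine ⟨t, ht, ?_⟩
    congr 1
    symm
    apply Finset.sum_subset (Finset.subset_univ J)
    intro i hi hiJ
    rw [hJ] at hiJ
    have := hz i hi
    rcases mul_eq_zero.1 this with h | h
    · simp [h]
    · exact absurd h hiJ

lemma pairE_le_vertex {s : Vd d} {v : Fin n → Vd d} {φ : Vd d} (hφ : ∀ i, pairE φ (v i) ≤ 0)
    {J : Finset (Fin n)} {x : Vd d} (hx : x ∈ cn s v J) : pairE φ x ≤ pairE φ s := by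
  obtain ⟨t, ht, rfl⟩ := hx
  rw [pairE_add_right, pairE_comb]
  have := Finset.sum_nonpos (fun i (_ : i ∈ J) => mul_nonpos_of_nonneg_of_nonpos (ht i) (hφ i))
  linarith

lemma face_of_functional (s : Vd d) (v : Fin n → Vd d) {φ : Vd d} (hφ : ∀ i, pairE φ (v i) ≤ 0)
    (J : Finset (Fin n)) (hJ : ∀ i, i ∈ J ↔ pairE φ (v i) = 0) :
    IsFaceOf (cn s v Finset.univ) (cn s v J) := by
  refine ⟨⟨s, cn_vertex_mem _ _ _⟩, φ, ?_⟩
  ext x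
  rw [mem_cn_filter s v hφ J hJ]
  simp only [mem_setOf_eq]
  refine and_congr_right fun hx => ⟨fun h y hy => h ▸ pairE_le_vertex hφ hy, fun h => ?_⟩
  exact le_antisymm (pairE_le_vertex hφ hx) (h s (cn_vertex_mem _ _ _))

lemma face_spec {s : Vd d} {v : Fin n → Vd d} {F : Set (Vd d)} (hF : IsFaceOf (cn s v Finset.univ) F) :
    ∃ φ : Vd d, (∀ i, pairE φ (v i) ≤ 0) ∧ (∀ i, i ∈ faceJ s v F ↔ pairE φ (v i) = 0) ∧
      F = cn s v (faceJ s v F) := by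
  classical
  obtain ⟨⟨x, hx⟩, φ, hφF⟩ := hF
  have hx' := hx
  rw [hφF] at hx'
  have hφ : ∀ i, pairE φ (v i) ≤ 0 := by
    intro i
    have := hx'.2 _ (cn_add_smul hx'.1 (Finset.mem_univ i) zero_le_one)
    rw [one_smul, pairE_add_right] at this
    linarith
  have hmem : ∀ y, y ∈ F ↔ y ∈ cn s v Finset.univ ∧ pairE φ y = pairE φ s := by
    intro y
    rw [hφF]
    refine and_congr_right fun hy => ⟨fun h => ?_, fun h z hz => h ▸ pairE_le_vertex hφ hz⟩
    exact le_antisymm (pairE_le_vertex hφ hy) (h s (cn_vertex_mem _ _ _))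
  have hJ : ∀ i, i ∈ faceJ s v F ↔ pairE φ (v i) = 0 := by
    intro i
    simp only [faceJ, Finset.mem_filter, Finset.mem_univ, true_and]
    rw [hmem, pairE_add_right]
    have := cn_add_smul (cn_vertex_mem s v Finset.univ) (Finset.mem_univ i) zero_le_one
    rw [one_smul] at this
    simp [this]
  refine ⟨φ, hφ, hJ, ?_⟩
  ext y
  rw [hmem, mem_cn_filter s v hφ _ hJ]

lemma faces_finite (s : Vd d) (v : Fin n → Vd d) : {F | IsFaceOf (cn s v Finset.univ) F}.Finite := by
  refine (Set.finite_range (fun J : Finset (Fin n) => cn s v J)).subset ?_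
  intro F hF
  obtain ⟨φ, _, _, h⟩ := face_spec hF
  exact ⟨_, h.symm⟩

lemma cn_convex (s : Vd d) (v : Fin n → Vd d) (J : Finset (Fin n)) : Convex ℝ (cn s v J) := by
  rintro x ⟨t, ht, rfl⟩ y ⟨u, hu, rfl⟩ a b ha hb hab
  refine ⟨fun i => a * t i + b * u i, fun i => add_nonneg (mul_nonneg ha (ht i)) (mul_nonneg hb (hu i)), ?_⟩
  simp only [smul_add, Finset.smul_sum, add_smul, Finset.sum_add_distrib, ← smul_smul]
  have : s = a • s + b • s := by rw [← add_smul, hab, one_smul]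
  nth_rewrite 3 [this]
  abel

lemma cn_sub_mem_span {s : Vd d} {v : Fin n → Vd d} {J : Finset (Fin n)} {x : Vd d} (hx : x ∈ cn s v J) :
    x - s ∈ Submodule.span ℝ (v '' (J : Set (Fin n))) := by
  obtain ⟨t, ht, rfl⟩ := hx
  rw [add_sub_cancel_left]
  exact Submodule.sum_mem _ fun i hi => Submodule.smul_mem _ _ (Submodule.subset_span ⟨i, hi, rfl⟩)

lemma cn_direction (s : Vd d) (v : Fin n → Vd d) (J : Finset (Fin n)) :
    (affineSpan ℝ (cn s v J)).direction = Submodule.span ℝ (v '' (J : Set (Fin n))) := by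
  rw [direction_affineSpan, vectorSpan_def]
  refine le_antisymm (Submodule.span_le.2 ?_) (Submodule.span_le.2 ?_)
  · rintro _ ⟨x, hx, y, hy, rfl⟩
    have := Submodule.sub_mem _ (cn_sub_mem_span hx) (cn_sub_mem_span hy)
    simpa using this
  · rintro _ ⟨i, hi, rfl⟩
    apply Submodule.subset_span
    refine ⟨s + v i, ?_, s, cn_vertex_mem _ _ _, by simp⟩
    have := cn_add_smul (cn_vertex_mem s v J) hi zero_le_one
    simpa using this

lemma mem_affineSpan_cn (s : Vd d) (v : Fin n → Vd d) (J : Finset (Fin n)) (x : Vd d) :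
    x ∈ affineSpan ℝ (cn s v J) ↔ x - s ∈ Submodule.span ℝ (v '' (J : Set (Fin n))) := by
  have hs : s ∈ affineSpan ℝ (cn s v J) := subset_affineSpan _ _ (cn_vertex_mem _ _ _)
  rw [← cn_direction s v J, ← vsub_eq_sub, AffineSubspace.vsub_right_mem_direction_iff_mem hs]

lemma map_cn (s : Vd d) (v : Fin n → Vd d) (J : Finset (Fin n)) (π : Vd d →ₗ[ℝ] Vd d) :
    π '' cn s v J = cn (π s) (π ∘ v) J := by
  ext x; constructor
  · rintro ⟨_, ⟨t, ht, rfl⟩, rfl⟩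
    exact ⟨t, ht, by simp⟩
  · rintro ⟨t, ht, rfl⟩
    exact ⟨_, ⟨t, ht, rfl⟩, by simp⟩

lemma image_suppCone (s : Vd d) (v : Fin n → Vd d) (J : Finset (Fin n)) {π : Vd d →ₗ[ℝ] Vd d}
    (hπ : ∀ i ∈ J, π (v i) = 0) :
    π '' suppCone (cn s v Finset.univ) (cn s v J) = cn (π s) (π ∘ v) Finset.univ := by
  have hk : ∀ y ∈ Submodule.span ℝ (v '' (J : Set (Fin n))), π y = 0 := by
    intro y hy
    have : Submodule.span ℝ (v '' (J : Set (Fin n))) ≤ LinearMap.ker π := by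
      rw [Submodule.span_le]; rintro _ ⟨i, hi, rfl⟩; exact hπ i hi
    exact this hy
  ext z; constructor
  · rintro ⟨_, ⟨α, hα, u, ⟨x, hx, ε, hε, h⟩, rfl⟩, rfl⟩
    have h1 := h ε hε le_rfl
    have hx' := intrinsicInterior_subset hx
    have e1 : π α = π s := by
      have := hk _ ((mem_affineSpan_cn s v J α).1 hα); rwa [map_sub, sub_eq_zero] at this
    have e2 : π x = π s := by
      have := hk _ (cn_sub_mem_span hx'); rwa [map_sub, sub_eq_zero] at this
    have h2 : π (x + ε • u) ∈ cn (π s) (π ∘ v) Finset.univ := by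
      rw [← map_cn]; exact ⟨_, h1, rfl⟩
    rw [mem_cn_iff_sub, map_add, e2, add_sub_cancel_left, map_smul] at h2
    have h3 := cn_smul_cn h2 (inv_nonneg.2 hε.le)
    rw [smul_smul, inv_mul_cancel₀ hε.ne', one_smul] at h3
    rw [map_add, e1]
    exact cn_add_cn (cn_vertex_mem _ _ _) h3
  · intro hz
    rw [← map_cn] at hz
    obtain ⟨y, hy, rfl⟩ := hz
    refine ⟨y, ⟨s, subset_affineSpan _ _ (cn_vertex_mem _ _ _), y - s, ?_, by abel⟩, rfl⟩
    obtain ⟨x, hx⟩ := (Set.Nonempty.intrinsicInterior (cn_convex s v J) ⟨s, cn_vertex_mem _ _ _⟩)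
    refine ⟨x, hx, 1, one_pos, fun t ht _ => ?_⟩
    rw [mem_cn_iff_sub] at hy
    exact cn_add_cn (cn_mono s v (Finset.subset_univ J) (intrinsicInterior_subset hx))
      (cn_smul_cn hy ht.le)

/-- faces of the quotient cone by a ray -/
lemma faces_quot {s : Vd d} {v : Fin n → Vd d} {i : Fin n} {π : Vd d →ₗ[ℝ] Vd d}
    (hπ : ∀ x, x - π x ∈ Submodule.span ℝ {v i}) (hπi : π (v i) = 0) :
    BijOn (fun F => π '' F) {F | IsFaceOf (cn s v Finset.univ) F ∧ i ∈ faceJ s v F}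
      {F | IsFaceOf (cn (π s) (π ∘ v) Finset.univ) F} := by
  classical
  have key : ∀ φ : Vd d, pairE φ (v i) = 0 → ∀ x, pairE φ (π x) = pairE φ x := by
    intro φ hφ x
    obtain ⟨r, hr⟩ := Submodule.mem_span_singleton.1 (hπ x)
    have : x = π x + r • v i := by rw [hr]; abel
    nth_rewrite 2 [this]
    rw [pairE_add_right, pairE_smul_right, hφ]; ring
  refine ⟨?_, ?_, ?_⟩
  · rintro F ⟨hF, hi⟩
    obtain ⟨φ, hφ, hJ, he⟩ := face_spec hF
    have hφi := (hJ i).1 hi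
    show IsFaceOf _ (π '' F)
    rw [he, map_cn]
    refine face_of_functional _ _ (φ := φ) ?_ _ ?_
    · intro j; simpa [key φ hφi] using hφ j
    · intro j; simpa [key φ hφi] using hJ j
  · have hsub : ∀ F G, (IsFaceOf (cn s v Finset.univ) F ∧ i ∈ faceJ s v F) →
        (IsFaceOf (cn s v Finset.univ) G ∧ i ∈ faceJ s v G) → π '' F = π '' G → F ⊆ G := by
      rintro F G ⟨hF, hFi⟩ ⟨hG, hGi⟩ h x hx
      obtain ⟨φ, hφ, hJ, he⟩ := face_spec hG
      have hφi := (hJ i).1 hGi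
      have hxa : x ∈ cn s v Finset.univ := by
        obtain ⟨_, _, _, he'⟩ := face_spec hF
        rw [he'] at hx
        exact cn_mono s v (Finset.subset_univ _) hx
      have : π x ∈ π '' G := h ▸ ⟨x, hx, rfl⟩
      obtain ⟨y, hy, hyx⟩ := this
      rw [he, mem_cn_filter s v hφ _ hJ] at hy ⊢
      refine ⟨hxa, ?_⟩
      rw [← hy.2, ← key φ hφi x, ← hyx, key φ hφi]
    intro F hF G hG h
    exact Subset.antisymm (hsub F G hF hG h) (hsub G F hG hF h.symm)
  · intro F'' hF''
    obtain ⟨ψ, hψ, hJ, he⟩ := face_spec hF''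
    obtain ⟨φ, hφ⟩ := exists_adj π ψ
    have h1 : ∀ j, j ∈ faceJ (π s) (π ∘ v) F'' ↔ pairE φ (v j) = 0 := fun j => by
      rw [hφ]; exact hJ j
    have hf := face_of_functional s v (φ := φ) (fun j => by rw [hφ]; exact hψ j) _ h1
    refine ⟨_, ⟨hf, ?_⟩, ?_⟩
    · simp only [faceJ, Finset.mem_filter, Finset.mem_univ, true_and]
      have hi : i ∈ faceJ (π s) (π ∘ v) F'' := by rw [h1, hφ, hπi, pairE_zero_right]
      have := cn_add_smul (cn_vertex_mem s v _) hi zero_le_one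
      simpa [faceJ] using this
    · show π '' _ = _
      rw [map_cn, ← he]

end faces


section meas
variable {d n : ℕ} {Λ : AddSubgroup (Vd d)}

/-- alternating sum of translated indicator functions -/
noncomputable def psi (v : Fin n → Vd d) (J : Finset (Fin n)) (A : Set (Vd d)) (x : Vd d) : ℝ :=
  ∑ I ∈ J.powerset, (-1) ^ I.card * A.indicator (fun _ => (1 : ℝ)) (x - ∑ i ∈ I, v i)

lemma mp_sum {v : Fin n → Vd d} {J : Finset (Fin n)} {m : Measure (Vd d)}
    (hm : ∀ i ∈ J, MeasurePreserving (fun x => x + v i) m m) :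
    MeasurePreserving (fun x => x + ∑ i ∈ J, v i) m m := by
  classical
  induction J using Finset.induction_on with
  | empty =>
    simp only [Finset.sum_empty, add_zero]
    exact MeasurePreserving.id m
  | insert i J hi ih =>
    have h1 := ih fun j hj => hm j (Finset.mem_insert_of_mem hj)
    have h2 := hm i (Finset.mem_insert_self i J)
    have := h1.comp h2
    convert this using 2 with x
    rw [Finset.sum_insert hi]; simp [add_assoc]

lemma emb_add (w : Vd d) : MeasurableEmbedding (fun x : Vd d => x + w) :=
  (Homeomorph.addRight w).measurableEmbedding

lemma shift_integral {w : Vd d} {m : Measure (Vd d)} (hm : MeasurePreserving (fun x => x + w) m m)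
    {A : Set (Vd d)} (hA : MeasurableSet A) (ξ : Vd d)
    (hi : IntegrableOn (fun x => Real.exp (pairE ξ x)) A m) :
    Integrable (fun x => A.indicator (fun _ => (1 : ℝ)) (x - w) * Real.exp (pairE ξ x)) m ∧
    ∫ x, A.indicator (fun _ => (1 : ℝ)) (x - w) * Real.exp (pairE ξ x) ∂m =
      Real.exp (pairE ξ w) * ∫ x in A, Real.exp (pairE ξ x) ∂m := by
  have e : (fun x => A.indicator (fun _ => (1 : ℝ)) (x - w) * Real.exp (pairE ξ x)) ∘ (fun x => x + w) =
      fun x => Real.exp (pairE ξ w) * A.indicator (fun x => Real.exp (pairE ξ x)) x := by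
    ext x
    simp only [Function.comp_apply, add_sub_cancel_right, pairE_add_right, Real.exp_add]
    by_cases hx : x ∈ A
    · simp [hx]; ring
    · simp [hx]
  constructor
  · rw [← hm.integrable_comp_emb (emb_add w), e]
    exact ((integrable_indicator_iff hA).2 hi).const_mul _
  · rw [← hm.integral_comp (emb_add w)]
    have := fun x => congrFun e x
    simp only [Function.comp_apply] at this
    simp only [this]
    rw [integral_const_mul, integral_indicator hA]

lemma psi_integral {v : Fin n → Vd d} {J : Finset (Fin n)} {m : Measure (Vd d)}
    (hm : ∀ i ∈ J, MeasurePreserving (fun x => x + v i) m m)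
    {A : Set (Vd d)} (hA : MeasurableSet A) (ξ : Vd d)
    (hi : IntegrableOn (fun x => Real.exp (pairE ξ x)) A m) :
    ∫ x, psi v J A x * Real.exp (pairE ξ x) ∂m =
      (∏ i ∈ J, (1 - Real.exp (pairE ξ (v i)))) * ∫ x in A, Real.exp (pairE ξ x) ∂m := by
  classical
  simp only [psi, Finset.sum_mul, mul_assoc]
  have hI : ∀ I ∈ J.powerset, MeasurePreserving (fun x => x + ∑ i ∈ I, v i) m m :=
    fun I hI => mp_sum fun i hi => hm i (Finset.mem_powerset.1 hI hi)
  rw [integral_finsetSum _ fun I h => ((shift_integral (hI I h) hA ξ hi).1.const_mul _)]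
  rw [Finset.prod_sub, Finset.sum_mul]
  refine Finset.sum_congr rfl fun I h => ?_
  rw [integral_const_mul, (shift_integral (hI I h) hA ξ hi).2, pairE_sum_right, Real.exp_sum]
  simp [mul_assoc]

lemma psi_split {v : Fin n → Vd d} {J : Finset (Fin n)} {i : Fin n} (hi : i ∈ J) {P : Set (Vd d)}
    (hP : ∀ x ∈ P, x + v i ∈ P) :
    psi v J P = psi v (J.erase i) {x | x ∈ P ∧ x - v i ∉ P} := by
  classical
  ext x
  unfold psi
  conv_lhs => rw [← Finset.insert_erase hi]
  rw [Finset.sum_powerset_insert (Finset.notMem_erase i J), ← Finset.sum_add_distrib]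
  refine Finset.sum_congr rfl fun I hI => ?_
  have hiI : i ∉ I := fun h => (Finset.notMem_erase i J) (Finset.mem_powerset.1 hI h)
  rw [Finset.card_insert_of_notMem hiI, Finset.sum_insert hiI, pow_succ]
  have e : x - (v i + ∑ i ∈ I, v i) = (x - ∑ i ∈ I, v i) - v i := by abel
  rw [e]
  set y := x - ∑ i ∈ I, v i
  by_cases h1 : y ∈ P <;> by_cases h2 : y - v i ∈ P
  · simp [h1, h2]
  · simp [h1, h2]
  · exact absurd (by simpa using hP _ h2) h1
  · simp [h1, h2]

lemma psi_support [DiscreteTopology Λ] (s : Vd d) (v : Fin n → Vd d) (hv : ∀ i, v i ∈ Λ)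
    (J : Finset (Fin n)) : ∃ R : ℝ, ∀ x, psi v J (cn s v J) x ≠ 0 → ‖x‖ ≤ R := by
  classical
  obtain ⟨Φ, hΦ, hd⟩ := cn_hdesc v hv J
  have hle : ∀ φ ∈ Φ, ∀ j ∈ J, pairE φ (v j) ≤ 0 := fun φ hφ j hj =>
    ((hd (v j)).1 (cn_gen_mem v hj)).2 φ hφ
  let T : ℝ := ∑ φ ∈ Φ, ∑ i ∈ J, (∑ j ∈ J, |pairE φ (v j)|) / |pairE φ (v i)|
  have hT : ∀ φ ∈ Φ, ∀ i ∈ J, pairE φ (v i) < 0 → ∑ j ∈ J, |pairE φ (v j)| ≤ T * |pairE φ (v i)| := by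
    intro φ hφ i hi h
    rw [← div_le_iff₀ (abs_pos.2 h.ne)]
    have h1 : (∑ j ∈ J, |pairE φ (v j)|) / |pairE φ (v i)| ≤ 
        ∑ i ∈ J, (∑ j ∈ J, |pairE φ (v j)|) / |pairE φ (v i)| :=
      Finset.single_le_sum (f := fun i => (∑ j ∈ J, |pairE φ (v j)|) / |pairE φ (v i)|)
        (fun i _ => by positivity) hi
    refine h1.trans ?_
    exact Finset.single_le_sum (f := fun φ => ∑ i ∈ J, (∑ j ∈ J, |pairE φ (v j)|) / |pairE φ (v i)|)
        (fun i _ => by positivity) hφ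
  have hT0 : 0 ≤ T := by positivity
  refine ⟨‖s‖ + ∑ i ∈ J, T * ‖v i‖, fun x hx => ?_⟩
  have hxP : x ∈ cn s v J := by
    by_contra hxP
    apply hx
    refine Finset.sum_eq_zero fun I hI => ?_
    rw [Set.indicator_of_notMem, mul_zero]
    intro h
    apply hxP
    have h2 : ∑ i ∈ I, v i ∈ cn 0 v J := by
      refine cn_mono _ _ (Finset.mem_powerset.1 hI) ⟨fun _ => 1, by simp, by simp⟩
    simpa using cn_add_cn h h2
  obtain ⟨t, ht, rfl⟩ := hxP
  have htT : ∀ i ∈ J, t i ≤ T := by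
    intro i hi
    by_contra hlt
    push Not at hlt
    apply hx
    rw [psi_split hi (fun x hx => by simpa using cn_add_smul hx hi zero_le_one)]
    refine Finset.sum_eq_zero fun I hI => ?_
    rw [Set.indicator_of_notMem, mul_zero]
    rintro ⟨h1, h2⟩
    apply h2
    rw [mem_cn_iff_sub, hd] at h1 ⊢
    have hI' := Finset.mem_powerset.1 hI
    have hiI : i ∉ I := fun h => (Finset.notMem_erase i J) (hI' h)
    have e : s + ∑ i ∈ J, t i • v i - ∑ i ∈ I, v i - v i - s = 
      (s + ∑ i ∈ J, t i • v i - ∑ i ∈ I, v i - s) - v i := by abel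
    refine ⟨?_, fun φ hφ => ?_⟩
    · rw [e]; exact Submodule.sub_mem _ h1.1 (Submodule.subset_span (hv i))
    · rcases (hle φ hφ i hi).lt_or_eq with h | h
      · have e' : s + ∑ i ∈ J, t i • v i - ∑ i ∈ I, v i - v i - s = 
          ∑ i ∈ J, t i • v i - ∑ i ∈ insert i I, v i := by rw [Finset.sum_insert hiI]; abel
        rw [e', pairE_sub_right, pairE_comb, pairE_sum_right]
        have a1 : ∑ j ∈ J, t j * pairE φ (v j) ≤ t i * pairE φ (v i) := by
          rw [← Finset.add_sum_erase _ _ hi]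
          have := Finset.sum_nonpos (fun j (hj : j ∈ J.erase i) => 
            mul_nonpos_of_nonneg_of_nonpos (ht j) (hle φ hφ j (Finset.mem_of_mem_erase hj)))
          linarith
        have a2 : - ∑ j ∈ insert i I, pairE φ (v j) ≤ ∑ j ∈ J, |pairE φ (v j)| := by
          rw [← Finset.sum_neg_distrib]
          refine (Finset.sum_le_sum fun j _ => neg_le_abs (pairE φ (v j))).trans ?_
          refine Finset.sum_le_sum_of_subset_of_nonneg ?_ fun _ _ _ => abs_nonneg _
          intro j hj
          rcases Finset.mem_insert.1 hj with rfl | hj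
          · exact hi
          · exact Finset.mem_of_mem_erase (hI' hj)
        have a3 := hT φ hφ i hi h
        rw [abs_of_neg h] at a3
        nlinarith
      · rw [e, pairE_sub_right, h, sub_zero]; exact h1.2 φ hφ
  refine (norm_add_le _ _).trans (add_le_add le_rfl ((norm_sum_le _ _).trans ?_))
  refine Finset.sum_le_sum fun i hi => ?_
  rw [norm_smul, Real.norm_of_nonneg (ht i)]
  exact mul_le_mul_of_nonneg_right (htT i hi) (norm_nonneg _)

lemma psi_measurable (v : Fin n → Vd d) (J : Finset (Fin n)) {A : Set (Vd d)} (hA : MeasurableSet A) :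
    Measurable (psi v J A) := by
  unfold psi
  refine Finset.measurable_fun_sum _ fun I _ => Measurable.const_mul ?_ _
  exact (measurable_const.indicator hA).comp (measurable_id.sub_const _)

lemma psi_bound (v : Fin n → Vd d) (J : Finset (Fin n)) (A : Set (Vd d)) (x : Vd d) :
    ‖psi v J A x‖ ≤ J.powerset.card := by
  unfold psi
  refine (norm_sum_le _ _).trans ?_
  rw [← nsmul_one, ← Finset.sum_const]
  refine Finset.sum_le_sum fun I _ => ?_
  rw [norm_mul, norm_pow, norm_neg, norm_one, one_pow, one_mul]
  exact norm_indicator_le_norm_self (fun _ => (1:ℝ)) _ |>.trans (by simp)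

end meas


section meas2
variable {d n : ℕ} {Λ : AddSubgroup (Vd d)}

lemma laplace_analytic {m : Measure (Vd d)} [IsFiniteMeasureOnCompacts m] {ψ : Vd d → ℝ}
    (hψ : Measurable ψ) {C R : ℝ} (hC : ∀ x, ‖ψ x‖ ≤ C) (hR : ∀ x, ψ x ≠ 0 → ‖x‖ ≤ R) (ξ : Vd d) :
    AnalyticAt ℝ (fun ξ => ∫ x, ψ x * Real.exp (pairE ξ x) ∂m) ξ := by
  classical
  let K : Set (Vd d) := Metric.closedBall 0 R
  have hK : IsCompact K := isCompact_closedBall 0 R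
  have : CompactSpace K := isCompact_iff_compactSpace.1 hK
  have hKm : MeasurableSet K := hK.measurableSet
  let ν : Measure K := m.comap Subtype.val
  have : IsFiniteMeasure ν := by
    constructor
    rw [Measure.comap_apply _ Subtype.val_injective (fun s hs => hKm.subtype_image hs) _ MeasurableSet.univ]
    simpa using hK.measure_lt_top
  let A₀ : Vd d →ₗ[ℝ] C(K, ℝ) :=
    { toFun := fun ξ => ⟨fun x => pairE ξ x, (continuous_pairE_right ξ).comp continuous_subtype_val⟩
      map_add' := fun a b => by ext x; exact pairE_add_left _ _ _
      map_smul' := fun r a => by ext x; exact pairE_smul_left _ _ _ }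
  let A : Vd d →L[ℝ] C(K, ℝ) := LinearMap.toContinuousLinearMap A₀
  have hintg : ∀ f : C(K, ℝ), Integrable (fun x : K => ψ x * f x) ν := by
    intro f
    refine Integrable.bdd_mul (c := C) ?_ ?_ ?_
    · exact Integrable.of_bound (f.continuous.aestronglyMeasurable) ‖f‖ (ae_of_all _ fun x => f.norm_coe_le_norm x)
    · exact (hψ.comp measurable_subtype_coe).aestronglyMeasurable
    · exact ae_of_all _ fun x => hC x
  let B₀ : C(K, ℝ) →ₗ[ℝ] ℝ :=
    { toFun := fun f => ∫ x : K, ψ x * f x ∂ν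
      map_add' := fun f g => by
        simp only [ContinuousMap.add_apply, mul_add]
        exact integral_add (hintg f) (hintg g)
      map_smul' := fun r f => by
        simp only [ContinuousMap.smul_apply, smul_eq_mul, RingHom.id_apply]
        rw [← integral_const_mul]
        congr 1; ext x; ring }
  let B : C(K, ℝ) →L[ℝ] ℝ := B₀.mkContinuous (C * ν.real univ) (by
    intro f
    have : ‖∫ x : K, ψ x * f x ∂ν‖ ≤ (C * ‖f‖) * ν.real univ := by
      refine norm_integral_le_of_norm_le_const (ae_of_all _ fun x => ?_)
      rw [norm_mul]
      exact mul_le_mul (hC x) (f.norm_coe_le_norm x) (norm_nonneg _) ((norm_nonneg _).trans (hC x))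
    refine this.trans (le_of_eq (by ring)))
  have heq : (fun ξ => ∫ x, ψ x * Real.exp (pairE ξ x) ∂m) = fun ξ => B (NormedSpace.exp (A ξ)) := by
    ext ξ
    have e1 : ∀ x : K, (NormedSpace.exp (A ξ)) x = Real.exp (pairE ξ x) := by
      intro x
      let _ : NormedAlgebra ℚ C(K, ℝ) := NormedAlgebra.restrictScalars ℚ ℝ _
      have := NormedSpace.map_exp (ContinuousMap.evalAlgHom ℝ ℝ x : C(K, ℝ) →ₐ[ℝ] ℝ) 
        (ContinuousEvalConst.continuous_eval_const x) (A ξ)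
      rw [← Real.exp_eq_exp_ℝ] at this
      exact this
    have e2 : B (NormedSpace.exp (A ξ)) = ∫ x : K, ψ x * Real.exp (pairE ξ x) ∂ν := by
      show ∫ x : K, ψ x * (NormedSpace.exp (A ξ)) x ∂ν = _
      simp only [e1]
    rw [e2, integral_subtype_comap hKm (fun x => ψ x * Real.exp (pairE ξ x))]
    symm
    refine setIntegral_eq_integral_of_forall_compl_eq_zero fun x hx => ?_
    by_contra h
    apply hx
    have : ψ x ≠ 0 := fun h0 => h (by rw [h0, zero_mul])
    simpa [K] using hR x this
  rw [heq]
  exact (B.analyticAt _).comp ((NormedSpace.exp_analytic (𝕂 := ℝ) (A ξ)).comp (A.analyticAt ξ))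

lemma lint_cone_lt_top {m : Measure (Vd d)} [IsFiniteMeasureOnCompacts m] {v : Fin n → Vd d}
    (J : Finset (Fin n)) (hm : ∀ i ∈ J, MeasurePreserving (fun x => x + v i) m m) {ξ : Vd d}
    (hξ : ∀ i ∈ J, pairE ξ (v i) < 0) (K : Set (Vd d)) (hK : IsCompact K) :
    ∫⁻ x in (K + cn 0 v J), ENNReal.ofReal (Real.exp (pairE ξ x)) ∂m < ⊤ := by
  classical
  induction J using Finset.induction_on generalizing K with
  | empty =>
    have : K + cn 0 v ∅ = K := by
      have : cn 0 v ∅ = {0} := by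
        ext x; constructor
        · rintro ⟨t, _, rfl⟩; simp
        · rintro rfl; exact cn_vertex_mem _ _ _
      rw [this]; simp
    rw [this]
    have := ((Real.continuous_exp.comp (continuous_pairE_right ξ)).continuousOn.integrableOn_compact hK (μ := m))
    have h2 := this.lintegral_lt_top
    exact h2
  | insert i J hi ih =>
    let seg : Set (Vd d) := (fun r : ℝ => r • v i) '' Icc 0 1
    have hseg : IsCompact seg := isCompact_Icc.image (by fun_prop)
    have hK' := hK.add hseg
    have hfin := ih (fun j hj => hm j (Finset.mem_insert_of_mem hj))
      (fun j hj => hξ j (Finset.mem_insert_of_mem hj)) _ hK'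
    set A := (K + seg) + cn 0 v J with hA
    have hcov : K + cn 0 v (insert i J) ⊆ ⋃ k : ℕ, (fun x => x + k • v i) '' A := by
      rintro _ ⟨x, hx, y, hy, rfl⟩
      obtain ⟨t, ht, hy'⟩ := (cn_insert 0 v J hi y).1 hy
      refine mem_iUnion.2 ⟨⌊t⌋₊, (x + (t - ⌊t⌋₊) • v i) + (y - t • v i), ?_, ?_⟩
      · refine ⟨_, ⟨x, hx, _, ⟨t - ⌊t⌋₊, ⟨?_, ?_⟩, rfl⟩, rfl⟩, _, hy', rfl⟩
        · exact sub_nonneg.2 (Nat.floor_le ht)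
        · have := Nat.lt_floor_add_one t; linarith
      · simp only [sub_smul, Nat.cast_smul_eq_nsmul]; abel
    have hmk : ∀ k : ℕ, MeasurePreserving (fun x => x + k • v i) m m := by
      intro k
      induction k with
      | zero => simp only [zero_smul, add_zero]; exact MeasurePreserving.id m
      | succ k ihk =>
        convert (hm i (Finset.mem_insert_self i J)).comp ihk using 2 with x
        simp [succ_nsmul, add_assoc]
    have hterm : ∀ k : ℕ, ∫⁻ x in (fun x => x + k • v i) '' A, ENNReal.ofReal (Real.exp (pairE ξ x)) ∂m =
        (ENNReal.ofReal (Real.exp (pairE ξ (v i)))) ^ k *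
          ∫⁻ x in A, ENNReal.ofReal (Real.exp (pairE ξ x)) ∂m := by
      intro k
      rw [← (hmk k).setLIntegral_comp_emb (emb_add _), ← lintegral_const_mul']
      · congr 1; ext x
        rw [pairE_add_right, Real.exp_add, mul_comm, ENNReal.ofReal_mul (Real.exp_nonneg _),
          ← ENNReal.ofReal_pow (Real.exp_nonneg _), ← Real.exp_nat_mul]
        congr 3
        rw [← Nat.cast_smul_eq_nsmul ℝ, pairE_smul_right]
      · exact ENNReal.pow_ne_top ENNReal.ofReal_ne_top
    refine (lintegral_mono_set hcov).trans_lt ((lintegral_iUnion_le _ _).trans_lt ?_)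
    simp only [hterm]
    rw [ENNReal.tsum_mul_right, ENNReal.tsum_geometric]
    refine ENNReal.mul_lt_top ?_ hfin
    rw [ENNReal.inv_lt_top, tsub_pos_iff_lt]
    rw [← ENNReal.ofReal_one]
    refine (ENNReal.ofReal_lt_ofReal_iff one_pos).2 ?_
    rw [Real.exp_lt_one_iff]
    exact hξ i (Finset.mem_insert_self i J)

lemma exp_integrableOn_cn {m : Measure (Vd d)} [IsFiniteMeasureOnCompacts m] {v : Fin n → Vd d}
    (J : Finset (Fin n)) (hm : ∀ i ∈ J, MeasurePreserving (fun x => x + v i) m m) {ξ : Vd d}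
    (hξ : ∀ i ∈ J, pairE ξ (v i) < 0) (s : Vd d) :
    IntegrableOn (fun x => Real.exp (pairE ξ x)) (cn s v J) m := by
  have h := lint_cone_lt_top J hm hξ {s} isCompact_singleton
  have e : ({s} : Set (Vd d)) + cn 0 v J = cn s v J := by
    ext x
    rw [mem_cn_iff_sub]
    constructor
    · rintro ⟨y, rfl, z, hz, rfl⟩; simpa using hz
    · intro hx; exact ⟨s, rfl, _, hx, by simp⟩
  rw [e] at h
  have hc := (Real.continuous_exp.comp (continuous_pairE_right ξ))
  refine ⟨hc.aestronglyMeasurable, ?_⟩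
  rw [hasFiniteIntegral_iff_ofReal (ae_of_all _ fun x => Real.exp_nonneg _)]
  exact h

end meas2


section meas3
variable {d n : ℕ} {Λ : AddSubgroup (Vd d)}

/-- the entire function attached to a cone and a measure -/
noncomputable def Ef (s : Vd d) (v : Fin n → Vd d) (J : Finset (Fin n)) (m : Measure (Vd d)) (ξ : Vd d) : ℝ :=
  ∫ x, psi v J (cn s v J) x * Real.exp (pairE ξ x) ∂m

/-- the denominators -/
noncomputable def Dn (v : Fin n → Vd d) (J : Finset (Fin n)) (ξ : Vd d) : ℝ :=
  ∏ i ∈ J, (1 - Real.exp (pairE ξ (v i)))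

lemma Ef_analytic [DiscreteTopology Λ] (s : Vd d) (v : Fin n → Vd d) (hv : ∀ i, v i ∈ Λ)
    (J : Finset (Fin n)) (m : Measure (Vd d)) [IsFiniteMeasureOnCompacts m] (ξ : Vd d) :
    AnalyticAt ℝ (Ef s v J m) ξ := by
  obtain ⟨R, hR⟩ := psi_support s v hv J
  exact laplace_analytic (psi_measurable v J (cn_closed v hv J s).measurableSet) (psi_bound v J _) hR ξ

lemma Ef_eq [DiscreteTopology Λ] (s : Vd d) (v : Fin n → Vd d) (hv : ∀ i, v i ∈ Λ)
    (J : Finset (Fin n)) (m : Measure (Vd d)) [IsFiniteMeasureOnCompacts m]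
    (hm : ∀ i ∈ J, MeasurePreserving (fun x => x + v i) m m) {ξ : Vd d}
    (hξ : ∀ i ∈ J, pairE ξ (v i) < 0) :
    Ef s v J m ξ = Dn v J ξ * ∫ x in cn s v J, Real.exp (pairE ξ x) ∂m :=
  psi_integral hm (cn_closed v hv J s).measurableSet ξ (exp_integrableOn_cn J hm hξ s)

lemma Ef_hyper [DiscreteTopology Λ] (s : Vd d) (v : Fin n → Vd d) (hv : ∀ i, v i ∈ Λ)
    (J : Finset (Fin n)) (m m'' : Measure (Vd d)) 
    (hm : ∀ i ∈ J, MeasurePreserving (fun x => x + v i) m m) {i : Fin n} (hi : i ∈ J)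
    {π : Vd d →ₗ[ℝ] Vd d} (hπ : ∀ x, x - π x ∈ Submodule.span ℝ {v i}) 
    (hpush : Measure.map π (m.restrict {x | x ∈ cn s v J ∧ x - v i ∉ cn s v J}) = 
      m''.restrict (π '' cn s v J)) {ξ : Vd d} (hξi : pairE ξ (v i) = 0)
    (hintg : IntegrableOn (fun x => Real.exp (pairE ξ x)) (π '' cn s v J) m'') :
    Ef s v J m ξ = Dn v (J.erase i) ξ * ∫ x in π '' cn s v J, Real.exp (pairE ξ x) ∂m'' := by
  classical
  have key : ∀ x, pairE ξ (π x) = pairE ξ x := by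
    intro x
    obtain ⟨r, hr⟩ := Submodule.mem_span_singleton.1 (hπ x)
    have : x = π x + r • v i := by rw [hr]; abel
    nth_rewrite 2 [this]
    rw [pairE_add_right, pairE_smul_right, hξi]; ring
  have hπm : Measurable π := (LinearMap.continuous_of_finiteDimensional π).measurable
  have hcl := (cn_closed v hv J s)
  have hP' : MeasurableSet {x | x ∈ cn s v J ∧ x - v i ∉ cn s v J} := 
    hcl.measurableSet.inter ((hcl.measurableSet.preimage (measurable_id.sub_const _)).compl)
  have hc : Continuous (fun x => Real.exp (pairE ξ x)) :=
    (Real.continuous_exp.comp (continuous_pairE_right ξ))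
  have hintg' : IntegrableOn (fun x => Real.exp (pairE ξ x)) 
      {x | x ∈ cn s v J ∧ x - v i ∉ cn s v J} m := by
    unfold IntegrableOn at hintg
    rw [← hpush, integrable_map_measure hc.aestronglyMeasurable hπm.aemeasurable] at hintg
    have e : (fun x => Real.exp (pairE ξ x)) ∘ π = fun x => Real.exp (pairE ξ x) := by
      ext x; simp [key]
    rw [e] at hintg
    exact hintg
  unfold Ef
  rw [psi_split hi (fun x hx => by simpa using cn_add_smul hx hi zero_le_one),
    psi_integral (fun j hj => hm j (Finset.mem_of_mem_erase hj)) hP' ξ hintg']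
  rw [← hpush, integral_map hπm.aemeasurable hc.aestronglyMeasurable]
  simp only [key]
  rfl

lemma fiber_lemma {P : Set (Vd d)} (hcl : IsClosed P) {w : Vd d} (hw : w ≠ 0)
    (hP : ∀ x ∈ P, ∀ r : ℝ, 0 ≤ r → x + r • w ∈ P) (hl : ¬ ContainsLine P) (x : Vd d)
    (hx : ∃ r : ℝ, x + r • w ∈ P) : ∃ τ : ℝ, ∀ r : ℝ, x + r • w ∈ P ↔ τ ≤ r := by
  let R : Set ℝ := {r | x + r • w ∈ P}
  have hup : ∀ r ∈ R, ∀ r', r ≤ r' → r' ∈ R := by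
    intro r hr r' h
    have := hP _ hr (r' - r) (sub_nonneg.2 h)
    rw [add_assoc, ← add_smul] at this
    simpa [R] using this
  have hRc : IsClosed R := hcl.preimage (by fun_prop)
  have hbb : BddBelow R := by
    by_contra hb
    refine hl ⟨x, w, hw, fun t => ?_⟩
    rw [not_bddBelow_iff] at hb
    obtain ⟨r, hr, hrt⟩ := hb t
    exact hup r hr t hrt.le
  have hmem := hRc.csInf_mem hx hbb
  exact ⟨sInf R, fun r => ⟨fun h => csInf_le hbb h, fun h => hup _ hmem _ h⟩⟩

lemma fiber_lemma' {P : Set (Vd d)} (hcl : IsClosed P) {w : Vd d} (hw : w ≠ 0)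
    (hP : ∀ x ∈ P, ∀ r : ℝ, 0 ≤ r → x + r • w ∈ P) (hl : ¬ ContainsLine P) (x : Vd d)
    (hx : ∃ r : ℝ, x + r • w ∈ P) : 
    ∃ τ : ℝ, ∀ r : ℝ, x + r • w ∈ {x | x ∈ P ∧ x - w ∉ P} ↔ r ∈ Ico τ (τ + 1) := by
  obtain ⟨τ, h⟩ := fiber_lemma hcl hw hP hl x hx
  refine ⟨τ, fun r => ?_⟩
  show _ ∧ _ ↔ _ ∧ _
  have e : x + r • w - w = x + (r - 1) • w := by rw [sub_smul, one_smul]; abel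
  rw [e, h, h, not_le, sub_lt_iff_lt_add]

lemma mem_image_iff_fiber {P : Set (Vd d)} {w : Vd d} {π : Vd d →ₗ[ℝ] Vd d}
    (hπ : ∀ x, x - π x ∈ Submodule.span ℝ {w}) (hπw : π w = 0) (x : Vd d) :
    π x ∈ π '' P ↔ ∃ r : ℝ, x + r • w ∈ P := by
  constructor
  · rintro ⟨y, hy, h⟩
    have : y - x ∈ Submodule.span ℝ {w} := by
      have h1 := Submodule.sub_mem _ (hπ y) (hπ x)
      rw [h] at h1
      have e : y - π x - (x - π x) = y - x := by abel
      rwa [e] at h1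
    obtain ⟨r, hr⟩ := Submodule.mem_span_singleton.1 this
    exact ⟨r, by rw [hr]; simpa using hy⟩
  · rintro ⟨r, hr⟩
    exact ⟨_, hr, by simp [hπw]⟩

lemma eq_add_of_proj {w : Vd d} {π : Vd d →ₗ[ℝ] Vd d}
    (hπ : ∀ x, x - π x ∈ Submodule.span ℝ {w}) {x y : Vd d} (h : π x = π y) :
    ∃ r : ℝ, y = x + r • w := by
  have h1 := Submodule.sub_mem _ (hπ y) (hπ x)
  rw [h] at h1
  have e : y - π y - (x - π y) = y - x := by abel
  rw [e] at h1
  obtain ⟨r, hr⟩ := Submodule.mem_span_singleton.1 h1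
  exact ⟨r, by rw [hr]; abel⟩

lemma count_push [DiscreteTopology Λ] {P : Set (Vd d)} (hcl : IsClosed P) {w : Vd d} (hw : w ≠ 0)
    (hP : ∀ x ∈ P, ∀ r : ℝ, 0 ≤ r → x + r • w ∈ P) (hl : ¬ ContainsLine P)
    {π : Vd d →ₗ[ℝ] Vd d} (hπ : ∀ x, x - π x ∈ Submodule.span ℝ {w}) (hπw : π w = 0)
    (hwΛ : w ∈ Λ) (hprim : ∀ q : ℝ, q • w ∈ Λ → ∃ k : ℤ, q = k) 
    [DiscreteTopology (AddSubgroup.map π.toAddMonoidHom Λ)] :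
    Measure.map π ((Measure.count.restrict (Λ : Set (Vd d))).restrict {x | x ∈ P ∧ x - w ∉ P}) = 
      (Measure.count.restrict (AddSubgroup.map π.toAddMonoidHom Λ : Set (Vd d))).restrict (π '' P) := by
  have hπm : Measurable π := (LinearMap.continuous_of_finiteDimensional π).measurable
  have hΛm : ∀ (M : AddSubgroup (Vd d)) [DiscreteTopology M], MeasurableSet (M : Set (Vd d)) := 
    fun M _ => (AddSubgroup.isClosed_of_discrete (H := M)).measurableSet
  have hP' : MeasurableSet {x | x ∈ P ∧ x - w ∉ P} := 
    hcl.measurableSet.inter ((hcl.measurableSet.preimage (measurable_id.sub_const _)).compl)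
  have himg : MeasurableSet (π '' P ∩ (AddSubgroup.map π.toAddMonoidHom Λ : Set (Vd d))) := by
    have : Countable (AddSubgroup.map π.toAddMonoidHom Λ) :=
      TopologicalSpace.separableSpace_iff_countable.1 inferInstance
    exact (Set.Countable.mono inter_subset_right (Set.countable_coe_iff.1 this)).measurableSet
  ext A hA
  rw [Measure.map_apply hπm hA, Measure.restrict_apply (hπm hA), 
    Measure.restrict_apply ((hπm hA).inter hP'), Measure.restrict_apply hA, 
    Measure.restrict_apply' (hΛm _), Measure.count_apply (((hπm hA).inter hP').inter (hΛm Λ)),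
    Measure.count_apply (by rw [inter_assoc]; exact hA.inter himg)]
  have hbij : BijOn π (π ⁻¹' A ∩ {x | x ∈ P ∧ x - w ∉ P} ∩ (Λ : Set (Vd d)))
      (A ∩ π '' P ∩ (AddSubgroup.map π.toAddMonoidHom Λ : Set (Vd d))) := by
    refine ⟨?_, ?_, ?_⟩
    · rintro x ⟨⟨hxA, hxP⟩, hxΛ⟩
      exact ⟨⟨hxA, ⟨x, hxP.1, rfl⟩⟩, ⟨x, hxΛ, rfl⟩⟩
    · rintro x ⟨⟨hxA, hxP⟩, hxΛ⟩ y ⟨⟨hyA, hyP⟩, hyΛ⟩ hxy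
      obtain ⟨r, rfl⟩ := eq_add_of_proj hπ hxy
      obtain ⟨τ, hτ⟩ := fiber_lemma' hcl hw hP hl x ⟨0, by simpa using hxP.1⟩
      have h1 := (hτ 0).1 (by simpa using hxP)
      have h2 := (hτ r).1 hyP
      obtain ⟨k, rfl⟩ := hprim r (by simpa using Λ.sub_mem hyΛ hxΛ)
      have h3 : (-1 : ℝ) < k := by linarith [h1.2, h2.1]
      have h4 : (k : ℝ) < 1 := by linarith [h1.1, h2.2]
      have h5 : (-1 : ℤ) < k := by exact_mod_cast h3
      have h6 : k < 1 := by exact_mod_cast h4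
      have : k = 0 := by omega
      simp [this]
    · rintro y ⟨⟨hyA, hyP⟩, ⟨x, hxΛ, rfl⟩⟩
      have hyP' : π x ∈ π '' P := hyP
      obtain ⟨τ, hτ⟩ := fiber_lemma' hcl hw hP hl x ((mem_image_iff_fiber hπ hπw x).1 hyP')
      have h1 := (hτ ⌈τ⌉).2 ⟨Int.le_ceil τ, Int.ceil_lt_add_one τ⟩
      have h2 : π (x + (⌈τ⌉ : ℝ) • w) = π x := by simp [hπw]
      refine ⟨x + (⌈τ⌉ : ℝ) • w, ⟨⟨?_, h1⟩, ?_⟩, h2⟩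
      · show π _ ∈ A
        rw [h2]; exact hyA
      · refine Λ.add_mem hxΛ ?_
        rw [Int.cast_smul_eq_zsmul]; exact Λ.zsmul_mem hwΛ _
  rw [← hbij.image_eq, hbij.injOn.encard_image]

lemma count_props (M : AddSubgroup (Vd d)) [DiscreteTopology M] :
    IsFiniteMeasureOnCompacts ((Measure.count : Measure (Vd d)).restrict (M : Set (Vd d))) ∧
    ∀ y ∈ M, MeasurePreserving (fun x => x + y) 
      ((Measure.count : Measure (Vd d)).restrict (M : Set (Vd d))) 
      ((Measure.count : Measure (Vd d)).restrict (M : Set (Vd d))) := by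
  have hMm : MeasurableSet (M : Set (Vd d)) := (AddSubgroup.isClosed_of_discrete (H := M)).measurableSet
  constructor
  · constructor
    intro K hK
    rw [Measure.restrict_apply hK.measurableSet]
    exact Measure.count_apply_lt_top.2 (disc_finite_inter M K hK.isBounded)
  · intro y hy
    have hmeas : Measurable (fun x : Vd d => x + y) := measurable_id.add_const y
    refine ⟨hmeas, ?_⟩
    ext A hA
    rw [Measure.map_apply hmeas hA, Measure.restrict_apply (hmeas hA), Measure.restrict_apply hA,
      Measure.count_apply ((hmeas hA).inter hMm), Measure.count_apply (hA.inter hMm)]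
    rw [← (add_left_injective y).encard_image]
    congr 2
    ext x; constructor
    · rintro ⟨z, ⟨hz, hzM⟩, rfl⟩
      exact ⟨hz, M.add_mem hzM hy⟩
    · rintro ⟨h1, h2⟩
      exact ⟨x - y, ⟨by simpa using h1, M.sub_mem h2 hy⟩, by simp⟩

end meas3


section meas4
variable {d n : ℕ} {Λ : AddSubgroup (Vd d)}

lemma param_emb {k : ℕ} (x₀ : Vd d) {b : Fin k → Vd d} (hb : LinearIndependent ℝ b) :
    IsClosedEmbedding (fun t : Fin k → ℝ => x₀ + ∑ i, t i • b i) := by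
  have h1 : IsClosedEmbedding (Fintype.linearCombination ℝ b) :=
    LinearMap.isClosedEmbedding_of_injective (LinearMap.ker_eq_bot.2 hb.fintypeLinearCombination_injective)
  exact (Homeomorph.addLeft x₀).isClosedEmbedding.comp h1

lemma canon_props {A : Set (Vd d)} {m : Measure (Vd d)} (h : IsCanonicalMeasure Λ A m) :
    IsFiniteMeasureOnCompacts m ∧
    ∀ y : Vd d, (∃ x ∈ A, x + y ∈ A) → MeasurePreserving (fun x => x + y) m m := by
  obtain ⟨k, x₀, b, hx₀, hbΛ, hb, hA, hintg, rfl⟩ := h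
  have hemb := param_emb x₀ hb
  have hmT := hemb.measurableEmbedding
  constructor
  · constructor
    intro K hK
    rw [hmT.map_apply]
    exact (hemb.isCompact_preimage hK).measure_lt_top
  · rintro y ⟨x, hx, hxy⟩
    rw [hA] at hx hxy
    obtain ⟨t, rfl⟩ := hx
    obtain ⟨u, hu⟩ := hxy
    have hy : y = ∑ i, (u - t) i • b i := by
      simp only [Pi.sub_apply, sub_smul, Finset.sum_sub_distrib]
      have : y = x₀ + ∑ i, t i • b i + y - (x₀ + ∑ i, t i • b i) := by abel
      rw [this, hu]; abel
    have hma : Measurable (fun x : Vd d => x + y) := measurable_id.add_const y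
    have hmb : Measurable (fun z : Fin k → ℝ => z + (u - t)) := measurable_id.add_const _
    refine ⟨hma, ?_⟩
    rw [Measure.map_map hma hmT.measurable]
    have : (fun x => x + y) ∘ (fun t : Fin k → ℝ => x₀ + ∑ i, t i • b i) =
        (fun t : Fin k → ℝ => x₀ + ∑ i, t i • b i) ∘ (fun z => z + (u - t)) := by
      ext1 z
      simp only [Function.comp_apply, Pi.add_apply, add_smul, Finset.sum_add_distrib]
      nth_rewrite 1 [hy]
      abel
    rw [this, ← Measure.map_map hmT.measurable hmb,
      map_add_right_eq_self]

lemma exists_lat_basis [hΛ : DiscreteTopology Λ] {L : Submodule ℝ (Vd d)} {T : Set (Vd d)} (hT : T ⊆ Λ)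
    (hL : L = Submodule.span ℝ T) : ∃ (k : ℕ) (b : Fin k → Vd d), LinearIndependent ℝ b ∧
      (∀ i, b i ∈ Λ) ∧ Submodule.span ℝ (range b) = L ∧
      ∀ y ∈ Λ, y ∈ L → ∃ c : Fin k → ℤ, y = ∑ i, (c i : ℝ) • b i := by
  let M : AddSubgroup (Vd d) := Λ ⊓ L.toAddSubgroup
  have hM : DiscreteTopology M := 
    DiscreteTopology.of_subset (s := (Λ : Set (Vd d))) hΛ (fun x hx => hx.1)
  obtain ⟨k, b, hb, hbM, hbc⟩ := exists_disc_basis M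
  refine ⟨k, b, hb, fun i => (hbM i).1, ?_, fun y hy hyL => hbc y ⟨hy, hyL⟩⟩
  refine le_antisymm (Submodule.span_le.2 ?_) ?_
  · rintro _ ⟨i, rfl⟩; exact (hbM i).2
  · rw [hL, Submodule.span_le]
    intro y hy
    obtain ⟨c, rfl⟩ := hbc y ⟨hT hy, by rw [hL]; exact Submodule.subset_span hy⟩
    exact Submodule.sum_mem _ fun i _ => Submodule.smul_mem _ _ (Submodule.subset_span ⟨i, rfl⟩)

lemma canon_of_basis (s : Vd d) (v : Fin n → Vd d) (J : Finset (Fin n)) {k : ℕ} {b : Fin k → Vd d}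
    (hb : LinearIndependent ℝ b) (hbΛ : ∀ i, b i ∈ Λ) 
    (hbL : Submodule.span ℝ (range b) = Submodule.span ℝ (v '' (J : Set (Fin n))))
    (hbc : ∀ y ∈ Λ, y ∈ Submodule.span ℝ (range b) → ∃ c : Fin k → ℤ, y = ∑ i, (c i : ℝ) • b i) :
    IsCanonicalMeasure Λ (affineSpan ℝ (cn s v J) : Set (Vd d))
      (Measure.map (fun t : Fin k → ℝ => s + ∑ i, t i • b i) volume) := by
  refine ⟨k, s, b, subset_affineSpan _ _ (cn_vertex_mem _ _ _), hbΛ, hb, ?_, hbc, rfl⟩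
  ext x
  rw [SetLike.mem_coe, mem_affineSpan_cn, ← hbL, Submodule.mem_span_range_iff_exists_fun]
  constructor
  · rintro ⟨c, hc⟩; exact ⟨c, by rw [hc]; abel⟩
  · rintro ⟨c, hc⟩; exact ⟨c, by rw [hc]; abel⟩

lemma exists_canon [DiscreteTopology Λ] (s : Vd d) (v : Fin n → Vd d) (hv : ∀ i, v i ∈ Λ)
    (J : Finset (Fin n)) : 
    ∃ m, IsCanonicalMeasure Λ (affineSpan ℝ (cn s v J) : Set (Vd d)) m := by
  obtain ⟨k, b, hb, hbΛ, hbL, hbc⟩ := exists_lat_basis (Λ := Λ) (T := v '' (J : Set (Fin n)))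
    (by rintro _ ⟨i, _, rfl⟩; exact hv i) rfl
  exact ⟨_, canon_of_basis s v J hb hbΛ hbL fun y hy hyL => hbc y hy (hbL ▸ hyL)⟩

lemma canon_cn_props {s : Vd d} {v : Fin n → Vd d} {J : Finset (Fin n)} {m : Measure (Vd d)}
    (h : IsCanonicalMeasure Λ (affineSpan ℝ (cn s v J) : Set (Vd d)) m) :
    IsFiniteMeasureOnCompacts m ∧ ∀ i ∈ J, MeasurePreserving (fun x => x + v i) m m := by
  refine ⟨(canon_props h).1, fun i hi => (canon_props h).2 _ ⟨s, ?_, ?_⟩⟩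
  · exact subset_affineSpan _ _ (cn_vertex_mem _ _ _)
  · refine subset_affineSpan _ _ ?_
    simpa using cn_add_smul (cn_vertex_mem s v J) hi zero_le_one

lemma leb_push {P : Set (Vd d)} (hcl : IsClosed P) {w : Vd d} (hw : w ≠ 0)
    (hP : ∀ x ∈ P, ∀ r : ℝ, 0 ≤ r → x + r • w ∈ P) (hl : ¬ ContainsLine P)
    {π : Vd d →ₗ[ℝ] Vd d} (hπ : ∀ x, x - π x ∈ Submodule.span ℝ {w}) (hπw : π w = 0)
    (hcl'' : IsClosed (π '' P)) (s : Vd d) {k : ℕ} {b : Fin k → Vd d} 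
    (hb : LinearIndependent ℝ (Fin.cons w b : Fin (k + 1) → Vd d)) (hb'' : LinearIndependent ℝ (π ∘ b)) :
    Measure.map π ((Measure.map (fun t : Fin (k + 1) → ℝ => s + ∑ i, t i • 
      (Fin.cons w b : Fin (k + 1) → Vd d) i) volume).restrict {x | x ∈ P ∧ x - w ∉ P}) = 
    (Measure.map (fun t : Fin k → ℝ => π s + ∑ i, t i • (π ∘ b) i) volume).restrict (π '' P) := by
  have hπm : Measurable π := (LinearMap.continuous_of_finiteDimensional π).measurable
  have hP' : MeasurableSet {x | x ∈ P ∧ x - w ∉ P} := 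
    hcl.measurableSet.inter ((hcl.measurableSet.preimage (measurable_id.sub_const _)).compl)
  have hT := (param_emb s hb).measurableEmbedding
  have hT'' := (param_emb (π s) hb'').measurableEmbedding
  ext A hA
  rw [Measure.map_apply hπm hA, Measure.restrict_apply (hπm hA), Measure.restrict_apply hA,
    hT.map_apply, hT''.map_apply]
  have hAP : MeasurableSet (A ∩ π '' P) := hA.inter hcl''.measurableSet
  have hvp := volume_preserving_piFinSuccAbove (fun _ : Fin (k + 1) => ℝ) 0
  set B := (fun t : Fin (k + 1) → ℝ => s + ∑ i, t i • (Fin.cons w b : Fin (k + 1) → Vd d) i) ⁻¹' 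
    (π ⁻¹' A ∩ {x | x ∈ P ∧ x - w ∉ P}) with hB
  have hBm : MeasurableSet B := hT.measurable ((hπm hA).inter hP')
  rw [← (hvp.symm).measure_preimage_equiv B]
  rw [show (volume : Measure (ℝ × (Fin k → ℝ))) = (volume : Measure ℝ).prod volume from rfl]
  rw [Measure.prod_apply_symm ((MeasurableEquiv.measurable _) hBm)]
  rw [← lintegral_indicator_one (hT''.measurable hAP)]
  congr 1
  ext u
  have hTe : ∀ r : ℝ, s + ∑ i, ((MeasurableEquiv.piFinSuccAbove (fun _ : Fin (k + 1) => ℝ) 0).symm (r, u)) i • 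
      (Fin.cons w b : Fin (k + 1) → Vd d) i = (s + ∑ i, u i • b i) + r • w := by
    intro r
    rw [Fin.sum_univ_succ]
    simp [MeasurableEquiv.piFinSuccAbove]
    abel
  have hset : (fun r : ℝ => (r, u)) ⁻¹' ((MeasurableEquiv.piFinSuccAbove (fun _ : Fin (k + 1) => ℝ) 0).symm ⁻¹' B)
      = {r : ℝ | π (s + ∑ i, u i • b i) ∈ A ∧ (s + ∑ i, u i • b i) + r • w ∈ {x | x ∈ P ∧ x - w ∉ P}} := by
    ext r
    show (π _ ∈ A ∧ _ ∈ _) ↔ _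
    beta_reduce
    rw [hTe]
    simp [hπw]
  rw [hset]
  have hu : π s + ∑ i, u i • (π ∘ b) i = π (s + ∑ i, u i • b i) := by simp
  by_cases h : u ∈ (fun t : Fin k → ℝ => π s + ∑ i, t i • (π ∘ b) i) ⁻¹' (A ∩ π '' P)
  · rw [indicator_of_mem h, Pi.one_apply]
    have h' : π (s + ∑ i, u i • b i) ∈ A ∩ π '' P := by rw [← hu]; exact h
    obtain ⟨τ, hτ⟩ := fiber_lemma' hcl hw hP hl _ ((mem_image_iff_fiber hπ hπw _).1 h'.2)
    have : {r : ℝ | π (s + ∑ i, u i • b i) ∈ A ∧ (s + ∑ i, u i • b i) + r • w ∈ {x | x ∈ P ∧ x - w ∉ P}} = 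
        Ico τ (τ + 1) := by
      ext r
      show _ ∧ _ ↔ _
      rw [hτ]; exact and_iff_right h'.1
    rw [this, Real.volume_Ico]; simp
  · rw [indicator_of_notMem h]
    convert measure_empty (μ := (volume : Measure ℝ))
    ext r
    simp only [mem_empty_iff_false, iff_false]
    rintro ⟨h1, h2⟩
    apply h
    show π s + ∑ i, u i • (π ∘ b) i ∈ A ∩ π '' P
    rw [hu]
    exact ⟨h1, (mem_image_iff_fiber hπ hπw _).2 ⟨r, h2.1⟩⟩

lemma exists_canon_push [DiscreteTopology Λ] {s : Vd d} {v : Fin n → Vd d} (hv : ∀ i, v i ∈ Λ)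
    {J : Finset (Fin n)} {i : Fin n} (hi : i ∈ J) (hw : v i ≠ 0) (hl : ¬ ContainsLine (cn s v J))
    {π : Vd d →ₗ[ℝ] Vd d} (hπ : ∀ x, x - π x ∈ Submodule.span ℝ {v i}) (hπw : π (v i) = 0)
    (hprim : ∀ q : ℝ, q • v i ∈ Λ → ∃ k : ℤ, q = k) 
    [DiscreteTopology (AddSubgroup.map π.toAddMonoidHom Λ)] :
    ∃ m m'', IsCanonicalMeasure Λ (affineSpan ℝ (cn s v J) : Set (Vd d)) m ∧
      IsCanonicalMeasure (AddSubgroup.map π.toAddMonoidHom Λ) 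
        (affineSpan ℝ (cn (π s) (π ∘ v) J) : Set (Vd d)) m'' ∧
      Measure.map π (m.restrict {x | x ∈ cn s v J ∧ x - v i ∉ cn s v J}) = 
      m''.restrict (π '' cn s v J) := by
  obtain ⟨k, c, hc, hcΛ, hcL, hcc⟩ := exists_lat_basis (Λ := AddSubgroup.map π.toAddMonoidHom Λ) 
    (T := (π ∘ v) '' (J : Set (Fin n)))
    (by rintro _ ⟨i, _, rfl⟩; exact ⟨v i, hv i, rfl⟩) rfl
  choose b hbΛ hbc using hcΛ
  have hbc' : π ∘ b = c := funext hbc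
  subst hbc'
  have hspan : Submodule.span ℝ ((π ∘ v) '' (J : Set (Fin n))) = 
      (Submodule.span ℝ (v '' (J : Set (Fin n)))).map π := by
    rw [Submodule.map_span, image_comp]
  have hviL : v i ∈ Submodule.span ℝ (v '' (J : Set (Fin n))) := Submodule.subset_span ⟨i, hi, rfl⟩
  have hlift : ∀ y, π y ∈ Submodule.span ℝ ((π ∘ v) '' (J : Set (Fin n))) → 
      y ∈ Submodule.span ℝ (v '' (J : Set (Fin n))) := by
    intro y hy
    rw [hspan] at hy
    obtain ⟨z, hz, hzy⟩ := hy
    obtain ⟨r, rfl⟩ := eq_add_of_proj hπ hzy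
    exact Submodule.add_mem _ hz (Submodule.smul_mem _ _ hviL)
  have hLI : LinearIndependent ℝ (Fin.cons (v i) b : Fin (k + 1) → Vd d) := by
    rw [Fintype.linearIndependent_iff]
    intro g hg
    rw [Fin.sum_univ_succ] at hg
    simp only [Fin.cons_zero, Fin.cons_succ] at hg
    have h1 := congrArg π hg
    simp only [map_add, map_smul, hπw, smul_zero, zero_add, map_sum, map_zero] at h1
    have h2 := Fintype.linearIndependent_iff.1 hc (fun j => g j.succ) h1
    simp only [h2, zero_smul, Finset.sum_const_zero, add_zero] at hg
    have h3 := (smul_eq_zero.1 hg).resolve_right hw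
    intro j
    refine Fin.cases h3 h2 j
  have hsp : Submodule.span ℝ (range (Fin.cons (v i) b : Fin (k + 1) → Vd d)) = 
      Submodule.span ℝ (v '' (J : Set (Fin n))) := by
    refine le_antisymm (Submodule.span_le.2 ?_) ?_
    · rintro _ ⟨j, rfl⟩
      refine Fin.cases hviL (fun j => hlift _ ?_) j
      rw [← hcL]; exact Submodule.subset_span ⟨j, by simp⟩
    · intro y hy
      have h1 : π y ∈ Submodule.span ℝ (range (π ∘ b)) := by
        rw [hcL, hspan]; exact ⟨y, hy, rfl⟩
      obtain ⟨u, hu⟩ := (Submodule.mem_span_range_iff_exists_fun ℝ).1 h1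
      obtain ⟨r, rfl⟩ := eq_add_of_proj hπ (x := ∑ i, u i • b i) (y := y) (by rw [← hu]; simp)
      refine Submodule.add_mem _ (Submodule.sum_mem _ fun j _ => Submodule.smul_mem _ _ 
        (Submodule.subset_span ⟨j.succ, by simp⟩)) (Submodule.smul_mem _ _ (Submodule.subset_span ⟨0, by simp⟩))
  refine ⟨_, _, canon_of_basis s v J hLI ?_ hsp ?_, canon_of_basis (π s) (π ∘ v) J hc ?_ hcL ?_, 
    leb_push (cn_closed v hv J s) hw (fun x hx r hr => cn_add_smul hx hi hr) hl hπ hπw ?_ s hLI hc⟩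
  · intro j; refine Fin.cases (hv i) hbΛ j
  · intro y hy hyL
    rw [hsp] at hyL
    have h1 : π y ∈ Submodule.span ℝ ((π ∘ v) '' (J : Set (Fin n))) := by
      rw [hspan]; exact ⟨y, hyL, rfl⟩
    obtain ⟨c, hcy⟩ := hcc (π y) ⟨y, hy, rfl⟩ h1
    obtain ⟨r, hr⟩ := eq_add_of_proj hπ (x := ∑ i, (c i : ℝ) • b i) (y := y) (by rw [hcy]; simp)
    have h2 : ∑ i, (c i : ℝ) • b i ∈ Λ := Λ.sum_mem fun j _ => by
      rw [Int.cast_smul_eq_zsmul]; exact Λ.zsmul_mem (hbΛ j) _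
    obtain ⟨q, rfl⟩ := hprim r (by
      have := Λ.sub_mem hy h2
      rwa [hr, add_sub_cancel_left] at this)
    refine ⟨Fin.cons q c, ?_⟩
    rw [Fin.sum_univ_succ, hr, add_comm]
    simp
  · intro j; exact ⟨b j, hbΛ j, rfl⟩
  · intro y hy hyL; exact hcc y hy (hcL ▸ hyL)
  · rw [map_cn]
    exact cn_closed (Λ := AddSubgroup.map π.toAddMonoidHom Λ) _ (fun j => ⟨v j, hv j, rfl⟩) _ _

end meas4


section interf
variable {d n : ℕ} {Λ : AddSubgroup (Vd d)}

/-- the open dual region of a family of vectors -/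
def negReg (v : Fin n → Vd d) (J : Finset (Fin n)) : Set (Vd d) := {ξ | ∀ i ∈ J, pairE ξ (v i) < 0}

lemma negReg_open (v : Fin n → Vd d) (J : Finset (Fin n)) : IsOpen (negReg v J) := by
  have : negReg v J = ⋂ i ∈ J, {ξ | pairE ξ (v i) < 0} := by ext; simp [negReg]
  rw [this]
  exact isOpen_biInter_finset fun i _ => isOpen_lt (continuous_pairE_left _) continuous_const

lemma entire_eq {f g : Vd d → ℝ} (hf : ∀ ξ, AnalyticAt ℝ f ξ) (hg : ∀ ξ, AnalyticAt ℝ g ξ)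
    {U : Set (Vd d)} (hU : IsOpen U) (hne : U.Nonempty) (h : ∀ ξ ∈ U, f ξ = g ξ) : f = g := by
  obtain ⟨x, hx⟩ := hne
  refine AnalyticOnNhd.eq_of_eventuallyEq (fun z _ => hf z) (fun z _ => hg z) (z₀ := x) ?_
  filter_upwards [hU.mem_nhds hx] with y hy using h y hy

lemma ratPoint_map {s : Vd d} (hs : IsRatPoint Λ s) (π : Vd d →ₗ[ℝ] Vd d) :
    IsRatPoint (AddSubgroup.map π.toAddMonoidHom Λ) (π s) := by
  obtain ⟨q, hq, h⟩ := hs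
  exact ⟨q, hq, ⟨_, h, by simp⟩⟩

lemma pairE_proj {w : Vd d} {π : Vd d →ₗ[ℝ] Vd d} (hπ : ∀ x, x - π x ∈ Submodule.span ℝ {w}) 
    {ξ : Vd d} (h : pairE ξ w = 0) (x : Vd d) : pairE ξ (π x) = pairE ξ x := by
  obtain ⟨r, hr⟩ := Submodule.mem_span_singleton.1 (hπ x)
  have : x = π x + r • w := by rw [hr]; abel
  nth_rewrite 2 [this]
  rw [pairE_add_right, pairE_smul_right, h]; simp

lemma cn_erase_zero (s : Vd d) (v : Fin n → Vd d) (J : Finset (Fin n)) {i : Fin n} (h : v i = 0) :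
    cn s v J = cn s v (J.erase i) := by
  ext x
  constructor
  · rintro ⟨t, ht, rfl⟩
    refine ⟨t, ht, ?_⟩
    rw [Finset.sum_erase]; simp [h]
  · rintro ⟨t, ht, rfl⟩
    refine ⟨t, ht, ?_⟩
    rw [Finset.sum_erase]; simp [h]

/-- interface for the integral functions -/
lemma I_interface [DiscreteTopology Λ] {I0 : Set (Vd d) → Vd d → ℝ} (hI : IsIMap Λ I0)
    {s : Vd d} (hs : IsRatPoint Λ s) (v : Fin n → Vd d) (hv : ∀ i, v i ∈ Λ) (J : Finset (Fin n))
    (hη : (negReg v J).Nonempty) (hl : ¬ ContainsLine (cn s v J)) :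
    ∃ E : Vd d → ℝ, (∀ ξ, AnalyticAt ℝ E ξ) ∧
      (∀ ξ ∈ negReg v J, E ξ = Dn v J ξ * I0 (cn s v J) ξ) ∧
      ∀ i ∈ J, ∀ π : Vd d →ₗ[ℝ] Vd d, (∀ x, x - π x ∈ Submodule.span ℝ {v i}) → π (v i) = 0 →
        (∀ q : ℝ, q • v i ∈ Λ → ∃ k : ℤ, q = k) →
        DiscreteTopology (AddSubgroup.map π.toAddMonoidHom Λ) →
        ∀ I1, IsIMap (AddSubgroup.map π.toAddMonoidHom Λ) I1 →
        ∀ ξ ∈ negReg v (J.erase i), pairE ξ (v i) = 0 →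
        E ξ = Dn v (J.erase i) ξ * I1 (cn (π s) (π ∘ v) J) ξ := by
  obtain ⟨m, hm⟩ := exists_canon (Λ := Λ) s v hv J
  have hP := cn_ratPolyhedron v hv J hs
  have key : ∀ m, IsCanonicalMeasure Λ (affineSpan ℝ (cn s v J) : Set (Vd d)) m →
      ∀ ξ ∈ negReg v J, Ef s v J m ξ = Dn v J ξ * I0 (cn s v J) ξ := by
    intro m hm ξ hξ
    obtain ⟨h1, h2⟩ := canon_cn_props hm
    rw [Ef_eq s v hv J m h2 hξ, hI.2.2 _ hP m hm ξ (exp_integrableOn_cn J h2 hξ s)]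
  have hEan : ∀ m, IsCanonicalMeasure Λ (affineSpan ℝ (cn s v J) : Set (Vd d)) m → ∀ ξ, 
      AnalyticAt ℝ (Ef s v J m) ξ := fun m hm ξ => by
    have := (canon_cn_props hm).1
    exact Ef_analytic s v hv J m ξ
  refine ⟨Ef s v J m, hEan m hm, key m hm, ?_⟩
  intro i hi π hπ hπw hprim hd I1 hI1 ξ hξ hξi
  have hw : v i ≠ 0 := by
    obtain ⟨η, h⟩ := hη
    intro h0
    have := h i hi
    rw [h0, pairE_zero_right] at this
    exact lt_irrefl _ this
  obtain ⟨m1, m2, hm1, hm2, hpush⟩ := exists_canon_push hv hi hw hl hπ hπw hprim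
  have : Ef s v J m = Ef s v J m1 := entire_eq (hEan m hm) (hEan m1 hm1) (negReg_open v J) hη 
    fun ξ hξ => by rw [key m hm ξ hξ, key m1 hm1 ξ hξ]
  rw [this]
  have hc2 := canon_cn_props hm2
  have hc2' := hc2.1
  have hintg : IntegrableOn (fun x => Real.exp (pairE ξ x)) (cn (π s) (π ∘ v) J) m2 := by
    rw [cn_erase_zero (π s) (π ∘ v) J (i := i) hπw]
    refine exp_integrableOn_cn _ (fun j hj => hc2.2 j (Finset.mem_of_mem_erase hj)) ?_ _
    intro j hj
    show pairE ξ (π (v j)) < 0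
    rw [pairE_proj hπ hξi]; exact hξ j hj
  have hc1 := canon_cn_props hm1
  have hc1' := hc1.1
  rw [Ef_hyper s v hv J m1 m2 hc1.2 hi hπ hpush hξi (by rw [map_cn]; exact hintg), map_cn,
    hI1.2.2 _ (cn_ratPolyhedron (π ∘ v) (fun j => (⟨v j, hv j, rfl⟩ : (π ∘ v) j ∈ AddSubgroup.map π.toAddMonoidHom Λ)) J (ratPoint_map hs π)) m2 hm2 ξ hintg]

lemma S_eq_integral [DiscreteTopology Λ] {S0 : Set (Vd d) → Vd d → ℝ} (hS : IsSMap Λ S0)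
    {P : Set (Vd d)} (hP : IsRatPolyhedron Λ P) (hcl : IsClosed P) (ξ : Vd d)
    (hintg : IntegrableOn (fun x => Real.exp (pairE ξ x)) P (Measure.count.restrict (Λ : Set (Vd d)))) :
    S0 P ξ = ∫ x in P, Real.exp (pairE ξ x) ∂(Measure.count.restrict (Λ : Set (Vd d))) := by
  have hΛm : MeasurableSet (Λ : Set (Vd d)) := (AddSubgroup.isClosed_of_discrete (H := Λ)).measurableSet
  have hc : (Λ : Set (Vd d)).Countable := by
    have : Countable Λ := TopologicalSpace.separableSpace_iff_countable.1 inferInstance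
    exact this
  have hms : MeasurableSet (P ∩ Λ) := hcl.measurableSet.inter hΛm
  rw [IntegrableOn, Measure.restrict_restrict hcl.measurableSet] at hintg
  rw [Measure.restrict_restrict hcl.measurableSet, hS.2.2 P hP ξ,
    setIntegral_countable _ (hc.mono inter_subset_right) hintg]
  · refine tsum_congr fun x => ?_
    simp [Measure.real]
  · have h1 := (integrable_indicator_iff hms).2 hintg
    rw [integrable_count_iff] at h1
    have := summable_subtype_iff_indicator (s := P ∩ (Λ : Set (Vd d))) (f := fun x => Real.exp (pairE ξ x))
    refine this.2 ?_
    exact h1.of_norm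

/-- interface for the sum functions -/
lemma S_interface [DiscreteTopology Λ] {I0 : Set (Vd d) → Vd d → ℝ} (hI : IsSMap Λ I0)
    {s : Vd d} (hs : IsRatPoint Λ s) (v : Fin n → Vd d) (hv : ∀ i, v i ∈ Λ) (J : Finset (Fin n))
    (hη : (negReg v J).Nonempty) (hl : ¬ ContainsLine (cn s v J)) :
    ∃ E : Vd d → ℝ, (∀ ξ, AnalyticAt ℝ E ξ) ∧
      (∀ ξ ∈ negReg v J, E ξ = Dn v J ξ * I0 (cn s v J) ξ) ∧
      ∀ i ∈ J, ∀ π : Vd d →ₗ[ℝ] Vd d, (∀ x, x - π x ∈ Submodule.span ℝ {v i}) → π (v i) = 0 →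
        (∀ q : ℝ, q • v i ∈ Λ → ∃ k : ℤ, q = k) →
        DiscreteTopology (AddSubgroup.map π.toAddMonoidHom Λ) →
        ∀ I1, IsSMap (AddSubgroup.map π.toAddMonoidHom Λ) I1 →
        ∀ ξ ∈ negReg v (J.erase i), pairE ξ (v i) = 0 →
        E ξ = Dn v (J.erase i) ξ * I1 (cn (π s) (π ∘ v) J) ξ := by
  have hP := cn_ratPolyhedron v hv J hs
  have hc := count_props Λ
  have hc' := hc.1
  refine ⟨Ef s v J (Measure.count.restrict (Λ : Set (Vd d))), Ef_analytic s v hv J _, ?_, ?_⟩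
  · intro ξ hξ
    have h2 : ∀ i ∈ J, _ := fun i (hi : i ∈ J) => hc.2 (v i) (hv i)
    rw [Ef_eq s v hv J _ h2 hξ, S_eq_integral hI hP (cn_closed v hv J s) ξ 
      (exp_integrableOn_cn J h2 hξ s)]
  intro i hi π hπ hπw hprim hd I1 hI1 ξ hξ hξi
  have hw : v i ≠ 0 := by
    obtain ⟨η, h⟩ := hη
    intro h0
    have := h i hi
    rw [h0, pairE_zero_right] at this
    exact lt_irrefl _ this
  have hc2 := count_props (AddSubgroup.map π.toAddMonoidHom Λ)
  have hc2' := hc2.1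
  have hv2 : ∀ j, (π ∘ v) j ∈ AddSubgroup.map π.toAddMonoidHom Λ := fun j => ⟨v j, hv j, rfl⟩
  have hintg : IntegrableOn (fun x => Real.exp (pairE ξ x)) (cn (π s) (π ∘ v) J) 
      (Measure.count.restrict (AddSubgroup.map π.toAddMonoidHom Λ : Set (Vd d))) := by
    rw [cn_erase_zero (π s) (π ∘ v) J (i := i) hπw]
    refine exp_integrableOn_cn _ (fun j hj => hc2.2 _ (hv2 j)) ?_ _
    intro j hj
    show pairE ξ (π (v j)) < 0
    rw [pairE_proj hπ hξi]; exact hξ j hj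
  have hpush := count_push (Λ := Λ) (cn_closed v hv J s) hw (fun x hx r hr => cn_add_smul hx hi hr) hl 
    hπ hπw (hv i) hprim
  rw [Ef_hyper s v hv J _ _ (fun i _ => hc.2 _ (hv i)) hi hπ hpush hξi (by rw [map_cn]; exact hintg), map_cn,
    S_eq_integral hI1 (cn_ratPolyhedron _ hv2 J (ratPoint_map hs π)) 
      (cn_closed _ hv2 J _) ξ hintg]

lemma I_vertex [DiscreteTopology Λ] {I0 : Set (Vd d) → Vd d → ℝ} (hI : IsIMap Λ I0)
    {s : Vd d} (hs : IsRatPoint Λ s) (ξ : Vd d) : I0 {s} ξ = Real.exp (pairE ξ s) := by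
  have hcn : cn s (fun _ : Fin 0 => (0 : Vd d)) ∅ = {s} := by
    ext x; simp [cn]
  have hP := cn_ratPolyhedron (Λ := Λ) (fun _ : Fin 0 => (0 : Vd d)) (fun i => i.elim0) ∅ hs
  have hcan := canon_of_basis (Λ := Λ) s (fun _ : Fin 0 => (0 : Vd d)) ∅ (k := 0) (b := fun i => 0)
    linearIndependent_empty_type (fun i => i.elim0) (by simp) (fun y hy h => ⟨fun i => i.elim0, by 
      simpa using h⟩)
  rw [hcn] at hP hcan
  have hm : Measure.map (fun t : Fin 0 → ℝ => s + ∑ i, t i • (0 : Vd d)) volume = Measure.dirac s := by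
    have : (volume : Measure (Fin 0 → ℝ)) = Measure.dirac 0 := by
      exact volume_pi.trans (Measure.pi_of_empty _ _)
    have h2 : (fun t : Fin 0 → ℝ => s + ∑ i, t i • (0 : Vd d)) = fun _ => s := by ext1 t; simp
    rw [h2, this, Measure.map_const]; simp
  rw [hm] at hcan
  rw [hI.2.2 _ hP _ hcan ξ ?_]
  · simp
  · rw [IntegrableOn, Measure.restrict_singleton]
    simp
    exact integrable_dirac (by simp)

end interf


section genf
variable {d n : ℕ}

/-- the filter of properties valid near `0` off a closed nowhere dense set -/
def genF (d : ℕ) : Filter (Vd d) where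
  sets := {s | ∃ Z : Set (Vd d), IsClosed Z ∧ interior Z = ∅ ∧ ∀ᶠ ξ in 𝓝 (0 : Vd d), ξ ∉ Z → ξ ∈ s}
  univ_sets := ⟨∅, isClosed_empty, interior_empty, by simp⟩
  sets_of_superset := by
    rintro s t ⟨Z, h1, h2, h3⟩ hst
    exact ⟨Z, h1, h2, h3.mono fun ξ h hz => hst (h hz)⟩
  inter_sets := by
    rintro s t ⟨Z, h1, h2, h3⟩ ⟨Z', h1', h2', h3'⟩
    refine ⟨Z ∪ Z', h1.union h1', ?_, ?_⟩
    · rw [interior_union_isClosed_of_interior_empty h1 h2', h2]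
    · filter_upwards [h3, h3'] with ξ h h' hz
      exact ⟨h fun hh => hz (Or.inl hh), h' fun hh => hz (Or.inr hh)⟩

lemma genF_le : genF d ≤ 𝓝 0 := by
  intro s hs
  exact ⟨∅, isClosed_empty, interior_empty, by filter_upwards [hs] with ξ h _ using h⟩

lemma genF_iff {f g : Vd d → ℝ} : MeroEqAt0 f g ↔ ∀ᶠ ξ in genF d, f ξ = g ξ := Iff.rfl

/-- analytic functions on a ball -/
lemma exists_ball_an {f : Vd d → ℝ} (hf : AnalyticAt ℝ f 0) : 
    ∃ r > 0, AnalyticOnNhd ℝ f (Metric.ball 0 r) := by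
  obtain ⟨r, hr, h⟩ := Metric.eventually_nhds_iff_ball.1 hf.eventually_analyticAt
  exact ⟨r, hr, fun x hx => h x hx⟩

lemma genF_ne {h : Vd d → ℝ} (hh : AnalyticAt ℝ h 0) (hne : ¬ ∀ᶠ ξ in 𝓝 (0 : Vd d), h ξ = 0) :
    ∀ᶠ ξ in genF d, h ξ ≠ 0 := by
  obtain ⟨r, hr, ha⟩ := exists_ball_an hh
  have hsub : Metric.closedBall (0 : Vd d) (r / 2) ⊆ Metric.ball 0 r := 
    Metric.closedBall_subset_ball (by linarith)
  refine ⟨Metric.closedBall 0 (r / 2) ∩ h ⁻¹' {0}, ?_, ?_, ?_⟩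
  · exact (ha.continuousOn.mono hsub).preimage_isClosed_of_isClosed Metric.isClosed_closedBall 
      isClosed_singleton
  · by_contra hcon
    obtain ⟨x, hx⟩ := nonempty_iff_ne_empty.2 hcon
    apply hne
    have h0 := ha.eqOn_zero_of_preconnected_of_eventuallyEq_zero (convex_ball _ _).isPreconnected
      (hsub (interior_subset hx).1) (by
        filter_upwards [isOpen_interior.mem_nhds hx] with y hy using (interior_subset hy).2)
    filter_upwards [Metric.ball_mem_nhds _ hr] with y hy using h0 hy
  · filter_upwards [Metric.ball_mem_nhds (0 : Vd d) (half_pos hr)] with ξ hξ h1 h2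
    exact h1 ⟨Metric.ball_subset_closedBall hξ, h2⟩

lemma genF_cont {U : Set (Vd d)} (hU : IsOpen U) {f g : Vd d → ℝ}
    (hc : ∀ᶠ ξ in 𝓝 (0 : Vd d), ξ ∈ U → ContinuousAt f ξ ∧ ContinuousAt g ξ)
    (h : ∀ᶠ ξ in genF d, ξ ∈ U → f ξ = g ξ) : ∀ᶠ ξ in 𝓝 (0 : Vd d), ξ ∈ U → f ξ = g ξ := by
  obtain ⟨Z, hZ, hZi, hZ2⟩ := h
  filter_upwards [hc, hZ2.eventually_nhds] with ξ h1 h2 hξ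
  obtain ⟨c1, c2⟩ := h1 hξ
  have hne : (𝓝[Zᶜ] ξ).NeBot := by
    rw [← mem_closure_iff_nhdsWithin_neBot, closure_compl, hZi]; simp
  refine tendsto_nhds_unique_of_eventuallyEq (c1.tendsto.mono_left (nhdsWithin_le_nhds (s := Zᶜ)))
    (c2.tendsto.mono_left nhdsWithin_le_nhds) ?_
  filter_upwards [nhdsWithin_le_nhds h2, nhdsWithin_le_nhds (hU.mem_nhds hξ), self_mem_nhdsWithin] 
    with x hx hxU hxZ
  exact hx hxZ hxU

lemma genF_an {f g : Vd d → ℝ} (hf : AnalyticAt ℝ f 0) (hg : AnalyticAt ℝ g 0) 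
    (h : ∀ᶠ ξ in genF d, f ξ = g ξ) : ∀ᶠ ξ in 𝓝 (0 : Vd d), f ξ = g ξ := by
  have := genF_cont isOpen_univ (f := f) (g := g) ?_ (h.mono fun _ h _ => h)
  · exact this.mono fun ξ h => h trivial
  · filter_upwards [hf.eventually_analyticAt, hg.eventually_analyticAt] with ξ h1 h2 _
    exact ⟨h1.continuousAt, h2.continuousAt⟩

lemma cone_zero {f : Vd d → ℝ} (hf : AnalyticAt ℝ f 0) {C : Set (Vd d)} (hC : IsOpen C) (hne : C.Nonempty)
    (hcone : ∀ ξ ∈ C, ∀ r : ℝ, 0 < r → r • ξ ∈ C) (h : ∀ᶠ ξ in 𝓝 (0 : Vd d), ξ ∈ C → f ξ = 0) :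
    ∀ᶠ ξ in 𝓝 (0 : Vd d), f ξ = 0 := by
  obtain ⟨r, hr, ha⟩ := exists_ball_an hf
  obtain ⟨c, hc⟩ := hne
  have ht : Tendsto (fun t : ℝ => t • c) (𝓝[>] 0) (𝓝 0) := by
    have : Tendsto (fun t : ℝ => t • c) (𝓝 0) (𝓝 ((0 : ℝ) • c)) := 
      (continuous_id.smul continuous_const).tendsto _
    rw [zero_smul] at this
    exact this.mono_left nhdsWithin_le_nhds
  obtain ⟨t, ⟨h1, h2⟩, h3⟩ := ((ht.eventually (h.eventually_nhds.and (Metric.ball_mem_nhds _ hr))).and 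
    self_mem_nhdsWithin).exists
  have h0 := ha.eqOn_zero_of_preconnected_of_eventuallyEq_zero (convex_ball _ _).isPreconnected
      h2 (by
        filter_upwards [h1, hC.mem_nhds (hcone c hc t h3)] with y hy hyC using hy hyC)
  filter_upwards [Metric.ball_mem_nhds _ hr] with y hy using h0 hy

lemma mero_cone {Λ : AddSubgroup (Vd d)} {f E D : Vd d → ℝ} (hf : RatMeromorphicAt0 Λ f) 
    (hE : AnalyticAt ℝ E 0) (hD : AnalyticAt ℝ D 0) {C : Set (Vd d)} (hC : IsOpen C) (hne : C.Nonempty)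
    (hcone : ∀ ξ ∈ C, ∀ r : ℝ, 0 < r → r • ξ ∈ C) (h : ∀ ξ ∈ C, E ξ = D ξ * f ξ) :
    ∀ᶠ ξ in genF d, E ξ = D ξ * f ξ := by
  obtain ⟨g, h', ⟨p, hg, -⟩, ⟨p', hh, -⟩, hnz, heq⟩ := hf
  have hg := hg.analyticAt
  have hh := hh.analyticAt
  have key := cone_zero (f := fun ξ => (E ξ * h' ξ - D ξ * g ξ) * h' ξ) 
    (((hE.mul hh).sub (hD.mul hg)).mul hh) hC hne hcone (by
      filter_upwards [heq] with ξ h1 hξ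
      by_cases h0 : h' ξ = 0
      · simp [h0]
      · rw [h ξ hξ, ← h1 h0]; ring)
  filter_upwards [genF_le key, genF_ne hh hnz, genF_le heq] with ξ h1 h2 h3
  have h4 := (mul_eq_zero.1 h1).resolve_right h2
  rw [← h3 h2] at h4
  have : (E ξ - D ξ * f ξ) * h' ξ = 0 := by linarith
  have := (mul_eq_zero.1 this).resolve_right h2
  linarith

lemma pairE_analytic (w ξ : Vd d) : AnalyticAt ℝ (fun ξ => pairE ξ w) ξ := by
  have : (fun ξ => pairE ξ w) = fun ξ => (innerSL ℝ w) ξ := by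
    ext ξ; simp [pairE, real_inner_comm]
  rw [this]
  exact (innerSL ℝ w).analyticAt ξ

lemma pairE_an' (w ξ : Vd d) : AnalyticAt ℝ (fun ξ => pairE w ξ) ξ := (innerSL ℝ w).analyticAt ξ

lemma Dn_analytic (v : Fin n → Vd d) (J : Finset (Fin n)) (ξ : Vd d) : AnalyticAt ℝ (Dn v J) ξ := by
  have : Dn v J = fun ξ => ∏ i ∈ J, (1 - Real.exp (pairE ξ (v i))) := rfl
  rw [this]
  exact Finset.analyticAt_fun_prod J fun i _ => analyticAt_const.sub (pairE_analytic (v i) ξ).rexp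

lemma Dn_ne {v : Fin n → Vd d} {J : Finset (Fin n)} {ξ : Vd d} (h : ξ ∈ negReg v J) : Dn v J ξ ≠ 0 := by
  refine Finset.prod_ne_zero_iff.2 fun i hi => ?_
  have := h i hi
  have h2 : Real.exp (pairE ξ (v i)) < 1 := by rwa [Real.exp_lt_one_iff]
  linarith

lemma negReg_cone (v : Fin n → Vd d) (J : Finset (Fin n)) : 
    ∀ ξ ∈ negReg v J, ∀ r : ℝ, 0 < r → r • ξ ∈ negReg v J := by
  intro ξ h r hr i hi
  rw [pairE_smul_left]
  exact mul_neg_of_pos_of_neg hr (h i hi)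

lemma Dn_not_zero {v : Fin n → Vd d} {J : Finset (Fin n)} (hη : (negReg v J).Nonempty) : 
    ¬ ∀ᶠ ξ in 𝓝 (0 : Vd d), Dn v J ξ = 0 := by
  intro h
  obtain ⟨c, hc⟩ := hη
  have ht : Tendsto (fun t : ℝ => t • c) (𝓝[>] 0) (𝓝 0) := by
    have : Tendsto (fun t : ℝ => t • c) (𝓝 0) (𝓝 ((0 : ℝ) • c)) := 
      (continuous_id.smul continuous_const).tendsto _
    rw [zero_smul] at this
    exact this.mono_left nhdsWithin_le_nhds
  obtain ⟨t, h1, h2⟩ := ((ht.eventually h).and self_mem_nhdsWithin).exists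
  exact Dn_ne (negReg_cone v J c hc t h2) h1

end genf


section divis
variable {d n : ℕ}

/-- the quotient series -/
noncomputable def qser (p : FormalMultilinearSeries ℝ (Vd d) ℝ) (P : Vd d →L[ℝ] Vd d) (u : Vd d) :
    FormalMultilinearSeries ℝ (Vd d) ℝ := fun n =>
  ∑ k : Fin (n + 1), ContinuousMultilinearMap.curryMid k ((p (n + 1)).compContinuousLinearMap 
    (fun i => if i < k then P else ContinuousLinearMap.id ℝ (Vd d))) u

lemma qser_apply (p : FormalMultilinearSeries ℝ (Vd d) ℝ) (P : Vd d →L[ℝ] Vd d) (u : Vd d) (x : Vd d) (r : ℝ)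
    (h : x - P x = r • u) (n : ℕ) :
    r * qser p P u n (fun _ => x) = p (n + 1) (fun _ => x) - p (n + 1) (fun _ => P x) := by
  classical
  let a : ℕ → ℝ := fun m => p (n + 1) (fun i => if i.val < m then P x else x)
  have h1 : qser p P u n (fun _ => x) = ∑ k : Fin (n + 1), p (n + 1) (fun i => (if i < k then P else 
    ContinuousLinearMap.id ℝ (Vd d)) ((k.insertNth u (fun _ => x) : Fin (n + 1) → Vd d) i)) := by
    simp [qser]
  have h2 : ∀ k : Fin (n + 1), r * p (n + 1) (fun i => (if i < k then P else 
    ContinuousLinearMap.id ℝ (Vd d)) ((k.insertNth u (fun _ => x) : Fin (n + 1) → Vd d) i)) = 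
      a k - a (k + 1) := by
    intro k
    have e1 : (fun i => (if i < k then P else 
      ContinuousLinearMap.id ℝ (Vd d)) ((k.insertNth u (fun _ => x) : Fin (n + 1) → Vd d) i)) = 
      Function.update (fun i : Fin (n + 1) => if i.val < k.val then P x else x) k u := by
      ext1 i
      rcases eq_or_ne i k with rfl | hik
      · simp
      · rw [Function.update_of_ne hik]
        obtain ⟨j, rfl⟩ := Fin.exists_succAbove_eq hik
        rw [Fin.insertNth_apply_succAbove]
        by_cases hlt : k.succAbove j < k
        · have : (k.succAbove j).val < k.val := hlt
          rw [if_pos hlt, if_pos this]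
        · have : ¬ (k.succAbove j).val < k.val := hlt
          rw [if_neg hlt, if_neg this]; rfl
    rw [e1, ← smul_eq_mul, ← ContinuousMultilinearMap.map_update_smul, ← h,
      ContinuousMultilinearMap.map_update_sub]
    congr 2
    · ext1 i
      rcases eq_or_ne i k with rfl | hik
      · simp
      · rw [Function.update_of_ne hik]
    · ext1 i
      rcases eq_or_ne i k with rfl | hik
      · simp
      · rw [Function.update_of_ne hik]
        have : i.val ≠ k.val := fun h => hik (Fin.ext h)
        by_cases hlt : i.val < k.val
        · rw [if_pos hlt, if_pos (by omega)]
        · rw [if_neg hlt, if_neg (by omega)]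
  rw [h1, Finset.mul_sum, Finset.sum_congr rfl fun k _ => h2 k, 
    Fin.sum_univ_eq_sum_range (fun k => a k - a (k + 1)), Finset.sum_range_sub']
  congr 1
  show p (n + 1) _ = _
  congr 1; ext1 i; rw [if_pos i.2]

lemma qser_radius (p : FormalMultilinearSeries ℝ (Vd d) ℝ) (hp : 0 < p.radius) (P : Vd d →L[ℝ] Vd d) (u : Vd d) :
    0 < (qser p P u).radius := by
  obtain ⟨r, hr0, hr⟩ := ENNReal.lt_iff_exists_nnreal_btwn.1 hp
  have hr0' : (0 : ℝ) < r := by exact_mod_cast hr0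
  obtain ⟨C, hC0, hC⟩ := p.norm_mul_pow_le_of_lt_radius hr
  set M : NNReal := max 1 ‖P‖₊ with hM
  have hM1 : (1 : ℝ) ≤ M := by exact_mod_cast le_max_left 1 ‖P‖₊
  have hMP : ‖P‖ ≤ M := by
    have : ‖P‖₊ ≤ M := le_max_right 1 ‖P‖₊
    exact_mod_cast this
  have hM0 : (0 : ℝ) < M := lt_of_lt_of_le one_pos hM1
  have hbd : ∀ n, ‖qser p P u n‖ ≤ (n + 1) * (‖p (n + 1)‖ * M ^ (n + 1) * ‖u‖) := by
    intro n
    refine (norm_sum_le _ _).trans ?_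
    have : ∀ k ∈ (Finset.univ : Finset (Fin (n + 1))), ‖ContinuousMultilinearMap.curryMid k ((p (n + 1)).compContinuousLinearMap 
      (fun i => if i < k then P else ContinuousLinearMap.id ℝ (Vd d))) u‖ ≤ ‖p (n + 1)‖ * M ^ (n + 1) * ‖u‖ := by
      intro k _
      refine (ContinuousLinearMap.le_opNorm _ _).trans ?_
      gcongr
      rw [ContinuousMultilinearMap.norm_curryMid]
      refine (ContinuousMultilinearMap.norm_compContinuousLinearMap_le _ _).trans ?_
      gcongr
      have : (M : ℝ) ^ (n + 1) = ∏ i : Fin (n + 1), (M : ℝ) := by simp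
      rw [this]
      refine Finset.prod_le_prod (fun _ _ => norm_nonneg _) fun i _ => ?_
      split_ifs
      · exact hMP
      · exact ContinuousLinearMap.norm_id_le.trans hM1
    refine (Finset.sum_le_card_nsmul _ _ _ this).trans ?_
    simp
  have h2M : (0 : ℝ) < 2 * M := by positivity
  refine lt_of_lt_of_le ?_ ((qser p P u).le_radius_of_bound (r := r / (2 * M)) (C * M * ‖u‖ / r) ?_)
  · have : (0 : NNReal) < r / (2 * M) := by
      have : (0 : ℝ) < ((r / (2 * M) : NNReal) : ℝ) := by push_cast; positivity
      exact_mod_cast this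
    exact_mod_cast this
  · intro n
    push_cast
    rw [div_pow, le_div_iff₀ hr0', mul_pow]
    have h2 : ((n : ℝ) + 1) ≤ 2 ^ n := by exact_mod_cast Nat.lt_two_pow_self (n := n)
    calc ‖qser p P u n‖ * ((r : ℝ) ^ n / (2 ^ n * M ^ n)) * r 
        ≤ ((n + 1) * (‖p (n + 1)‖ * M ^ (n + 1) * ‖u‖)) * ((r : ℝ) ^ n / (2 ^ n * M ^ n)) * r := by
          gcongr; exact hbd n
      _ = ((n + 1) / 2 ^ n) * (‖p (n + 1)‖ * (r : ℝ) ^ (n + 1)) * M * ‖u‖ := by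
          field_simp; ring
      _ ≤ 1 * C * M * ‖u‖ := by
          gcongr
          · rw [div_le_one (by positivity)]; exact h2
          · exact hC (n + 1)
      _ = C * M * ‖u‖ := by ring

/-- projection onto the hyperplane `w^⊥` -/
noncomputable def hproj (w : Vd d) : Vd d →L[ℝ] Vd d := 
  ContinuousLinearMap.id ℝ (Vd d) - (innerSL ℝ w).smulRight ((‖w‖ ^ 2)⁻¹ • w)

lemma hproj_apply (w x : Vd d) : hproj w x = x - pairE x w • ((‖w‖ ^ 2)⁻¹ • w) := by
  simp [hproj, pairE, real_inner_comm]

lemma hproj_pair {w : Vd d} (hw : w ≠ 0) (x : Vd d) : pairE (hproj w x) w = 0 := by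
  rw [hproj_apply, pairE_sub_left, pairE_smul_left, pairE_smul_left]
  have : pairE w w = ‖w‖ ^ 2 := real_inner_self_eq_norm_sq w
  rw [this]
  have : ‖w‖ ^ 2 ≠ 0 := by positivity
  field_simp; simp

lemma hproj_fix {w x : Vd d} (h : pairE x w = 0) : hproj w x = x := by
  rw [hproj_apply, h]; simp

lemma hproj_an {f : Vd d → ℝ} (hf : AnalyticAt ℝ f 0) (w : Vd d) : AnalyticAt ℝ (fun x => f (hproj w x)) 0 := by
  have h : AnalyticAt ℝ f (hproj w 0) := by rwa [map_zero]
  exact h.comp ((hproj w).analyticAt 0)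

lemma hproj_tendsto (w : Vd d) : Tendsto (hproj w) (𝓝 0) (𝓝 0) := by
  have := (hproj w).continuous.tendsto 0
  rwa [map_zero] at this

/-- division by a linear form -/
lemma div_linear {N : Vd d → ℝ} (hN : AnalyticAt ℝ N 0) {w : Vd d} (hw : w ≠ 0)
    (h : ∀ᶠ ξ in 𝓝 (0 : Vd d), pairE ξ w = 0 → N ξ = 0) :
    ∃ q : Vd d → ℝ, AnalyticAt ℝ q 0 ∧ ∀ᶠ ξ in 𝓝 (0 : Vd d), N ξ = pairE ξ w * q ξ := by
  obtain ⟨p, hp⟩ := hN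
  have hp' := hp
  obtain ⟨r, hr⟩ := hp
  have hq := (qser p (hproj w) ((‖w‖ ^ 2)⁻¹ • w)).hasFPowerSeriesOnBall 
    (qser_radius p (hr.r_pos.trans_le hr.r_le) _ _)
  refine ⟨_, hq.hasFPowerSeriesAt.analyticAt, ?_⟩
  have e1 := hp'.eventually_hasSum
  have e2 := (hproj_tendsto w).eventually hp'.eventually_hasSum
  have e3 := hq.hasFPowerSeriesAt.eventually_hasSum
  filter_upwards [e1, e2, e3, (hproj_tendsto w).eventually h] with x h1 h2 h3 h4
  have h4 := h4 (hproj_pair hw x)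
  simp only [zero_add] at h1 h2 h3
  rw [h4] at h2
  have h5 := h1.sub h2
  have h6 := h3.mul_left (pairE x w)
  rw [← hasSum_nat_add_iff' 1] at h5
  simp only [Finset.range_one, Finset.sum_singleton] at h5
  have e : (p 0 fun _ => x) = p 0 fun _ => hproj w x := by
    congr 1; ext1 i; exact i.elim0
  rw [e, sub_self, sub_zero, sub_zero] at h5
  have e7 : (fun i => pairE x w * (qser p (hproj w) ((‖w‖ ^ 2)⁻¹ • w) i) fun _ => x) = 
      fun n => ((p (n + 1)) fun _ => x) - (p (n + 1)) fun _ => (hproj w) x := by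
    ext1 m
    refine qser_apply p _ _ x _ ?_ m
    rw [hproj_apply]; abel
  rw [e7] at h6
  exact h5.unique h6

lemma div_prod {v : Fin n → Vd d} (hv0 : ∀ i, v i ≠ 0)
    (hsep : ∀ i j, i ≠ j → ∃ ξ, pairE ξ (v i) = 0 ∧ pairE ξ (v j) ≠ 0) (K : Finset (Fin n)) :
    ∀ N : Vd d → ℝ, AnalyticAt ℝ N 0 → 
    (∀ i ∈ K, ∀ᶠ ξ in 𝓝 (0 : Vd d), pairE ξ (v i) = 0 → N ξ = 0) →
    ∃ q : Vd d → ℝ, AnalyticAt ℝ q 0 ∧ ∀ᶠ ξ in 𝓝 (0 : Vd d), N ξ = (∏ i ∈ K, pairE ξ (v i)) * q ξ := by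
  classical
  induction K using Finset.induction_on with
  | empty => 
    intro N hN _
    exact ⟨N, hN, by simp⟩
  | insert j K hj ih =>
    intro N hN h
    obtain ⟨q, hq, hNq⟩ := div_linear hN (hv0 j) (h j (Finset.mem_insert_self _ _))
    have hv : ∀ i ∈ K, ∀ᶠ ξ in 𝓝 (0 : Vd d), pairE ξ (v i) = 0 → q ξ = 0 := by
      intro i hi
      have hij : i ≠ j := by rintro rfl; exact hj hi
      obtain ⟨c, hc1, hc2⟩ := hsep i j hij
      have han : AnalyticAt ℝ (fun ξ => pairE (hproj (v i) ξ) (v j)) 0 := 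
        hproj_an (pairE_analytic (v j) 0) (v i)
      have hne : ¬ ∀ᶠ ξ in 𝓝 (0 : Vd d), pairE (hproj (v i) ξ) (v j) = 0 := by
        intro hcon
        have ht : Tendsto (fun t : ℝ => t • c) (𝓝[>] 0) (𝓝 0) := by
          have : Tendsto (fun t : ℝ => t • c) (𝓝 0) (𝓝 ((0 : ℝ) • c)) := 
            (continuous_id.smul continuous_const).tendsto _
          rw [zero_smul] at this
          exact this.mono_left nhdsWithin_le_nhds
        obtain ⟨t, h1, h2⟩ := ((ht.eventually hcon).and self_mem_nhdsWithin).exists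
        rw [map_smul, hproj_fix hc1, pairE_smul_left] at h1
        exact (mul_ne_zero (ne_of_gt h2) hc2) h1
      have hz := genF_an (hproj_an hq (v i)) (analyticAt_const (v := (0 : ℝ))) (by
        filter_upwards [genF_ne han hne, genF_le ((hproj_tendsto (v i)).eventually hNq), 
          genF_le ((hproj_tendsto (v i)).eventually (h i (Finset.mem_insert_of_mem hi)))] with ξ h1 h2 h3
        rw [h3 (hproj_pair (hv0 i) ξ)] at h2
        exact (mul_eq_zero.1 h2.symm).resolve_left h1)
      filter_upwards [hz] with ξ h1 h2
      rwa [hproj_fix h2] at h1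
    obtain ⟨q', hq', hqq⟩ := ih q hq hv
    refine ⟨q', hq', ?_⟩
    filter_upwards [hNq, hqq] with ξ h1 h2
    rw [h1, h2, Finset.prod_insert hj]; ring

lemma exp_unit : ∃ e : ℝ → ℝ, AnalyticAt ℝ e 0 ∧ e 0 ≠ 0 ∧ ∀ t, 1 - Real.exp t = t * e t := by
  have h1 : AnalyticAt ℝ (fun t => 1 - Real.exp t) 0 := analyticAt_const.sub analyticAt_rexp
  obtain ⟨p, hp⟩ := h1
  refine ⟨dslope (fun t => 1 - Real.exp t) 0, 
    (HasFPowerSeriesAt.has_fpower_series_dslope_fslope hp).analyticAt, ?_, ?_⟩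
  · rw [dslope_same]
    have : HasDerivAt (fun t => 1 - Real.exp t) (-Real.exp 0) 0 := (Real.hasDerivAt_exp 0).const_sub 1
    rw [this.deriv]; simp
  · intro t
    have := sub_smul_dslope (fun t => 1 - Real.exp t) 0 t
    simp at this
    linarith

/-- division by the denominators -/
lemma div_Dn {v : Fin n → Vd d} (hv0 : ∀ i, v i ≠ 0)
    (hsep : ∀ i j, i ≠ j → ∃ ξ, pairE ξ (v i) = 0 ∧ pairE ξ (v j) ≠ 0) (K : Finset (Fin n)) 
    {N : Vd d → ℝ} (hN : AnalyticAt ℝ N 0)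
    (h : ∀ i ∈ K, ∀ᶠ ξ in 𝓝 (0 : Vd d), pairE ξ (v i) = 0 → N ξ = 0) :
    ∃ q : Vd d → ℝ, AnalyticAt ℝ q 0 ∧ ∀ᶠ ξ in 𝓝 (0 : Vd d), N ξ = Dn v K ξ * q ξ := by
  obtain ⟨q, hq, hqN⟩ := div_prod hv0 hsep K N hN h
  obtain ⟨e, he, he0, hee⟩ := exp_unit
  have hU : AnalyticAt ℝ (fun ξ => ∏ i ∈ K, e (pairE ξ (v i))) 0 := by
    refine Finset.analyticAt_fun_prod K fun i _ => ?_
    have : AnalyticAt ℝ e (pairE 0 (v i)) := by rwa [pairE_zero_left]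
    exact AnalyticAt.comp (f := fun ξ => pairE ξ (v i)) this (pairE_analytic (v i) 0)
  have hU0 : (∏ i ∈ K, e (pairE (0 : Vd d) (v i))) ≠ 0 := by
    refine Finset.prod_ne_zero_iff.2 fun i _ => ?_
    rwa [pairE_zero_left]
  refine ⟨_, hq.div hU hU0, ?_⟩
  filter_upwards [hqN, hU.continuousAt.eventually_ne hU0] with ξ h1 h2
  have : Dn v K ξ = (∏ i ∈ K, pairE ξ (v i)) * ∏ i ∈ K, e (pairE ξ (v i)) := by
    rw [← Finset.prod_mul_distrib]
    exact Finset.prod_congr rfl fun i _ => hee _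
  rw [this, h1, Pi.div_apply]
  field_simp

end divis

noncomputable section
variable {d n : ℕ} {Λ : AddSubgroup (Vd d)}

lemma no_line [DiscreteTopology Λ] (s : Vd d) (v : Fin n → Vd d) (hv : ∀ i, v i ∈ Λ) (J : Finset (Fin n))
    (hη : (negReg v J).Nonempty) : ¬ ContainsLine (cn s v J) := by
  rintro ⟨x, u, hu, h⟩
  obtain ⟨η, hη⟩ := hη
  have key : ∀ w : Vd d, (∀ t : ℝ, x + t • w ∈ cn s v J) → w ∈ cn 0 v J := by
    intro w hw
    have hlim : Tendsto (fun k : ℕ => (1 / ((k : ℝ) + 1)) • (x - s) + w) atTop (𝓝 ((0 : ℝ) • (x - s) + w)) :=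
      (tendsto_one_div_add_atTop_nhds_zero_nat.smul_const _).add_const _
    rw [zero_smul, zero_add] at hlim
    refine (cn_closed v hv J 0).mem_of_tendsto hlim (Eventually.of_forall fun k => ?_)
    have h1 := (mem_cn_iff_sub s v J _).1 (hw ((k : ℝ) + 1))
    have hk : (0 : ℝ) < (k : ℝ) + 1 := by positivity
    have h2 := cn_smul_cn h1 (r := 1 / ((k : ℝ) + 1)) (by positivity)
    convert h2 using 1
    rw [add_sub_right_comm, smul_add, smul_smul, one_div, inv_mul_cancel₀ hk.ne', one_smul]
  have h1 := key u h
  have h2 := key (-u) (fun t => by simpa using h (-t))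
  obtain ⟨t, ht, e⟩ := h1
  obtain ⟨t', ht', e'⟩ := h2
  have e1 : ∑ i ∈ J, (t i + t' i) * pairE η (v i) = 0 := by
    have : (∑ i ∈ J, (t i + t' i) • v i) = 0 := by
      have := congrArg₂ (· + ·) e e'
      simp only [add_neg_cancel, zero_add] at this
      simp only [add_smul, Finset.sum_add_distrib]
      exact this.symm
    rw [← pairE_comb, this, pairE_zero_right]
  have e2 := (Finset.sum_eq_zero_iff_of_nonpos (fun i hi =>
    mul_nonpos_of_nonneg_of_nonpos (add_nonneg (ht i) (ht' i)) (hη i hi).le)).1 e1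
  apply hu
  rw [e, zero_add]
  refine Finset.sum_eq_zero fun i hi => ?_
  have := e2 i hi
  have h3 := hη i hi
  have : t i + t' i = 0 := by
    rcases mul_eq_zero.1 this with h | h
    · exact h
    · exact absurd h h3.ne
  have : t i = 0 := by linarith [ht i, ht' i]
  rw [this, zero_smul]

lemma finrank_quot_lt {w : Vd d} (hw : w ∈ Submodule.span ℝ (Λ : Set (Vd d))) (hw0 : w ≠ 0) (π : Vd d →ₗ[ℝ] Vd d)
    (hπ : π w = 0) :
    Module.finrank ℝ (Submodule.span ℝ ((AddSubgroup.map π.toAddMonoidHom Λ : AddSubgroup (Vd d)) : Set (Vd d)))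
      < Module.finrank ℝ (Submodule.span ℝ (Λ : Set (Vd d))) := by
  have e : ((AddSubgroup.map π.toAddMonoidHom Λ : AddSubgroup (Vd d)) : Set (Vd d)) = π '' (Λ : Set (Vd d)) := rfl
  rw [e, ← Submodule.map_span]
  set W := Submodule.span ℝ (Λ : Set (Vd d))
  have h1 := LinearMap.finrank_range_add_finrank_ker (π.domRestrict W)
  rw [LinearMap.range_domRestrict] at h1
  have h2 : 0 < Module.finrank ℝ (LinearMap.ker (π.domRestrict W)) := by
    refine Module.finrank_pos_iff_exists_ne_zero.2 ⟨⟨⟨w, hw⟩, ?_⟩, ?_⟩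
    · simpa using hπ
    · intro h
      exact hw0 (congrArg Subtype.val (congrArg Subtype.val h))
  omega

lemma coproj_step {Λ₀ : AddSubgroup (Vd d)} {Q : Vd d →ₗ[ℝ] Vd d →ₗ[ℝ] ℝ} (hQ : IsRatInner Λ₀ Q) (v : Fin n → Vd d)
    (J : Finset (Fin n)) {i : Fin n} (hi : i ∈ J) {π ρ σ : Vd d →ₗ[ℝ] Vd d}
    (hπ : IsQCoproj Q (Submodule.span ℝ {v i}) π)
    (hρ : IsQCoproj Q (Submodule.span ℝ ((π ∘ v) '' J)) ρ)
    (hσ : IsQCoproj Q (Submodule.span ℝ (v '' J)) σ) : ρ ∘ₗ π = σ := by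
  have hM : ∀ y ∈ Submodule.span ℝ ((π ∘ v) '' J), ∀ z ∈ Submodule.span ℝ {v i}, Q y z = 0 := by
    intro y hy z hz
    rw [image_comp, ← Submodule.map_span] at hy
    obtain ⟨x, -, rfl⟩ := hy
    exact hπ.2 x z hz
  have h := coproj_comp hπ hρ hM
  have e : Submodule.span ℝ {v i} ⊔ Submodule.span ℝ ((π ∘ v) '' J) = Submodule.span ℝ (v '' J) := by
    have hvi : v i ∈ Submodule.span ℝ (v '' J) := Submodule.subset_span ⟨i, hi, rfl⟩
    have hle : Submodule.span ℝ {v i} ≤ Submodule.span ℝ (v '' J) := by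
      rw [Submodule.span_le]; simpa using hvi
    apply le_antisymm
    · refine sup_le hle ?_
      rw [Submodule.span_le]
      rintro _ ⟨j, hj, rfl⟩
      have h1 := hle (hπ.1 (v j))
      have h2 : v j ∈ Submodule.span ℝ (v '' J) := Submodule.subset_span ⟨j, hj, rfl⟩
      have := Submodule.sub_mem _ h2 h1
      simpa using this
    · rw [Submodule.span_le]
      rintro _ ⟨j, hj, rfl⟩
      have h1 := hπ.1 (v j)
      have h2 : π (v j) ∈ Submodule.span ℝ ((π ∘ v) '' J) := Submodule.subset_span ⟨j, hj, rfl⟩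
      have := Submodule.add_mem_sup h1 h2
      simpa using this
  rw [e] at h
  exact coproj_unique hQ h hσ

lemma negReg_proj {v : Fin n → Vd d} {i : Fin n} {π : Vd d →ₗ[ℝ] Vd d} {J : Finset (Fin n)}
    (hπ : ∀ x, x - π x ∈ Submodule.span ℝ {v i}) {ξ : Vd d} (h0 : pairE ξ (v i) = 0) :
    ξ ∈ negReg (π ∘ v) J ↔ ξ ∈ negReg v J := by
  simp only [negReg, mem_setOf_eq, Function.comp, pairE_proj hπ h0]

end

noncomputable section
variable {d n : ℕ} {Λ : AddSubgroup (Vd d)}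

open Classical in
/-- the finite set of faces of the cone -/
def fcs (s : Vd d) (v : Fin n → Vd d) : Finset (Set (Vd d)) := (faces_finite s v).toFinset

lemma mem_fcs {s : Vd d} {v : Fin n → Vd d} {F : Set (Vd d)} : F ∈ fcs s v ↔ IsFaceOf (cn s v Finset.univ) F := by
  simp [fcs]

lemma cont_of_interface {E f : Vd d → ℝ} {v : Fin n → Vd d} {J : Finset (Fin n)}
    (hE : ∀ ξ, AnalyticAt ℝ E ξ) (h : ∀ ξ ∈ negReg v J, E ξ = Dn v J ξ * f ξ) {ξ : Vd d} (hξ : ξ ∈ negReg v J) :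
    ContinuousAt f ξ := by
  have h1 : ContinuousAt (fun ξ => E ξ / Dn v J ξ) ξ :=
    (hE ξ).continuousAt.div (Dn_analytic v J ξ).continuousAt (Dn_ne hξ)
  refine h1.congr ?_
  filter_upwards [(negReg_open v J).mem_nhds hξ] with y hy
  rw [h y hy, mul_div_cancel_left₀ _ (Dn_ne hy)]

open Classical in
lemma face_ident {Q : Vd d →ₗ[ℝ] Vd d →ₗ[ℝ] ℝ} (hQ : IsRatInner Λ Q)
    {I S μ : AddSubgroup (Vd d) → Set (Vd d) → Vd d → ℝ} (hΛd : ∀ Λ', IsQuotLattice Q Λ Λ' → DiscreteTopology Λ')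
    (hI : IsIFamily Q Λ I) (hS : IsSFamily Q Λ S) (hμ : IsMuCore Λ Q I S μ)
    {Λ' : AddSubgroup (Vd d)} (hΛ' : IsQuotLattice Q Λ Λ')
    {s : Vd d} (hs : IsRatPoint Λ' s) {v : Fin n → Vd d} (hv : ∀ i, v i ∈ Λ') {i : Fin n}
    (hφ : ∃ φ, pairE φ (v i) = 0 ∧ ∀ j, j ≠ i → pairE φ (v j) < 0)
    {pr : Submodule ℝ (Vd d) → (Vd d →ₗ[ℝ] Vd d)} (hpr : ∀ L, IsQCoproj Q L (pr L))
    {G : Set (Vd d) → Vd d → ℝ}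
    (hG : ∀ F, IsFaceOf (cn s v Finset.univ) F → i ∈ faceJ s v F → AnalyticAt ℝ (G F) 0 ∧
      MeroEqAt0 (μ (AddSubgroup.map (pr (Submodule.span ℝ (v '' faceJ s v F))).toAddMonoidHom Λ')
        (cn (pr (Submodule.span ℝ (v '' faceJ s v F)) s) (pr (Submodule.span ℝ (v '' faceJ s v F)) ∘ v) Finset.univ))
        (G F))
    {π : Vd d →ₗ[ℝ] Vd d} (hπ : IsQCoproj Q (Submodule.span ℝ {v i}) π) :
    ∀ᶠ ξ in 𝓝 (0 : Vd d), ξ ∈ negReg v (Finset.univ.erase i) → pairE ξ (v i) = 0 →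
      S (AddSubgroup.map π.toAddMonoidHom Λ') (cn (π s) (π ∘ v) Finset.univ) ξ =
      ∑ F ∈ (fcs s v).filter (fun F => i ∈ faceJ s v F), G F ξ *
        I (AddSubgroup.map π.toAddMonoidHom Λ') (cn (π s) (π ∘ v) (faceJ s v F)) ξ := by
  have hq : IsQuotLattice Q Λ (AddSubgroup.map π.toAddMonoidHom Λ') :=
    quot_quot hQ hΛ' (T := {v i}) (by simpa using hv i) rfl hπ
  have hπi : π (v i) = 0 := coproj_zero hQ hπ (Submodule.mem_span_singleton_self _)
  have hs'' := ratPoint_map hs π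
  have hv'' : ∀ j, (π ∘ v) j ∈ AddSubgroup.map π.toAddMonoidHom Λ' := fun j => ⟨v j, hv j, rfl⟩
  have hd := hΛd _ hq
  have hI'' := hI _ hq
  have hS'' := hS _ hq
  set Λ'' := AddSubgroup.map π.toAddMonoidHom Λ' with hΛ''
  have hne : (negReg (π ∘ v) (Finset.univ.erase i)).Nonempty := by
    obtain ⟨φ, h1, h2⟩ := hφ
    exact ⟨φ, (negReg_proj hπ.1 h1).2 fun j hj => h2 j (Finset.ne_of_mem_erase hj)⟩
  have hneJ : ∀ J, (negReg (π ∘ v) (Finset.erase J i)).Nonempty := fun J =>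
    hne.mono fun ξ (hξ : ξ ∈ negReg (π ∘ v) (Finset.univ.erase i)) j hj => hξ j (Finset.mem_erase.2 ⟨Finset.ne_of_mem_erase hj, Finset.mem_univ _⟩)
  have hz : (π ∘ v) i = 0 := hπi
  have hlJ : ∀ J, ¬ ContainsLine (cn (π s) (π ∘ v) (Finset.erase J i)) := fun J => no_line _ _ hv'' _ (hneJ J)
  have hl : ¬ ContainsLine (cn (π s) (π ∘ v) Finset.univ) := by
    rw [cn_erase_zero _ _ _ hz]; exact hlJ _
  have h := hμ.2.2 _ hq (cn (π s) (π ∘ v) Finset.univ) ⟨π s, n, π ∘ v, hs'', hv'', rfl⟩ hl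
    (fun F => pr (affineSpan ℝ F).direction) (fun F _ => hpr _)
  have hbij := faces_quot (s := s) hπ.1 hπi
  have hset : {F | IsFaceOf (cn s v Finset.univ) F ∧ i ∈ faceJ s v F} =
      (((fcs s v).filter (fun F => i ∈ faceJ s v F) : Finset (Set (Vd d))) : Set (Set (Vd d))) := by
    ext F; simp [mem_fcs]
  rw [genF_iff] at h
  have hGev : ∀ᶠ ξ in genF d, ∀ F ∈ (fcs s v).filter (fun F => i ∈ faceJ s v F),
      μ (AddSubgroup.map (pr (Submodule.span ℝ (v '' faceJ s v F))).toAddMonoidHom Λ')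
        (cn (pr (Submodule.span ℝ (v '' faceJ s v F)) s) (pr (Submodule.span ℝ (v '' faceJ s v F)) ∘ v) Finset.univ) ξ
        = G F ξ := by
    rw [eventually_all_finset]
    intro F hF
    rw [Finset.mem_filter, mem_fcs] at hF
    exact genF_iff.1 (hG F hF.1 hF.2).2
  have h2 : ∀ᶠ ξ in genF d, ξ ∈ negReg (π ∘ v) (Finset.univ.erase i) →
      S Λ'' (cn (π s) (π ∘ v) Finset.univ) ξ =
      ∑ F ∈ (fcs s v).filter (fun F => i ∈ faceJ s v F), G F ξ *
        I Λ'' (cn (π s) (π ∘ v) (faceJ s v F)) ξ := by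
    filter_upwards [h, hGev] with ξ h1 h2 _
    rw [h1]
    refine (finsum_mem_eq_of_bijOn (fun F => π '' F) hbij (fun F _ => rfl)).symm.trans ?_
    rw [hset, finsum_mem_coe_finset]
    refine Finset.sum_congr rfl fun F hF => ?_
    rw [← h2 F hF]
    rw [Finset.mem_filter, mem_fcs] at hF
    obtain ⟨-, -, -, hFe⟩ := face_spec hF.1
    have e1 : π '' F = cn (π s) (π ∘ v) (faceJ s v F) := by
      conv_lhs => rw [hFe]
      exact map_cn _ _ _ _
    rw [e1, cn_direction]
    set J := faceJ s v F
    have hρ := hpr (Submodule.span ℝ ((π ∘ v) '' J))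
    set ρ := pr (Submodule.span ℝ ((π ∘ v) '' J))
    have hstep := coproj_step hQ v J hF.2 hπ hρ (hpr (Submodule.span ℝ (v '' J)))
    rw [image_suppCone _ _ _ (fun j hj => coproj_zero hQ hρ (Submodule.subset_span ⟨j, hj, rfl⟩)), ← hstep,
      hΛ'', AddSubgroup.map_map]
    rfl
  have h3 := genF_cont (negReg_open _ _) (f := S Λ'' (cn (π s) (π ∘ v) Finset.univ)) (g := fun ξ =>
    ∑ F ∈ (fcs s v).filter (fun F => i ∈ faceJ s v F), G F ξ *
        I Λ'' (cn (π s) (π ∘ v) (faceJ s v F)) ξ) ?_ h2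
  · filter_upwards [h3] with ξ h hξ h0
    exact h ((negReg_proj hπ.1 h0).2 hξ)
  · have hc : ∀ᶠ ξ in 𝓝 (0 : Vd d), ∀ F ∈ (fcs s v).filter (fun F => i ∈ faceJ s v F), ContinuousAt (G F) ξ := by
      rw [eventually_all_finset]
      intro F hF
      rw [Finset.mem_filter, mem_fcs] at hF
      exact (hG F hF.1 hF.2).1.eventually_analyticAt.mono fun ξ h => h.continuousAt
    filter_upwards [hc] with ξ hξ hU
    constructor
    · obtain ⟨E, hE, h, -⟩ := S_interface hS'' hs'' (π ∘ v) hv'' (Finset.univ.erase i) hne (hlJ _)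
      rw [cn_erase_zero _ _ _ hz]
      exact cont_of_interface hE h hU
    · refine tendsto_finsetSum _ fun F hF => (hξ F hF).mul ?_
      obtain ⟨E, hE, h, -⟩ := I_interface hI'' hs'' (π ∘ v) hv'' ((faceJ s v F).erase i) (hneJ _) (hlJ _)
      rw [cn_erase_zero _ _ _ hz]
      exact cont_of_interface hE h fun j hj => hU j (Finset.mem_erase.2 ⟨Finset.ne_of_mem_erase hj, Finset.mem_univ _⟩)

end

noncomputable section
variable {d n : ℕ} {Λ : AddSubgroup (Vd d)}

lemma Dn_compl (v : Fin n → Vd d) (J : Finset (Fin n)) (ξ : Vd d) :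
    Dn v Jᶜ ξ * Dn v J ξ = Dn v Finset.univ ξ := Finset.prod_compl_mul_prod _ _

lemma Dn_compl_erase (v : Fin n → Vd d) (J : Finset (Fin n)) {i : Fin n} (hi : i ∈ J) (ξ : Vd d) :
    Dn v Jᶜ ξ * Dn v (J.erase i) ξ = Dn v (Finset.univ.erase i) ξ := by
  unfold Dn
  rw [← Finset.prod_union]
  · congr 1
    ext j
    by_cases h : j = i
    · subst h; simp [hi]
    · simp only [Finset.mem_union, Finset.mem_compl, Finset.mem_erase, Finset.mem_univ]; tauto
  · rw [Finset.disjoint_left]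
    intro j hj hj'
    exact Finset.mem_compl.1 hj (Finset.mem_of_mem_erase hj')

lemma Dn_zero (v : Fin n → Vd d) (J : Finset (Fin n)) {i : Fin n} (hi : i ∈ J) {ξ : Vd d} (h : pairE ξ (v i) = 0) :
    Dn v J ξ = 0 := Finset.prod_eq_zero hi (by rw [h]; simp)

lemma cn_empty (s : Vd d) (v : Fin n → Vd d) : cn s v ∅ = {s} := by
  ext x
  simp only [cn, Finset.sum_empty, add_zero, mem_ofPred_eq, mem_singleton_iff]
  exact ⟨fun ⟨_, _, h⟩ => h, fun h => ⟨0, fun _ => le_rfl, h⟩⟩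

open Classical in
lemma main_step {Q : Vd d →ₗ[ℝ] Vd d →ₗ[ℝ] ℝ} (hQ : IsRatInner Λ Q)
    {I S μ : AddSubgroup (Vd d) → Set (Vd d) → Vd d → ℝ} (hΛd : ∀ Λ', IsQuotLattice Q Λ Λ' → DiscreteTopology Λ')
    (hI : IsIFamily Q Λ I) (hS : IsSFamily Q Λ S) (hμ : IsMuCore Λ Q I S μ)
    {Λ' : AddSubgroup (Vd d)} (hΛ' : IsQuotLattice Q Λ Λ')
    {s : Vd d} (hs : IsRatPoint Λ' s) {v : Fin n → Vd d} (hv : ∀ i, v i ∈ Λ')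
    (hprim : ∀ i, ∀ q : ℝ, q • v i ∈ Λ' → ∃ k : ℤ, q = k)
    {η : Vd d} (hη : ∀ i, pairE η (v i) < 0)
    (hφ : ∀ i, ∃ φ, pairE φ (v i) = 0 ∧ ∀ j, j ≠ i → pairE φ (v j) < 0)
    {pr : Submodule ℝ (Vd d) → (Vd d →ₗ[ℝ] Vd d)} (hpr : ∀ L, IsQCoproj Q L (pr L))
    {G : Set (Vd d) → Vd d → ℝ}
    (hG : ∀ F, IsFaceOf (cn s v Finset.univ) F → ∀ i, i ∈ faceJ s v F → AnalyticAt ℝ (G F) 0 ∧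
      MeroEqAt0 (μ (AddSubgroup.map (pr (Submodule.span ℝ (v '' faceJ s v F))).toAddMonoidHom Λ')
        (cn (pr (Submodule.span ℝ (v '' faceJ s v F)) s) (pr (Submodule.span ℝ (v '' faceJ s v F)) ∘ v) Finset.univ))
        (G F)) :
    ∃ g, AnalyticAt ℝ g 0 ∧ MeroEqAt0 (μ Λ' (cn s v Finset.univ)) g := by
  have hd := hΛd _ hΛ'
  have hηJ : ∀ J, (negReg v J).Nonempty := fun J => ⟨η, fun i _ => hη i⟩
  have hlJ : ∀ J, ¬ ContainsLine (cn s v J) := fun J => no_line _ _ hv _ (hηJ J)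
  have hv0 : ∀ i, v i ≠ 0 := by
    intro i h
    have := hη i
    rw [h, pairE_zero_right] at this
    exact lt_irrefl _ this
  choose EI hEIa hEI1 hEI2 using fun J => I_interface (hI _ hΛ') hs v hv J (hηJ J) (hlJ J)
  obtain ⟨ES, hESa, hES1, hES2⟩ := S_interface (hS _ hΛ') hs v hv Finset.univ (hηJ _) (hlJ _)
  have hEIg : ∀ J, ∀ᶠ ξ in genF d, EI J ξ = Dn v J ξ * I Λ' (cn s v J) ξ := fun J =>
    mero_cone ((hI _ hΛ').1 _ (cn_ratPolyhedron v hv J hs)) (hEIa J 0) (Dn_analytic v J 0) (negReg_open v J)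
      (hηJ J) (negReg_cone v J) (hEI1 J)
  have hESg : ∀ᶠ ξ in genF d, ES ξ = Dn v Finset.univ ξ * S Λ' (cn s v Finset.univ) ξ :=
    mero_cone ((hS _ hΛ').1 _ (cn_ratPolyhedron v hv _ hs)) (hESa 0) (Dn_analytic v _ 0) (negReg_open v _)
      (hηJ _) (negReg_cone v _) hES1
  -- the vertex
  have hsF : {s} ∈ fcs s v := by
    rw [mem_fcs, ← cn_empty s v]
    refine face_of_functional s v (fun i => (hη i).le) ∅ fun i => ?_
    simp [(hη i).ne]
  have hsJ : faceJ s v {s} = ∅ := by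
    ext i; simp [faceJ, hv0 i]
  have hFJ : ∀ F ∈ fcs s v, F = cn s v (faceJ s v F) := fun F hF => by
    obtain ⟨-, -, -, h⟩ := face_spec (mem_fcs.1 hF)
    exact h
  have hex : ∀ F ∈ (fcs s v).erase {s}, ∃ i, i ∈ faceJ s v F := by
    intro F hF
    by_contra! hcon
    have h0 : faceJ s v F = ∅ := Finset.eq_empty_of_forall_notMem hcon
    have := hFJ F (Finset.mem_of_mem_erase hF)
    rw [h0, cn_empty] at this
    exact Finset.ne_of_mem_erase hF this
  have hpr0 : pr (Submodule.span ℝ (v '' faceJ s v {s})) = LinearMap.id := by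
    refine coproj_unique hQ (hpr _) ?_
    rw [hsJ]
    constructor
    · intro x; simp
    · intro x y hy
      have : y = 0 := by simpa using hy
      simp [this]
  -- the formula
  have hform := hμ.2.2 _ hΛ' (cn s v Finset.univ) ⟨s, n, v, hs, hv, rfl⟩ (hlJ _)
    (fun F => pr (affineSpan ℝ F).direction) (fun F _ => hpr _)
  rw [genF_iff] at hform
  set M : Set (Vd d) → Vd d → ℝ := fun F => 
    μ (AddSubgroup.map (pr (Submodule.span ℝ (v '' faceJ s v F))).toAddMonoidHom Λ')
        (cn (pr (Submodule.span ℝ (v '' faceJ s v F)) s) (pr (Submodule.span ℝ (v '' faceJ s v F)) ∘ v) Finset.univ)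
    with hM
  have hMs : M {s} = μ Λ' (cn s v Finset.univ) := by
    simp only [hM]
    rw [hpr0]
    congr 1
    exact AddSubgroup.map_id _
  have hset : {F | IsFaceOf (cn s v Finset.univ) F} = ((fcs s v : Finset (Set (Vd d))) : Set (Set (Vd d))) := by
    ext F; simp [mem_fcs]
  have hform2 : ∀ᶠ ξ in genF d, S Λ' (cn s v Finset.univ) ξ = 
      M {s} ξ * Real.exp (pairE ξ s) + ∑ F ∈ (fcs s v).erase {s}, M F ξ * I Λ' (cn s v (faceJ s v F)) ξ := by
    filter_upwards [hform] with ξ h1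
    have h2 : M {s} ξ * Real.exp (pairE ξ s) = M {s} ξ * I Λ' (cn s v (faceJ s v {s})) ξ := by
      rw [hsJ, cn_empty, I_vertex (hI _ hΛ') hs]
    rw [h1, h2, Finset.add_sum_erase _ (fun F => M F ξ * I Λ' (cn s v (faceJ s v F)) ξ) hsF]
    rw [← finsum_mem_coe_finset, ← hset]
    refine finsum_mem_congr rfl fun F hF => ?_
    have hF' : F ∈ fcs s v := mem_fcs.2 hF
    have hFe := hFJ F hF'
    have e1 : (affineSpan ℝ F).direction = Submodule.span ℝ (v '' faceJ s v F) := by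
      conv_lhs => rw [hFe]
      exact cn_direction _ _ _
    have e2 : pr (Submodule.span ℝ (v '' faceJ s v F)) '' suppCone (cn s v Finset.univ) F =
        cn (pr (Submodule.span ℝ (v '' faceJ s v F)) s) (pr (Submodule.span ℝ (v '' faceJ s v F)) ∘ v) Finset.univ := by
      have := image_suppCone (π := pr (Submodule.span ℝ (v '' faceJ s v F))) s v (faceJ s v F)
        (fun j hj => coproj_zero hQ (hpr _) (Submodule.subset_span ⟨j, hj, rfl⟩))
      rwa [← hFe] at this
    rw [e1, e2, ← hFe]
  have hGa : ∀ F ∈ (fcs s v).erase {s}, AnalyticAt ℝ (G F) 0 := fun F hF => by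
    obtain ⟨i, hi⟩ := hex F hF
    exact (hG F (mem_fcs.1 (Finset.mem_of_mem_erase hF)) i hi).1
  have hMG : ∀ᶠ ξ in genF d, ∀ F ∈ (fcs s v).erase {s}, M F ξ = G F ξ := by
    rw [eventually_all_finset]
    intro F hF
    obtain ⟨i, hi⟩ := hex F hF
    exact genF_iff.1 (hG F (mem_fcs.1 (Finset.mem_of_mem_erase hF)) i hi).2
  have hEIg' : ∀ᶠ ξ in genF d, ∀ F ∈ (fcs s v).erase {s}, 
      EI (faceJ s v F) ξ = Dn v (faceJ s v F) ξ * I Λ' (cn s v (faceJ s v F)) ξ := by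
    rw [eventually_all_finset]
    intro F hF
    exact hEIg _
  set N : Vd d → ℝ := fun ξ => ES ξ - ∑ F ∈ (fcs s v).erase {s}, 
    G F ξ * (Dn v (faceJ s v F)ᶜ ξ * EI (faceJ s v F) ξ) with hN
  have hNa : AnalyticAt ℝ N 0 := by
    refine (hESa 0).sub (Finset.analyticAt_fun_sum _ fun F hF => ?_)
    exact (hGa F hF).mul ((Dn_analytic _ _ _).mul (hEIa _ 0))
  have hNg : ∀ᶠ ξ in genF d, Dn v Finset.univ ξ * (μ Λ' (cn s v Finset.univ) ξ * Real.exp (pairE ξ s)) = N ξ := by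
    filter_upwards [hform2, hMG, hEIg', hESg] with ξ h1 h2 h3 h4
    simp only [hN]
    rw [h4, h1, hMs, mul_add, Finset.mul_sum, eq_sub_iff_add_eq]
    congr 1
    refine Finset.sum_congr rfl fun F hF => ?_
    rw [h2 F hF, h3 F hF, ← Dn_compl v (faceJ s v F)]
    ring
  have hvan : ∀ i, ∀ᶠ ξ in 𝓝 (0 : Vd d), ξ ∈ negReg v (Finset.univ.erase i) → pairE ξ (v i) = 0 → N ξ = 0 := by
    intro i
    have hπ := hpr (Submodule.span ℝ {v i})
    set π := pr (Submodule.span ℝ {v i})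
    have hq : IsQuotLattice Q Λ (AddSubgroup.map π.toAddMonoidHom Λ') :=
      quot_quot hQ hΛ' (T := {v i}) (by simpa using hv i) rfl hπ
    have hπi : π (v i) = 0 := coproj_zero hQ hπ (Submodule.mem_span_singleton_self _)
    filter_upwards [face_ident hQ hΛd hI hS hμ hΛ' hs hv (hφ i) hpr (fun F hF hi => hG F hF i hi) hπ] with ξ h hξ h0
    have h := h hξ h0
    simp only [hN]
    rw [hES2 i (Finset.mem_univ _) π hπ.1 hπi (hprim i) (hΛd _ hq) _ (hS _ hq) ξ hξ h0, h, sub_eq_zero, Finset.mul_sum]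
    have hsub : (fcs s v).filter (fun F => i ∈ faceJ s v F) ⊆ (fcs s v).erase {s} := by
      intro F hF
      rw [Finset.mem_filter] at hF
      refine Finset.mem_erase.2 ⟨?_, hF.1⟩
      rintro rfl
      rw [hsJ] at hF
      simpa using hF.2
    rw [← Finset.sum_subset hsub]
    · refine Finset.sum_congr rfl fun F hF => ?_
      rw [Finset.mem_filter] at hF
      rw [hEI2 _ i hF.2 π hπ.1 hπi (hprim i) (hΛd _ hq) _ (hI _ hq) ξ 
        (fun j hj => hξ j (Finset.mem_erase.2 ⟨Finset.ne_of_mem_erase hj, Finset.mem_univ _⟩)) h0, ← Dn_compl_erase v _ hF.2]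
      ring
    · intro F hF hF2
      have : i ∉ faceJ s v F := fun hi => hF2 (Finset.mem_filter.2 ⟨Finset.mem_of_mem_erase hF, hi⟩)
      rw [Dn_zero v _ (Finset.mem_compl.2 this) h0]; simp
  have hvan2 : ∀ i ∈ (Finset.univ : Finset (Fin n)), ∀ᶠ ξ in 𝓝 (0 : Vd d), pairE ξ (v i) = 0 → N ξ = 0 := by
    intro i _
    have key := cone_zero (hproj_an hNa (v i)) (C := (hproj (v i)) ⁻¹' negReg v (Finset.univ.erase i))
      ((negReg_open _ _).preimage (hproj (v i)).continuous) (by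
        obtain ⟨φ, h1, h2⟩ := hφ i
        refine ⟨φ, ?_⟩
        rw [mem_preimage, hproj_fix h1]
        exact fun j hj => h2 j (Finset.ne_of_mem_erase hj)) (fun ξ hξ r hr => by
        rw [mem_preimage, map_smul]
        exact negReg_cone _ _ _ hξ r hr) (by
        filter_upwards [(hproj_tendsto (v i)).eventually (hvan i)] with ξ h hξ
        exact h hξ (hproj_pair (hv0 i) ξ))
    filter_upwards [key] with ξ h h0
    rwa [hproj_fix h0] at h
  obtain ⟨q, hqa, hqN⟩ := div_Dn hv0 (fun i j hij => by
    obtain ⟨φ, h1, h2⟩ := hφ i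
    exact ⟨φ, h1, (h2 j hij.symm).ne⟩) Finset.univ hNa hvan2
  refine ⟨fun ξ => q ξ * Real.exp (-pairE ξ s), hqa.mul (pairE_analytic s 0).neg.rexp, ?_⟩
  rw [genF_iff]
  filter_upwards [hNg, genF_le hqN, genF_ne (Dn_analytic v Finset.univ 0) (Dn_not_zero (hηJ _))] with ξ h1 h2 h3
  rw [h2] at h1
  have := mul_left_cancel₀ h3 h1
  rw [← this, mul_assoc, ← Real.exp_add]
  simp

/-- analyticity of all the functions `μ(a)` -/
lemma mu_analytic {Q : Vd d →ₗ[ℝ] Vd d →ₗ[ℝ] ℝ} (hΛ : IsFullLattice Λ) (hQ : IsRatInner Λ Q)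
    {I S μ : AddSubgroup (Vd d) → Set (Vd d) → Vd d → ℝ}
    (hI : IsIFamily Q Λ I) (hS : IsSFamily Q Λ S) (hμ : IsMuFamily Λ Q I S μ) :
    ∀ (k : ℕ) (Λ' : AddSubgroup (Vd d)), IsQuotLattice Q Λ Λ' → 
      Module.finrank ℝ (Submodule.span ℝ (Λ' : Set (Vd d))) = k → ∀ a, IsRatAffineCone Λ' a → 
      ∃ g, AnalyticAt ℝ g 0 ∧ MeroEqAt0 (μ Λ' a) g := by
  have hΛd : ∀ Λ', IsQuotLattice Q Λ Λ' → DiscreteTopology Λ' := fun Λ' h => quot_disc hΛ hQ h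
  choose pr hpr using exists_coproj hQ
  intro k
  induction k using Nat.strong_induction_on with
  | _ k ih =>
  intro Λ' hΛ' hk a ha
  have hd := hΛd _ hΛ'
  by_cases hl : ContainsLine a
  · refine ⟨fun _ => 0, analyticAt_const, ?_⟩
    rw [genF_iff]
    exact Eventually.of_forall (hμ.2 Λ' hΛ' a ha hl)
  obtain ⟨s, n, v, hs, hv, rfl, hprim, ⟨η, hη⟩, hφ⟩ := normal_form ha hl
  have hG : ∀ F, ∃ g : Vd d → ℝ, IsFaceOf (cn s v Finset.univ) F → ∀ i, i ∈ faceJ s v F → AnalyticAt ℝ g 0 ∧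
      MeroEqAt0 (μ (AddSubgroup.map (pr (Submodule.span ℝ (v '' faceJ s v F))).toAddMonoidHom Λ')
        (cn (pr (Submodule.span ℝ (v '' faceJ s v F)) s) (pr (Submodule.span ℝ (v '' faceJ s v F)) ∘ v) Finset.univ))
        g := by
    intro F
    by_cases hF : ∃ i, i ∈ faceJ s v F
    · obtain ⟨i, hi⟩ := hF
      have hρ := hpr (Submodule.span ℝ (v '' faceJ s v F))
      set ρ := pr (Submodule.span ℝ (v '' faceJ s v F))
      have hq : IsQuotLattice Q Λ (AddSubgroup.map ρ.toAddMonoidHom Λ') :=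
        quot_quot hQ hΛ' (T := v '' faceJ s v F) (by rintro _ ⟨j, -, rfl⟩; exact hv j) rfl hρ
      have hlt := finrank_quot_lt (Λ := Λ') (Submodule.subset_span (hv i)) (fun h => by
        have := hη i
        rw [h, pairE_zero_right] at this
        exact lt_irrefl _ this) ρ (coproj_zero hQ hρ (Submodule.subset_span ⟨i, hi, rfl⟩))
      obtain ⟨g, h1, h2⟩ := ih _ (hk ▸ hlt) _ hq rfl (cn (ρ s) (ρ ∘ v) Finset.univ) 
        ⟨ρ s, n, ρ ∘ v, ratPoint_map hs ρ, fun j => ⟨v j, hv j, rfl⟩, rfl⟩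
      exact ⟨g, fun _ _ _ => ⟨h1, h2⟩⟩
    · exact ⟨0, fun _ i hi => (hF ⟨i, hi⟩).elim⟩
  choose G hG using hG
  exact main_step hQ hΛd hI hS hμ.1 hΛ' hs hv hprim hη hφ hpr hG

end

noncomputable section
variable {d n : ℕ} {Λ : AddSubgroup (Vd d)}

/-- polarization identity -/
lemma polar_identity (f : ContinuousMultilinearMap ℝ (fun _ : Fin n => Vd d) ℝ) (w : Fin n → Vd d) :
    ∑ T : Finset (Fin n), (-1 : ℝ) ^ T.card * f (fun _ => ∑ i ∈ Tᶜ, w i) =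
      ∑ σ : Equiv.Perm (Fin n), f (fun i => w (σ i)) := by
  have h1 : ∀ T : Finset (Fin n), (-1 : ℝ) ^ T.card * f (fun _ => ∑ i ∈ Tᶜ, w i) =
      ∑ r : Fin n → Fin n, if T ⊆ (Finset.univ.image r)ᶜ then (-1 : ℝ) ^ T.card * f (fun i => w (r i)) else 0 := by
    intro T
    rw [f.map_sum_finset (fun _ j => w j) (fun _ => Tᶜ), Finset.mul_sum, ← Finset.sum_filter]
    refine Finset.sum_congr ?_ fun _ _ => rfl
    ext r
    simp only [Fintype.mem_piFinset, Finset.mem_compl, Finset.mem_filter, Finset.mem_univ, true_and,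
      Finset.subset_iff, Finset.mem_image]
    exact ⟨fun h x hx ⟨i, hi⟩ => h i (hi ▸ hx), fun h i hi => h hi ⟨i, rfl⟩⟩
  rw [Finset.sum_congr rfl fun T _ => h1 T, Finset.sum_comm]
  have h2 : ∀ r : Fin n → Fin n, (∑ T : Finset (Fin n), if T ⊆ (Finset.univ.image r)ᶜ then
      (-1 : ℝ) ^ T.card * f (fun i => w (r i)) else 0) = 
      if Function.Bijective r then f (fun i => w (r i)) else 0 := by
    intro r
    rw [← Finset.sum_filter]
    have e : (Finset.univ.filter fun T : Finset (Fin n) => T ⊆ (Finset.univ.image r)ᶜ) = ((Finset.univ.image r)ᶜ).powerset := by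
      ext T; simp
    rw [e, ← Finset.sum_mul]
    have h3 := Finset.sum_powerset_neg_one_pow_card (x := (Finset.univ.image r)ᶜ)
    have h4 : ∑ T ∈ ((Finset.univ.image r)ᶜ).powerset, (-1 : ℝ) ^ T.card = 
        if (Finset.univ.image r)ᶜ = ∅ then 1 else 0 := by
      have := congrArg (fun z : ℤ => (z : ℝ)) h3
      push_cast at this
      simpa using this
    rw [h4]
    have h5 : (Finset.univ.image r)ᶜ = ∅ ↔ Function.Bijective r := by
      rw [← Finite.surjective_iff_bijective, Finset.compl_eq_empty_iff, Finset.eq_univ_iff_forall]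
      simp [Function.Surjective]
    by_cases hb : Function.Bijective r
    · rw [if_pos (h5.2 hb), if_pos hb, one_mul]
    · rw [if_neg (fun h => hb (h5.1 h)), if_neg hb, zero_mul]
  rw [Finset.sum_congr rfl fun r _ => h2 r, ← Finset.sum_filter]
  symm
  refine Finset.sum_bij (fun σ _ => (σ : Fin n → Fin n)) ?_ ?_ ?_ ?_
  · intro σ _; exact Finset.mem_filter.2 ⟨Finset.mem_univ _, σ.bijective⟩
  · intro σ _ τ _ h; exact Equiv.coe_fn_injective h
  · intro r hr
    exact ⟨Equiv.ofBijective r (Finset.mem_filter.1 hr).2, Finset.mem_univ _, rfl⟩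
  · intro σ _; rfl

/-- the symmetrization of a formal series -/
def symSer (p : FormalMultilinearSeries ℝ (Vd d) ℝ) : FormalMultilinearSeries ℝ (Vd d) ℝ := fun n =>
  ((n.factorial : ℝ)⁻¹) • ∑ σ : Equiv.Perm (Fin n), (p n).domDomCongr σ

lemma symSer_apply (p : FormalMultilinearSeries ℝ (Vd d) ℝ) (n : ℕ) (w : Fin n → Vd d) :
    symSer p n w = (n.factorial : ℝ)⁻¹ * ∑ σ : Equiv.Perm (Fin n), p n (fun i => w (σ i)) := by
  simp [symSer]

lemma symSer_diag (p : FormalMultilinearSeries ℝ (Vd d) ℝ) (n : ℕ) (x : Vd d) :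
    symSer p n (fun _ => x) = p n (fun _ => x) := by
  rw [symSer_apply]
  have : (n.factorial : ℝ) ≠ 0 := by positivity
  simp [Fintype.card_perm, this]

lemma symSer_has {g : Vd d → ℝ} {p : FormalMultilinearSeries ℝ (Vd d) ℝ} (h : HasFPowerSeriesAt g p 0) :
    HasFPowerSeriesAt g (symSer p) 0 := by
  obtain ⟨r, hr⟩ := h
  refine ⟨r, hr.r_le.trans (FormalMultilinearSeries.radius_le_of_le fun n => ?_), hr.r_pos, ?_⟩
  · have hn : (n.factorial : ℝ) ≠ 0 := by positivity
    calc ‖symSer p n‖ ≤ (n.factorial : ℝ)⁻¹ * ∑ σ : Equiv.Perm (Fin n), ‖(p n).domDomCongr σ‖ := by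
          rw [symSer, norm_smul, Real.norm_of_nonneg (by positivity)]
          gcongr
          exact norm_sum_le _ _
      _ = ‖p n‖ := by
          simp_rw [ContinuousMultilinearMap.norm_domDomCongr]
          simp [Fintype.card_perm, hn]
  · intro y hy
    have := hr.hasSum hy
    simpa only [symSer_diag] using this

lemma dual_sum {ι : Type*} (T : Finset ι) (w : ι → Vd d) (h : ∀ i ∈ T, IsDualIntegral Λ (w i)) :
    IsDualIntegral Λ (∑ i ∈ T, w i) := by
  intro x hx
  choose! m hm using fun i hi => h i hi x hx
  refine ⟨∑ i ∈ T, m i, ?_⟩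
  rw [pairE_sum_left]
  push_cast
  exact Finset.sum_congr rfl hm

lemma symSer_rat (p : FormalMultilinearSeries ℝ (Vd d) ℝ) (n : ℕ)
    (h : ∀ x, IsDualIntegral Λ x → ∃ q : ℚ, p n (fun _ => x) = q) (w : Fin n → Vd d)
    (hw : ∀ i, IsDualIntegral Λ (w i)) : ∃ q : ℚ, symSer p n w = q := by
  choose q hq using fun T : Finset (Fin n) => h _ (dual_sum Tᶜ w fun i _ => hw i)
  refine ⟨(n.factorial : ℚ)⁻¹ * ∑ T : Finset (Fin n), (-1) ^ T.card * q T, ?_⟩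
  rw [symSer_apply, ← polar_identity]
  push_cast
  simp_rw [hq]

lemma symSer_zero (p : FormalMultilinearSeries ℝ (Vd d) ℝ) (n : ℕ)
    (h : ∀ x, IsDualIntegral Λ x → p n (fun _ => x) = 0) (w : Fin n → Vd d)
    (hw : ∀ i, IsDualIntegral Λ (w i)) : symSer p n w = 0 := by
  rw [symSer_apply, ← polar_identity]
  rw [Finset.sum_eq_zero, mul_zero]
  intro T _
  rw [h _ (dual_sum Tᶜ w fun i _ => hw i), mul_zero]

lemma dual_span [DiscreteTopology Λ] : Submodule.span ℝ {x | IsDualIntegral Λ x} = ⊤ := by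
  rw [← Submodule.orthogonal_eq_bot_iff, Submodule.eq_bot_iff]
  intro x hx
  have hx' : ∀ y, IsDualIntegral Λ y → pairE y x = 0 := fun y hy =>
    (Submodule.mem_orthogonal _ _).1 hx y (Submodule.subset_span hy)
  obtain ⟨Φ, hΦ, hsep⟩ := exists_dual_sep Λ
  refine hsep x ?_ fun φ hφ => (hx' φ (hΦ φ hφ)).le
  rw [← Submodule.orthogonal_orthogonal (Submodule.span ℝ (Λ : Set (Vd d))), Submodule.mem_orthogonal]
  intro u hu
  refine hx' u fun y hy => ⟨0, ?_⟩
  have := (Submodule.mem_orthogonal _ _).1 hu y (Submodule.subset_span hy)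
  rw [pairE, real_inner_comm, this]; simp

/-- a series vanishing on the diagonals of the dual lattice vanishes on all diagonals -/
lemma diag_zero [DiscreteTopology Λ] (p : FormalMultilinearSeries ℝ (Vd d) ℝ) (n : ℕ)
    (h : ∀ x, IsDualIntegral Λ x → p n (fun _ => x) = 0) (x : Vd d) : p n (fun _ => x) = 0 := by
  have hs := (dual_span (Λ := Λ)).ge
  have key : (symSer p n).toMultilinearMap = 0 := by
    refine Module.Basis.ext_multilinear (fun _ => Module.Basis.ofSpan hs) fun v => ?_
    exact symSer_zero p n h _ fun i => Module.Basis.ofSpan_subset hs (mem_range_self _)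
  rw [← symSer_diag]
  exact congrArg (fun f => f (fun _ => x)) key

end

noncomputable section
variable {d n : ℕ} {Λ : AddSubgroup (Vd d)}

/-- the restriction of a formal series to a line -/
def lineSer (p : FormalMultilinearSeries ℝ (Vd d) ℝ) (x : Vd d) : PowerSeries ℝ :=
  PowerSeries.mk fun n => p n (fun _ => x)

lemma diag_smul (p : FormalMultilinearSeries ℝ (Vd d) ℝ) (n : ℕ) (t : ℝ) (x : Vd d) :
    p n (fun _ => t • x) = t ^ n * p n (fun _ => x) := by
  have := (p n).map_smul_univ (fun _ => t) (fun _ => x)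
  simpa using this

lemma lineSer_mul {f g k : Vd d → ℝ} {p q r : FormalMultilinearSeries ℝ (Vd d) ℝ}
    (hf : HasFPowerSeriesAt f p 0) (hg : HasFPowerSeriesAt g q 0) (hk : HasFPowerSeriesAt k r 0)
    (h : ∀ᶠ ξ in 𝓝 (0 : Vd d), f ξ * g ξ = k ξ) (x : Vd d) :
    lineSer p x * lineSer q x = lineSer r x := by
  have ht : Tendsto (fun t : ℝ => t • x) (𝓝 0) (𝓝 0) := by
    have : Tendsto (fun t : ℝ => t • x) (𝓝 0) (𝓝 ((0 : ℝ) • x)) :=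
      (continuous_id.smul continuous_const).tendsto _
    rwa [zero_smul] at this
  obtain ⟨rf, hf⟩ := hf
  obtain ⟨rg, hg⟩ := hg
  obtain ⟨rk, hk⟩ := hk
  have h1 : HasFPowerSeriesAt (fun t : ℝ => k (t • x))
      (FormalMultilinearSeries.ofScalars ℝ fun n => PowerSeries.coeff n (lineSer r x)) 0 := by
    rw [hasFPowerSeriesAt_iff]
    filter_upwards [ht.eventually (Metric.eball_mem_nhds 0 hk.r_pos)] with t h3
    have := hk.hasSum h3
    simp only [diag_smul, zero_add] at this
    simpa [FormalMultilinearSeries.coeff_ofScalars, lineSer] using this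
  have h2 : HasFPowerSeriesAt (fun t : ℝ => k (t • x))
      (FormalMultilinearSeries.ofScalars ℝ fun n => PowerSeries.coeff n (lineSer p x * lineSer q x)) 0 := by
    rw [hasFPowerSeriesAt_iff]
    filter_upwards [ht.eventually (Metric.eball_mem_nhds 0 hf.r_pos), ht.eventually (Metric.eball_mem_nhds 0 hg.r_pos),
      ht.eventually h] with t h3 h4 h5
    have a1 := hf.hasSum h3
    have a2 := hg.hasSum h4
    have b1 := p.summable_norm_apply (Metric.eball_subset_eball hf.r_le h3)
    have b2 := q.summable_norm_apply (Metric.eball_subset_eball hg.r_le h4)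
    have c1 := summable_norm_sum_mul_antidiagonal_of_summable_norm b1 b2
    have c2 := tsum_mul_tsum_eq_tsum_sum_antidiagonal_of_summable_norm b1 b2
    rw [a1.tsum_eq, a2.tsum_eq, zero_add, h5] at c2
    have c3 := c1.of_norm.hasSum
    rw [← c2] at c3
    simp only [FormalMultilinearSeries.coeff_ofScalars, zero_add, smul_eq_mul]
    convert c3 using 2 with m
    rw [PowerSeries.coeff_mul, Finset.mul_sum]
    refine Finset.sum_congr rfl fun ij hij => ?_
    rw [diag_smul, diag_smul, ← Finset.HasAntidiagonal.mem_antidiagonal.1 hij, pow_add, lineSer, lineSer, PowerSeries.coeff_mk,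
      PowerSeries.coeff_mk]
    ring
  have h3 := h2.eq_formalMultilinearSeries h1
  ext m
  have := congrArg (fun P => FormalMultilinearSeries.coeff P m) h3
  simpa [FormalMultilinearSeries.coeff_ofScalars] using this

/-- a real power series whose product with a nonzero rational power series is rational, is rational -/
lemma rat_quot {A H C : PowerSeries ℝ} (h : A * H = C) (hH0 : H ≠ 0)
    (hH : ∀ n, ∃ q : ℚ, PowerSeries.coeff n H = q) (hC : ∀ n, ∃ q : ℚ, PowerSeries.coeff n C = q) (n : ℕ) :
    ∃ q : ℚ, PowerSeries.coeff n A = q := by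
  obtain ⟨l, hl⟩ := exists_ratProj
  choose h' hh' using hH
  choose c' hc' using hC
  have e : (PowerSeries.mk fun n => ((l (PowerSeries.coeff n A) : ℚ) : ℝ)) * H = A * H := by
    rw [h]
    ext m
    have h1 := congrArg (PowerSeries.coeff m) h
    rw [PowerSeries.coeff_mul, hc'] at h1
    rw [hc', ← hl (c' m), ← h1, map_sum, PowerSeries.coeff_mul]
    push_cast
    refine Finset.sum_congr rfl fun ij _ => ?_
    rw [PowerSeries.coeff_mk, hh', ratProj_mul]
    push_cast
    rfl
  have e2 := mul_right_cancel₀ hH0 e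
  exact ⟨l (PowerSeries.coeff n A), by
    conv_lhs => rw [← e2]
    rw [PowerSeries.coeff_mk]⟩

lemma diag_poly (p : FormalMultilinearSeries ℝ (Vd d) ℝ) (n : ℕ) (x y : Vd d) :
    ∃ P : Polynomial ℝ, ∀ k : ℝ, P.eval k = p n (fun _ => x + k • y) := by
  refine ⟨∑ s : Finset (Fin n), Polynomial.C (p n (s.piecewise (fun _ => y) (fun _ => x))) * Polynomial.X ^ s.card, 
    fun k => ?_⟩
  have := (p n).map_add_univ (fun _ => k • y) (fun _ => x)
  have e : (fun _ : Fin n => x + k • y) = (fun _ => k • y) + (fun _ => x) := by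
    ext1 i; simp [add_comm]
  rw [e, this, Polynomial.eval_finsetSum]
  refine Finset.sum_congr rfl fun s _ => ?_
  have h2 := (p n).map_piecewise_smul (fun _ => k) (s.piecewise (fun _ => y) (fun _ => x)) s
  have e2 : (s.piecewise (fun i => k • (s.piecewise (fun _ => y) (fun _ => x) : Fin n → Vd d) i) 
      (s.piecewise (fun _ => y) (fun _ => x)) : Fin n → Vd d) = s.piecewise (fun _ => k • y) (fun _ => x) := by
    ext1 i
    by_cases hi : i ∈ s <;> simp [hi]
  rw [e2] at h2
  rw [h2, Polynomial.eval_mul, Polynomial.eval_C, Polynomial.eval_pow, Polynomial.eval_X, Finset.prod_const,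
    smul_eq_mul, mul_comm]

lemma poly_rat (P : Polynomial ℝ) (h : ∀ᶠ k : ℕ in atTop, ∃ q : ℚ, P.eval (k : ℝ) = q) :
    ∃ q : ℚ, P.eval 0 = q := by
  obtain ⟨l, hl⟩ := exists_ratProj
  set P' : Polynomial ℝ := ∑ i ∈ Finset.range (P.natDegree + 1), Polynomial.C ((l (P.coeff i) : ℚ) : ℝ) * Polynomial.X ^ i with hP'
  have key : P = P' := by
    obtain ⟨N, hN⟩ := eventually_atTop.1 h
    refine Polynomial.eq_of_infinite_eval_eq P P' ?_
    refine Set.Infinite.mono (s := (fun k : ℕ => (k : ℝ)) '' Set.Ici N) ?_ 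
      ((Set.Ici_infinite N).image (Nat.cast_injective.injOn))
    rintro _ ⟨k, hk, rfl⟩
    obtain ⟨q, hq⟩ := hN k hk
    show P.eval (k : ℝ) = P'.eval (k : ℝ)
    have h1 : l (P.eval (k : ℝ)) = ∑ i ∈ Finset.range (P.natDegree + 1), l (P.coeff i) * (k : ℚ) ^ i := by
      rw [Polynomial.eval_eq_sum_range, map_sum]
      refine Finset.sum_congr rfl fun i _ => ?_
      have := ratProj_mul l ((k : ℚ) ^ i) (P.coeff i)
      push_cast at this
      exact this
    rw [hq, hl] at h1
    rw [hq, h1, hP', Polynomial.eval_finsetSum]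
    push_cast
    simp
  refine ⟨l (P.coeff 0), ?_⟩
  conv_lhs => rw [key, hP']
  rw [Polynomial.eval_finsetSum, Finset.sum_range_succ']
  simp

lemma rat_series [DiscreteTopology Λ] {g h k : Vd d → ℝ} (hg : AnalyticAt ℝ g 0) (hh : HasRatSeriesAt0 Λ h)
    (hk : HasRatSeriesAt0 Λ k) (hne : ¬ ∀ᶠ ξ in 𝓝 (0 : Vd d), h ξ = 0)
    (heq : ∀ᶠ ξ in 𝓝 (0 : Vd d), g ξ * h ξ = k ξ) : HasRatSeriesAt0 Λ g := by
  obtain ⟨p, hp⟩ := hg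
  obtain ⟨q, hq, hqr⟩ := hh
  obtain ⟨r, hr, hrr⟩ := hk
  refine ⟨symSer p, symSer_has hp, fun n w hw => symSer_rat p n (fun x hx => ?_) w hw⟩
  have step1 : ∀ x, IsDualIntegral Λ x → (∃ m, q m (fun _ => x) ≠ 0) → ∀ n, ∃ c : ℚ, p n (fun _ => x) = c := by
    intro x hx ⟨m, hm⟩ n
    have := rat_quot (lineSer_mul hp hq hr heq x) (fun h0 => hm (by
      have := congrArg (PowerSeries.coeff m) h0
      simpa [lineSer] using this)) (fun n => by
        simpa [lineSer] using hqr n (fun _ => x) (fun _ => hx)) (fun n => by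
        simpa [lineSer] using hrr n (fun _ => x) (fun _ => hx)) n
    simpa [lineSer] using this
  obtain ⟨y, hy, m, hm⟩ : ∃ y, IsDualIntegral Λ y ∧ ∃ m, q m (fun _ => y) ≠ 0 := by
    by_contra! hcon
    apply hne
    obtain ⟨ρ, hρ⟩ := hq
    filter_upwards [Metric.eball_mem_nhds 0 hρ.r_pos] with ξ hξ
    have h1 := hρ.hasSum hξ
    have h2 : ∀ m, q m (fun _ => ξ) = 0 := fun m => diag_zero (Λ := Λ) q m (fun x hx => hcon x hx m) ξ
    simp only [h2, zero_add] at h1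
    exact h1.unique hasSum_zero
  obtain ⟨P, hP⟩ := diag_poly p n x y
  have hlim : Tendsto (fun k : ℕ => q m (fun _ => ((k : ℝ)⁻¹) • x + y)) atTop (𝓝 (q m (fun _ => y))) := by
    have h1 : Tendsto (fun k : ℕ => ((k : ℝ)⁻¹) • x + y) atTop (𝓝 ((0 : ℝ) • x + y)) :=
      (tendsto_inv_atTop_nhds_zero_nat.smul_const x).add_const y
    rw [zero_smul, zero_add] at h1
    exact ((q m).cont.tendsto _).comp (tendsto_pi_nhds.2 fun _ => h1)
  have := poly_rat P (by
    filter_upwards [hlim.eventually_ne hm, eventually_gt_atTop 0] with k hk hk0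
    rw [hP]
    have hk1 : (k : ℝ) ≠ 0 := by positivity
    have e : x + (k : ℝ) • y = (k : ℝ) • ((k : ℝ)⁻¹ • x + y) := by
      rw [smul_add, smul_smul, mul_inv_cancel₀ hk1, one_smul]
    refine step1 _ ?_ ⟨m, ?_⟩ n
    · intro z hz
      obtain ⟨a, ha⟩ := hx z hz
      obtain ⟨b, hb⟩ := hy z hz
      refine ⟨a + k * b, ?_⟩
      rw [pairE_add_left, pairE_smul_left, ha, hb]; push_cast; ring
    · rw [e, diag_smul]
      exact mul_ne_zero (pow_ne_zero _ hk1) hk)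
  rw [hP] at this
  simpa using this

end


/-- for every rational affine cone `a` in `V` or in a rational quotient of `V`,
the meromorphic function `μ(a)` is analytic near `0`, with rational Taylor coefficients with
respect to an integral basis. -/
theorem statement11 (d : ℕ) (Λ : AddSubgroup (Vd d)) (hΛ : IsFullLattice Λ)
    (Q : Vd d →ₗ[ℝ] Vd d →ₗ[ℝ] ℝ) (hQ : IsRatInner Λ Q)
    (I S μ : AddSubgroup (Vd d) → Set (Vd d) → Vd d → ℝ)
    (hI : IsIFamily Q Λ I) (hS : IsSFamily Q Λ S) (hμ : IsMuFamily Λ Q I S μ)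
    (Λ' : AddSubgroup (Vd d)) (hΛ' : IsQuotLattice Q Λ Λ')
    (a : Set (Vd d)) (ha : IsRatAffineCone Λ' a) :
    ∃ g : Vd d → ℝ, HasRatSeriesAt0 Λ' g ∧ MeroEqAt0 (μ Λ' a) g := by

  have hd := quot_disc hΛ hQ hΛ'
  by_cases hl : ContainsLine a
  · refine ⟨fun _ => 0, ⟨0, ?_, fun n w _ => ⟨0, by simp⟩⟩, ?_⟩
    · have := hasFPowerSeriesAt_const (𝕜 := ℝ) (c := (0 : ℝ)) (e := (0 : Vd d))
      rwa [constFormalMultilinearSeries_zero] at this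
    · rw [genF_iff]
      exact Eventually.of_forall (hμ.2 Λ' hΛ' a ha hl)
  obtain ⟨g, hg, hgμ⟩ := mu_analytic hΛ hQ hI hS hμ _ Λ' hΛ' rfl a ha
  refine ⟨g, ?_, hgμ⟩
  obtain ⟨k, h, hk, hh, hne, heq⟩ := hμ.1.1 Λ' hΛ' a ha hl
  obtain ⟨ph, hph, -⟩ := id hh
  obtain ⟨pk, hpk, -⟩ := id hk
  refine rat_series hg hh hk hne (genF_an (hg.mul hph.analyticAt) hpk.analyticAt ?_)
  filter_upwards [genF_iff.1 hgμ, genF_le heq, genF_ne hph.analyticAt hne] with ξ h1 h2 h3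
  rw [← h1]
  exact h2 h3
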